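/- For every q ≥ 1, every n, and every degree i ≥ 0 with 2i ≤ n − 4q, the group cohomology H^i(Aut(F_n); Λ^q H_Q^*) is zero, where Λ^q H_Q^* is the q-th exterior power of the rationalized dual of the abelianization of F_n. -/

import Mathlib

open CategoryTheory

noncomputable section

/-- The free group on `n` generators. -/
abbrev FreeGrp (n : ℕ) : Type := FreeGroup (Fin n)

/-- The automorphism group `Aut(F_n)` of the free group on `n` generators. -/
abbrev AutF (n : ℕ) : Type := MulAut (FreeGrp n)

/-- The abelianization `H = F_n/[F_n,F_n]`, written additively, as a `ℤ`-module. -/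
abbrev AbH (n : ℕ) : Type := Additive (Abelianization (FreeGrp n))

/-- The natural action of `Aut(F_n)` on the abelianization `H`, as a `ℤ`-linear
representation. -/
def abRep (n : ℕ) : Representation ℤ (AutF n) (AbH n) where
  toFun φ := (MonoidHom.toAdditive (Abelianization.map φ.toMonoidHom)).toIntLinearMap
  map_one' := by
    ext x
    show MonoidHom.toAdditive (Abelianization.map (MulEquiv.toMonoidHom (1 : AutF n))) x = x
    rw [show MulEquiv.toMonoidHom (1 : AutF n) = MonoidHom.id _ from rfl, Abelianization.map_id]
    rfl
  map_mul' φ ψ := by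
    ext x
    show MonoidHom.toAdditive (Abelianization.map (MulEquiv.toMonoidHom (φ * ψ))) x =
      MonoidHom.toAdditive (Abelianization.map φ.toMonoidHom)
        (MonoidHom.toAdditive (Abelianization.map ψ.toMonoidHom) x)
    rw [show MulEquiv.toMonoidHom (φ * ψ) = φ.toMonoidHom.comp ψ.toMonoidHom from rfl,
      ← Abelianization.map_comp]
    rfl

open scoped TensorProduct

section Rationalize

variable {G V : Type} [Group G] [AddCommGroup V] [Module ℤ V]

/-- Rationalization of a `ℤ`-linear representation: the induced `ℚ`-linear representation
on `ℚ ⊗[ℤ] V`. -/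
def ratRep (ρ : Representation ℤ G V) : Representation ℚ G (ℚ ⊗[ℤ] V) where
  toFun g := (ρ g).baseChange ℚ
  map_one' := by
    show (ρ 1).baseChange ℚ = 1
    rw [map_one, LinearMap.baseChange_one]
  map_mul' g g' := by
    show (ρ (g * g')).baseChange ℚ = (ρ g).baseChange ℚ * (ρ g').baseChange ℚ
    rw [map_mul, LinearMap.baseChange_mul]

end Rationalize

section ExtPower

variable {R M N : Type} [CommRing R] [AddCommGroup M] [Module R M] [AddCommGroup N] [Module R N]

lemma extPower_map_mem (f : M →ₗ[R] N) (q : ℕ) {x : ExteriorAlgebra R M}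
    (hx : x ∈ ⋀[R]^q M) : ExteriorAlgebra.map f x ∈ ⋀[R]^q N := by
  rw [← ExteriorAlgebra.ιMulti_span_fixedDegree] at hx ⊢
  induction hx using Submodule.span_induction with
  | mem y hy =>
      obtain ⟨m, rfl⟩ := hy
      rw [ExteriorAlgebra.map_apply_ιMulti]
      exact Submodule.subset_span ⟨f ∘ m, rfl⟩
  | zero => simp
  | add y z _ _ hy hz => rw [map_add]; exact Submodule.add_mem _ hy hz
  | smul r y _ hy => rw [map_smul]; exact Submodule.smul_mem _ r hy

/-- The map induced by a linear map on the `q`-th exterior powers. -/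
def extPowerMap (f : M →ₗ[R] N) (q : ℕ) : ⋀[R]^q M →ₗ[R] ⋀[R]^q N :=
  (ExteriorAlgebra.map f).toLinearMap.restrict (fun x hx => extPower_map_mem f q hx)

variable {G : Type} [Group G]

/-- The representation induced on the `q`-th exterior power of a representation. -/
def extPowerRep (ρ : Representation R G M) (q : ℕ) : Representation R G (⋀[R]^q M) where
  toFun g := extPowerMap (ρ g) q
  map_one' := by
    apply LinearMap.ext
    intro x
    apply Subtype.ext
    show ExteriorAlgebra.map (ρ 1) (x : ExteriorAlgebra R M) = (x : ExteriorAlgebra R M)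
    rw [map_one, show (1 : M →ₗ[R] M) = LinearMap.id from rfl, ExteriorAlgebra.map_id]
    rfl
  map_mul' g g' := by
    apply LinearMap.ext
    intro x
    apply Subtype.ext
    show ExteriorAlgebra.map (ρ (g * g')) (x : ExteriorAlgebra R M) =
      ExteriorAlgebra.map (ρ g) (ExteriorAlgebra.map (ρ g') (x : ExteriorAlgebra R M))
    rw [map_mul, show ρ g * ρ g' = (ρ g).comp (ρ g') from rfl,
      ← ExteriorAlgebra.map_comp_map]
    rfl

end ExtPower

/-- The rationalized dual `H_ℚ^* = H^* ⊗_ℤ ℚ` of the abelianization, as a `ℚ`-linear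
representation of `Aut(F_n)`. -/
def ratDualRep (n : ℕ) : Representation ℚ (AutF n) (ℚ ⊗[ℤ] Module.Dual ℤ (AbH n)) :=
  ratRep (abRep n).dual

/-- The `q`-th exterior power `Λ^q H_ℚ^*`, as an object of `Rep ℚ (Aut F_n)`. -/
def extPowerDualRep (n q : ℕ) : Rep ℚ (AutF n) :=
  Rep.of (extPowerRep (ratDualRep n) q)

namespace AutFree

set_option linter.unusedSectionVars false

section Words
variable {α : Type} [DecidableEq α]

/-- The opposite letter. -/
def lbar (u : α × Bool) : α × Bool := (u.1, !u.2)

@[simp] theorem lbar_lbar (u : α × Bool) : lbar (lbar u) = u := by simp [lbar]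

@[simp] theorem lbar_fst (u : α × Bool) : (lbar u).1 = u.1 := rfl

theorem lbar_ne (u : α × Bool) : lbar u ≠ u := by
  rcases u with ⟨a, _ | _⟩ <;> simp [lbar]

theorem ne_lbar (u : α × Bool) : u ≠ lbar u := (lbar_ne u).symm

/-- The element of the free group given by a letter. -/
def ltr (u : α × Bool) : FreeGroup α := FreeGroup.mk [u]

theorem ltr_inv (u : α × Bool) : (ltr u)⁻¹ = ltr (lbar u) := by
  simp [ltr, lbar, FreeGroup.inv_mk, FreeGroup.invRev]

theorem ltr_true (a : α) : ltr (a, true) = FreeGroup.of a := rfl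

theorem ltr_false (a : α) : ltr (a, false) = (FreeGroup.of a)⁻¹ := by
  rw [← ltr_true, ltr_inv]; rfl

@[simp] theorem ltr_mul_lbar (u : α × Bool) : ltr u * ltr (lbar u) = 1 := by
  rw [← ltr_inv, mul_inv_cancel]

@[simp] theorem lbar_mul_ltr (u : α × Bool) : ltr (lbar u) * ltr u = 1 := by
  rw [← ltr_inv, inv_mul_cancel]

/-- The elements whose reduced word starts with the letter `u`. -/
def half (u : α × Bool) : Set (FreeGroup α) := {g | g.toWord.head? = some u}

theorem one_notMem_half (u : α × Bool) : (1 : FreeGroup α) ∉ half u := by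
  simp [half]

theorem half_unique {u v : α × Bool} {g : FreeGroup α} (hu : g ∈ half u) (hv : g ∈ half v) :
    u = v := by
  simp only [half, Set.mem_ofPred_eq] at hu hv
  rw [hu] at hv; exact Option.some.inj hv

theorem toWord_ltr_mul {a : α × Bool} {g : FreeGroup α} (h : g ∉ half (lbar a)) :
    (ltr a * g).toWord = a :: g.toWord := by
  rw [FreeGroup.toWord_mul]
  simp only [ltr, FreeGroup.toWord_mk, FreeGroup.reduce_singleton, List.singleton_append]
  rw [FreeGroup.reduce.cons, FreeGroup.reduce_toWord]
  simp only [half, Set.mem_ofPred_eq] at h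
  cases hL : g.toWord with
  | nil => rfl
  | cons b L =>
    have hb : ¬ (a.1 = b.1 ∧ a.2 = !b.2) := by
      rintro ⟨h1, h2⟩
      apply h
      rw [hL]
      simp only [List.head?_cons, lbar, Option.some.injEq]
      ext <;> simp [h1, h2]
    simp [hb]

theorem left_induction {P : FreeGroup α → Prop} (h1 : P 1)
    (hs : ∀ a g, g ∉ half (lbar a) → P g → P (ltr a * g)) : ∀ g, P g := by
  have key : ∀ (L : List (α × Bool)), FreeGroup.IsReduced L → P (FreeGroup.mk L) := by
    intro L
    induction L with
    | nil => intro _; exact h1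
    | cons a L ih =>
      intro hL
      have hL' : FreeGroup.IsReduced L := List.IsChain.tail hL
      have : FreeGroup.mk (a :: L) = ltr a * FreeGroup.mk L := by
        simp [ltr]
      rw [this]
      refine hs a _ ?_ (ih hL')
      intro hh
      simp only [half, Set.mem_ofPred_eq, FreeGroup.toWord_mk, hL'.reduce_eq] at hh
      cases L with
      | nil => simp at hh
      | cons b L =>
        simp only [List.head?_cons, Option.some.injEq] at hh
        subst hh
        have := (FreeGroup.isReduced_cons_cons.1 hL).1 rfl
        rcases a with ⟨a, _ | _⟩ <;> simp [lbar] at this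
  intro g
  have := key g.toWord FreeGroup.isReduced_toWord
  rwa [FreeGroup.mk_toWord] at this

theorem right_induction {P : FreeGroup α → Prop} (h1 : P 1)
    (hs : ∀ w x, w⁻¹ ∉ half x → P w → P (w * ltr x)) : ∀ w, P w := by
  intro w
  have := left_induction (P := fun g => P g⁻¹) (by simpa using h1) (by
    intro a g hg hP
    rw [mul_inv_rev, ltr_inv]
    exact hs _ _ (by simpa using hg) hP) w⁻¹
  simpa using this

theorem ltr_mul_mem_half {a : α × Bool} {g : FreeGroup α} (h : g ∉ half (lbar a)) :
    ltr a * g ∈ half a := by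
  simp [half, toWord_ltr_mul h]

theorem ltr_mem_half (a : α × Bool) : ltr a ∈ half a := by
  simpa using ltr_mul_mem_half (one_notMem_half (lbar a))

theorem exists_half_of_ne_one {g : FreeGroup α} (h : g ≠ 1) : ∃ u, g ∈ half u := by
  cases hg : g.toWord with
  | nil => exact absurd (FreeGroup.toWord_eq_nil_iff.1 hg) h
  | cons b L => exact ⟨b, by simp [half, hg]⟩

/-- Left multiplication by a letter exchanges half-spaces. -/
theorem ltr_mul_mem_half_iff {a : α × Bool} {g : FreeGroup α} :
    ltr a * g ∈ half a ↔ g ∉ half (lbar a) := by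
  refine ⟨fun h hg => ?_, ltr_mul_mem_half⟩
  have hx : ltr a * g ∉ half (lbar (lbar a)) := by
    rw [lbar_lbar]
    revert hg h
    refine left_induction (P := fun g => ltr a * g ∈ half a → g ∈ half (lbar a) →
      ltr a * g ∉ half a) ?_ ?_ g
    · intro _ h; exact absurd h (one_notMem_half _)
    · intro b g hb _ h1 h2
      obtain rfl := half_unique h2 (ltr_mul_mem_half hb)
      rw [← mul_assoc, ltr_mul_lbar, one_mul]
      simpa using hb
  rw [lbar_lbar] at hx
  exact hx h

/-- Right multiplication by a letter only changes the first letter across one edge. -/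
theorem mem_half_mul_ltr {g : FreeGroup α} {u x : α × Bool} (h : ¬ (g ∈ half u ↔ g * ltr x ∈ half u)) :
    (g = 1 ∧ x = u) ∨ (g = ltr u ∧ x = lbar u) := by
  refine left_induction (P := fun g => ∀ u, ¬ (g ∈ half u ↔ g * ltr x ∈ half u) →
    (g = 1 ∧ x = u) ∨ (g = ltr u ∧ x = lbar u)) ?_ ?_ g u h
  · intro u h
    left
    refine ⟨rfl, ?_⟩
    by_contra hx
    apply h
    simp only [one_mul, one_notMem_half, false_iff]
    intro h'
    exact hx (half_unique (ltr_mem_half x) h')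
  · intro a g hg ih u h
    have h1 : ltr a * g ∈ half a := ltr_mul_mem_half hg
    by_cases h2 : g * ltr x ∈ half (lbar a)
    · have := ih (lbar a) (by tauto)
      rcases this with ⟨rfl, rfl⟩ | ⟨rfl, _⟩
      · right
        have : ¬ (ltr a ∈ half u ↔ (1 : FreeGroup α) ∈ half u) := by
          simpa [mul_assoc] using h
        have h3 : ltr a ∈ half u := by
          by_contra h3
          exact this ⟨fun h => absurd h h3, fun h => absurd h (one_notMem_half _)⟩
        obtain rfl := half_unique h3 (ltr_mem_half a)
        simp
      · exact absurd (ltr_mem_half _) hg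
    · have h3 : ltr a * (g * ltr x) ∈ half a := ltr_mul_mem_half h2
      rw [← mul_assoc] at h3
      exfalso
      apply h
      exact ⟨fun h' => half_unique h1 h' ▸ h3, fun h' => half_unique h3 h' ▸ h1⟩

theorem half_connected {u : α × Bool} {P : FreeGroup α → Prop}
    (h : ∀ g x, g ∈ half u → g * ltr x ∈ half u → (P g ↔ P (g * ltr x))) :
    ∀ g ∈ half u, (P g ↔ P (ltr u)) := by
  refine right_induction (P := fun g => g ∈ half u → (P g ↔ P (ltr u))) ?_ ?_
  · intro h; exact absurd h (one_notMem_half u)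
  · intro w x hw ih hm
    by_cases hwu : w ∈ half u
    · rw [← h w x hwu hm]; exact ih hwu
    · rcases mem_half_mul_ltr (g := w) (u := u) (x := x) (by tauto) with ⟨rfl, rfl⟩ | ⟨rfl, rfl⟩
      · simp
      · exact absurd (ltr_mem_half u) hwu

end Words

section Sets
variable {G : Type} [Group G]

/-- Left translate of a set. -/
def tr (g : G) (A : Set G) : Set G := {w | g⁻¹ * w ∈ A}

theorem mem_tr {g w : G} {A : Set G} : w ∈ tr g A ↔ g⁻¹ * w ∈ A := Iff.rfl

theorem tr_tr (g h : G) (A : Set G) : tr g (tr h A) = tr (g * h) A := by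
  ext w; simp [mem_tr, mul_assoc]

theorem tr_one (A : Set G) : tr 1 A = A := by
  ext w; simp [mem_tr]

theorem tr_compl (g : G) (A : Set G) : tr g Aᶜ = (tr g A)ᶜ := rfl

/-- The boundary edges of `A` entering `A` under right multiplication by `w`. -/
def dirSet (A : Set G) (w : G) : Set G := {g | g ∉ A ∧ g * w ∈ A}

theorem mem_dirSet {A : Set G} {w g : G} : g ∈ dirSet A w ↔ g ∉ A ∧ g * w ∈ A := Iff.rfl

/-- Almost invariant sets. -/
def AI (A : Set G) : Prop := ∀ w, (dirSet A w).Finite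

/-- The number of boundary edges entering `A` under right multiplication by `w`. -/
def dc (A : Set G) (w : G) : ℕ := (dirSet A w).ncard

theorem dirSet_compl (A : Set G) (w : G) :
    dirSet Aᶜ w = (fun g => g * w⁻¹) '' dirSet A w⁻¹ := by
  ext g
  constructor
  · intro ⟨h1, h2⟩
    exact ⟨g * w, ⟨h2, by simpa using h1⟩, by simp⟩
  · rintro ⟨g, ⟨h1, h2⟩, rfl⟩
    exact ⟨by simpa using h2, by simpa using h1⟩

theorem dc_compl (A : Set G) (w : G) : dc Aᶜ w = dc A w⁻¹ := by
  rw [dc, dirSet_compl, Set.ncard_image_of_injective _ (mul_left_injective _), dc]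

theorem AI.compl {A : Set G} (h : AI A) : AI Aᶜ := fun w => by
  rw [dirSet_compl]; exact (h _).image _

theorem dirSet_tr (h : G) (A : Set G) (w : G) :
    dirSet (tr h A) w = (fun g => h * g) '' dirSet A w := by
  ext g
  constructor
  · intro ⟨h1, h2⟩
    exact ⟨h⁻¹ * g, ⟨h1, by simpa [mem_tr, mul_assoc] using h2⟩, by simp⟩
  · rintro ⟨g, ⟨h1, h2⟩, rfl⟩
    exact ⟨by simpa [mem_tr] using h1, by simpa [mem_tr, mul_assoc] using h2⟩

theorem dc_tr (h : G) (A : Set G) (w : G) : dc (tr h A) w = dc A w := by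
  rw [dc, dirSet_tr, Set.ncard_image_of_injective _ (mul_right_injective _), dc]

theorem AI.tr {A : Set G} (h : AI A) (g : G) : AI (tr g A) := fun w => by
  rw [dirSet_tr]; exact (h _).image _

theorem dirSet_inter_union (A B : Set G) (w : G) :
    dirSet (A ∩ B) w ∪ dirSet (A ∪ B) w ⊆ dirSet A w ∪ dirSet B w ∧
    dirSet (A ∩ B) w ∩ dirSet (A ∪ B) w ⊆ dirSet A w ∩ dirSet B w := by
  constructor <;> intro g <;>
    simp only [mem_dirSet, Set.mem_union, Set.mem_inter_iff] <;> tauto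

theorem AI.inter {A B : Set G} (hA : AI A) (hB : AI B) : AI (A ∩ B) := fun w =>
  ((hA w).union (hB w)).subset
    (Set.subset_union_left.trans (dirSet_inter_union A B w).1)

theorem AI.union {A B : Set G} (hA : AI A) (hB : AI B) : AI (A ∪ B) := fun w =>
  ((hA w).union (hB w)).subset
    (Set.subset_union_right.trans (dirSet_inter_union A B w).1)

theorem dc_inter_add_union {A B : Set G} (hA : AI A) (hB : AI B) (w : G) :
    dc (A ∩ B) w + dc (A ∪ B) w ≤ dc A w + dc B w := by
  have h := dirSet_inter_union A B w
  rw [dc, dc, dc, dc, ← Set.ncard_union_add_ncard_inter _ _ (hA.inter hB w) (hA.union hB w),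
    ← Set.ncard_union_add_ncard_inter _ _ (hA w) (hB w)]
  exact add_le_add (Set.ncard_le_ncard h.1 ((hA w).union (hB w)))
    (Set.ncard_le_ncard h.2 ((hA w).inter_of_left _))

theorem AI.mul {A : Set G} {v w : G} (hv : (dirSet A v).Finite) (hw : (dirSet A w).Finite) :
    (dirSet A (v * w)).Finite := by
  refine (hv.union (hw.preimage (mul_left_injective v).injOn)).subset ?_
  intro g ⟨h1, h2⟩
  by_cases h : g * v ∈ A
  · exact Or.inl ⟨h1, h⟩
  · exact Or.inr ⟨h, by simpa [mul_assoc] using h2⟩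

/-- Image of a set under an automorphism. -/
def im (θ : MulAut G) (A : Set G) : Set G := {w | θ⁻¹ w ∈ A}

theorem mem_im {θ : MulAut G} {A : Set G} {w : G} : w ∈ im θ A ↔ θ⁻¹ w ∈ A := Iff.rfl

theorem im_compl (θ : MulAut G) (A : Set G) : im θ Aᶜ = (im θ A)ᶜ := rfl

theorem im_tr (θ : MulAut G) (g : G) (A : Set G) : im θ (tr g A) = tr (θ g) (im θ A) := by
  ext w; simp [mem_im, mem_tr]

theorem dirSet_im (θ : MulAut G) (A : Set G) (w : G) :
    dirSet (im θ A) w = θ '' dirSet A (θ⁻¹ w) := by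
  ext g
  constructor
  · intro ⟨h1, h2⟩
    exact ⟨θ⁻¹ g, ⟨h1, by simpa [mem_im] using h2⟩, by simp⟩
  · rintro ⟨g, ⟨h1, h2⟩, rfl⟩
    exact ⟨by simpa [mem_im] using h1, by simpa [mem_im] using h2⟩

theorem dc_im (θ : MulAut G) (A : Set G) (w : G) : dc (im θ A) w = dc A (θ⁻¹ w) := by
  rw [dc, dirSet_im, Set.ncard_image_of_injective _ θ.injective, dc]

theorem AI.im {A : Set G} (h : AI A) (θ : MulAut G) : AI (im θ A) := fun w => by
  rw [dirSet_im]; exact (h _).image _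

/-- The ray `h * w ^ k` eventually lies in `A`. -/
def endsIn (A : Set G) (h w : G) : Prop := ∀ᶠ k : ℕ in Filter.atTop, h * w ^ k ∈ A

theorem endsIn_or {A : Set G} (hA : AI A) (h : G) {w : G}
    (hw : Function.Injective fun k : ℕ => w ^ k) : endsIn A h w ∨ endsIn Aᶜ h w := by
  have hinj : Function.Injective fun k : ℕ => h * w ^ k :=
    (mul_right_injective h).comp hw
  have ht := hinj.tendsto_cofinite
  rw [Nat.cofinite_eq_atTop] at ht
  have h1 := ht.eventually (hA w).eventually_cofinite_notMem
  have h2 := ht.eventually (hA.compl w).eventually_cofinite_notMem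
  obtain ⟨K, hK⟩ := Filter.eventually_atTop.1 (h1.and h2)
  have step : ∀ k, K ≤ k → (h * w ^ K ∈ A ↔ h * w ^ k ∈ A) := by
    intro k hk
    induction k, hk using Nat.le_induction with
    | base => rfl
    | succ k hk ih =>
      rw [ih]
      have := hK k hk
      simp only [mem_dirSet, mul_assoc, ← pow_succ, Set.mem_compl_iff] at this
      tauto
  by_cases hm : h * w ^ K ∈ A
  · exact Or.inl (Filter.eventually_atTop.2 ⟨K, fun k hk => (step k hk).1 hm⟩)
  · exact Or.inr (Filter.eventually_atTop.2 ⟨K, fun k hk h' => hm ((step k hk).2 h')⟩)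

theorem not_endsIn_compl {A : Set G} {h w : G} (h1 : endsIn A h w) : ¬ endsIn Aᶜ h w := by
  intro h2
  obtain ⟨k, hk1, hk2⟩ := (h1.and h2).exists
  exact hk2 hk1

theorem endsIn_compl {A : Set G} (hA : AI A) (h : G) {w : G}
    (hw : Function.Injective fun k : ℕ => w ^ k) : endsIn Aᶜ h w ↔ ¬ endsIn A h w :=
  ⟨fun h1 h2 => not_endsIn_compl h2 h1, fun h1 => (endsIn_or hA h hw).resolve_left h1⟩

theorem endsIn_inter {A B : Set G} {h w : G} :
    endsIn (A ∩ B) h w ↔ endsIn A h w ∧ endsIn B h w := Filter.eventually_and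

theorem endsIn_union {A B : Set G} (hA : AI A) (hB : AI B) {h w : G}
    (hw : Function.Injective fun k : ℕ => w ^ k) :
    endsIn (A ∪ B) h w ↔ endsIn A h w ∨ endsIn B h w := by
  have : A ∪ B = (Aᶜ ∩ Bᶜ)ᶜ := by simp [Set.compl_inter]
  rw [this, endsIn_compl (hA.compl.inter hB.compl) h hw, endsIn_inter, endsIn_compl hA h hw,
    endsIn_compl hB h hw]
  tauto

theorem endsIn_tr {A : Set G} {g h w : G} : endsIn (tr g A) h w ↔ endsIn A (g⁻¹ * h) w := by
  simp [endsIn, mem_tr, mul_assoc]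

/-- The set `A` separates the two ends of the line through `h` in the direction `w`. -/
def Sep (A : Set G) (h w : G) : Prop := ¬ (endsIn A h w ↔ endsIn A h w⁻¹)

/-- All four corners of the two sets are nonempty. -/
def Crossing (A E : Set G) : Prop :=
  (A ∩ E).Nonempty ∧ (A ∩ Eᶜ).Nonempty ∧ (Aᶜ ∩ E).Nonempty ∧ (Aᶜ ∩ Eᶜ).Nonempty

theorem Crossing.compl_right {A E : Set G} (h : Crossing A E) : Crossing A Eᶜ :=
  ⟨h.2.1, by simpa using h.1, h.2.2.2, by simpa using h.2.2.1⟩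

theorem Crossing.compl_left {A E : Set G} (h : Crossing A E) : Crossing Aᶜ E :=
  ⟨h.2.2.1, h.2.2.2, by simpa using h.1, by simpa using h.2.1⟩

theorem crossing_compl_right {A E : Set G} : Crossing A Eᶜ ↔ Crossing A E :=
  ⟨fun h => by simpa using h.compl_right, fun h => h.compl_right⟩

theorem crossing_compl_left {A E : Set G} : Crossing Aᶜ E ↔ Crossing A E :=
  ⟨fun h => by simpa using h.compl_left, fun h => h.compl_left⟩

theorem not_crossing_iff {A E : Set G} :
    ¬ Crossing A E ↔ A ⊆ Eᶜ ∨ A ⊆ E ∨ E ⊆ A ∨ Eᶜ ⊆ A := by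
  simp only [Crossing, Set.Nonempty, Set.subset_def, Set.mem_inter_iff, Set.mem_compl_iff]
  constructor
  · intro h
    by_contra hc
    push Not at hc
    obtain ⟨⟨a, h1, h2⟩, ⟨b, h3, h4⟩, ⟨c, h5, h6⟩, ⟨d, h7, h8⟩⟩ := hc
    exact h ⟨⟨a, h1, h2⟩, ⟨b, h3, h4⟩, ⟨c, h6, h5⟩, ⟨d, h8, h7⟩⟩
  · rintro (h | h | h | h) ⟨⟨a, h1, h2⟩, ⟨b, h3, h4⟩, ⟨c, h5, h6⟩, ⟨d, h7, h8⟩⟩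
    · exact h a h1 h2
    · exact h4 (h b h3)
    · exact h5 (h c h6)
    · exact h7 (h d h8)

/-- Corners of crossing sets remain nested with the sets nested with both. -/
theorem not_crossing_inter {A E B : Set G} (hAE : Crossing A E) (hA : ¬ Crossing A B)
    (hE : ¬ Crossing E B) : ¬ Crossing (A ∩ E) B := by
  rw [not_crossing_iff] at *
  obtain ⟨⟨a, ha⟩, ⟨b, hb⟩, ⟨c, hc⟩, ⟨d, hd⟩⟩ := hAE
  simp only [Set.subset_def, Set.mem_inter_iff, Set.mem_compl_iff] at *
  rcases hA with h | h | h | h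
  · exact Or.inl fun x hx => h x hx.1
  · exact Or.inr (Or.inl fun x hx => h x hx.1)
  · rcases hE with h' | h' | h' | h'
    · exact Or.inl fun x hx => h' x hx.2
    · exact Or.inr (Or.inl fun x hx => h' x hx.2)
    · exact Or.inr (Or.inr (Or.inl fun x hx => ⟨h x hx, h' x hx⟩))
    · exfalso
      by_cases hdB : d ∈ B
      · exact hd.1 (h d hdB)
      · exact hd.2 (h' d hdB)
  · rcases hE with h' | h' | h' | h'
    · exact Or.inl fun x hx => h' x hx.2
    · exact Or.inr (Or.inl fun x hx => h' x hx.2)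
    · exfalso
      by_cases hdB : d ∈ B
      · exact hd.2 (h' d hdB)
      · exact hd.1 (h d hdB)
    · exact Or.inr (Or.inr (Or.inr fun x hx => ⟨h x hx, h' x hx⟩))

theorem not_crossing_union {A E B : Set G} (hAE : Crossing A E) (hA : ¬ Crossing A B)
    (hE : ¬ Crossing E B) : ¬ Crossing (A ∪ E) B := by
  rw [← crossing_compl_left, Set.compl_union]
  refine not_crossing_inter hAE.compl_left.compl_right ?_ ?_ <;>
    rwa [crossing_compl_left]

end Sets

section HalfSpaces
variable {α : Type} [DecidableEq α]

theorem compl_half (u : α × Bool) : (half u)ᶜ = tr (ltr u) (half (lbar u)) := by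
  ext w
  rw [mem_tr, ltr_inv, ltr_mul_mem_half_iff, lbar_lbar]; rfl

theorem compl_tr_half (g : FreeGroup α) (u : α × Bool) :
    (tr g (half u))ᶜ = tr (g * ltr u) (half (lbar u)) := by
  rw [← tr_compl, compl_half, tr_tr]

theorem dirSet_half_ltr (u x : α × Bool) : dirSet (half u) (ltr x) = if x = u then {1} else ∅ := by
  ext g
  rw [mem_dirSet]
  constructor
  · intro ⟨h1, h2⟩
    rcases mem_half_mul_ltr (g := g) (u := u) (x := x) (by tauto) with ⟨rfl, rfl⟩ | ⟨rfl, rfl⟩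
    · simp
    · exact absurd (ltr_mem_half u) h1
  · split_ifs with h
    · rintro rfl
      subst h
      exact ⟨one_notMem_half _, by simpa using ltr_mem_half x⟩
    · intro h; exact h.elim

theorem AI_half (u : α × Bool) : AI (half u) := by
  refine right_induction ?_ ?_
  · have : dirSet (half u) 1 = ∅ := by ext g; simp [mem_dirSet]
    rw [this]; exact Set.finite_empty
  · intro w x _ h
    refine AI.mul h ?_
    rw [dirSet_half_ltr]
    split_ifs
    · exact Set.finite_singleton _
    · exact Set.finite_empty

theorem tr_half_connected {g : FreeGroup α} {u : α × Bool} {P : FreeGroup α → Prop}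
    (h : ∀ w x, w ∈ tr g (half u) → w * ltr x ∈ tr g (half u) → (P w ↔ P (w * ltr x))) :
    ∀ w ∈ tr g (half u), (P w ↔ P (g * ltr u)) := by
  intro w hw
  have := half_connected (u := u) (P := fun v => P (g * v)) (by
    intro v x hv hvx
    have := h (g * v) x (by simpa [mem_tr] using hv) (by simpa [mem_tr, mul_assoc] using hvx)
    simpa [mul_assoc] using this) (g⁻¹ * w) hw
  simpa using this

/-- Half-spaces are pairwise nested. -/
theorem not_crossing_half (u v : α × Bool) (h : FreeGroup α) :
    ¬ Crossing (half u) (tr h (half v)) := by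
  intro hc
  have key : ∀ (g : FreeGroup α) (v : α × Bool), (half u ∩ tr g (half v)).Nonempty →
      ((half u)ᶜ ∩ tr g (half v)).Nonempty → (1 : FreeGroup α) ∈ tr g (half v) := by
    intro g v ⟨a, ha1, ha2⟩ ⟨b, hb1, hb2⟩
    by_contra h1
    have := tr_half_connected (g := g) (u := v) (P := fun w => w ∈ half u) (by
      intro w x hw hwx
      by_contra hne
      rcases mem_half_mul_ltr hne with ⟨rfl, rfl⟩ | ⟨rfl, rfl⟩
      · exact h1 hw
      · rw [ltr_mul_lbar] at hwx; exact h1 hwx)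
    exact hb1 ((this b hb2).2 ((this a ha2).1 ha1))
  have h1 := key h v hc.1 hc.2.2.1
  have h2 := key (h * ltr v) (lbar v) (by rw [← compl_tr_half]; exact hc.2.1)
    (by rw [← compl_tr_half]; exact hc.2.2.2)
  rw [← compl_tr_half] at h2
  exact h2 h1

theorem crossing_tr_iff {G : Type} [Group G] {A E : Set G} (g : G) :
    Crossing (tr g A) (tr g E) ↔ Crossing A E := by
  have key : ∀ {A E : Set G} (g : G), (A ∩ E).Nonempty → (tr g A ∩ tr g E).Nonempty := by
    rintro A E g ⟨x, h1, h2⟩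
    exact ⟨g * x, by simpa [mem_tr] using h1, by simpa [mem_tr] using h2⟩
  have key2 : ∀ {A E : Set G} (g : G), Crossing A E → Crossing (tr g A) (tr g E) :=
    fun g h => ⟨key g h.1, key g h.2.1, key g h.2.2.1, key g h.2.2.2⟩
  refine ⟨fun h => ?_, key2 g⟩
  have := key2 g⁻¹ h
  simpa [tr_tr, tr_one] using this

theorem not_crossing_tr_half (u v : α × Bool) (g h : FreeGroup α) :
    ¬ Crossing (tr g (half u)) (tr h (half v)) := by
  have : tr h (half v) = tr g (tr (g⁻¹ * h) (half v)) := by simp [tr_tr]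
  rw [this, crossing_tr_iff]
  exact not_crossing_half _ _ _

/-- The half-spaces crossing a set. -/
def crossings (A : Set (FreeGroup α)) : Set (FreeGroup α × (α × Bool)) :=
  {p | Crossing A (tr p.1 (half p.2))}

theorem finite_crossings [Finite α] {A : Set (FreeGroup α)} (hA : AI A) :
    (crossings A).Finite := by
  classical
  -- the finite set of end points of boundary edges
  let S : Set (FreeGroup α) := ⋃ x : α × Bool, (dirSet A (ltr x) ∪ dirSet Aᶜ (ltr x))
  have hS : S.Finite := Set.finite_iUnion fun x => (hA _).union (hA.compl _)
  have key : ∀ (g : FreeGroup α) (u : α × Bool), (A ∩ tr g (half u)).Nonempty →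
      (Aᶜ ∩ tr g (half u)).Nonempty → ∃ s ∈ S, s ∈ tr g (half u) := by
    intro g u ⟨a, ha1, ha2⟩ ⟨b, hb1, hb2⟩
    by_contra hc
    push Not at hc
    have := tr_half_connected (g := g) (u := u) (P := fun w => w ∈ A) (by
      intro w x hw hwx
      by_contra hne
      refine hc w (Set.mem_iUnion.2 ⟨x, ?_⟩) hw
      simp only [Set.mem_union, mem_dirSet, Set.mem_compl_iff]
      tauto)
    exact hb1 ((this b hb2).2 ((this a ha2).1 ha1))
  have hfin : ∀ a b : FreeGroup α, ∀ u : α × Bool,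
      {g : FreeGroup α | a ∈ tr g (half u) ∧ b ∉ tr g (half u)}.Finite := by
    intro a b u
    have := ((AI_half u).compl (a⁻¹ * b)).preimage
      (f := fun g : FreeGroup α => g⁻¹ * a) (fun x _ y _ h => by simpa using h)
    refine this.subset ?_
    intro g ⟨h1, h2⟩
    exact ⟨by simpa [mem_tr] using h1, by simpa [mem_tr, mul_assoc] using h2⟩
  have : crossings A ⊆ ⋃ a ∈ S, ⋃ b ∈ S, ⋃ u : α × Bool,
      {g : FreeGroup α | a ∈ tr g (half u) ∧ b ∉ tr g (half u)} ×ˢ {u} := by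
    rintro ⟨g, u⟩ h
    obtain ⟨a, haS, ha⟩ := key g u h.1 h.2.2.1
    obtain ⟨b, hbS, hb⟩ := key (g * ltr u) (lbar u) (by rw [← compl_tr_half]; exact h.2.1)
      (by rw [← compl_tr_half]; exact h.2.2.2)
    rw [← compl_tr_half] at hb
    simp only [Set.mem_iUnion]
    exact ⟨a, haS, b, hbS, u, ⟨ha, hb⟩, rfl⟩
  refine Set.Finite.subset ?_ this
  exact hS.biUnion fun a _ => hS.biUnion fun b _ => Set.finite_iUnion fun u =>
    (hfin a b u).prod (Set.finite_singleton u)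

/-- The exponent sum of a generator. -/
def expo (a : α) : FreeGroup α →* Multiplicative ℤ :=
  FreeGroup.lift fun b => Multiplicative.ofAdd (if b = a then 1 else 0)

theorem ltr_pow_injective (u : α × Bool) : Function.Injective fun k : ℕ => ltr u ^ k := by
  have h1 : ∀ a : α, Function.Injective fun k : ℕ => (FreeGroup.of a) ^ k := by
    intro a k l h
    have := congrArg (fun w => Multiplicative.toAdd (expo a w)) h
    simpa [expo] using this
  rcases u with ⟨a, _ | _⟩
  · rw [ltr_false]
    intro k l h
    apply h1 a
    simpa using h
  · exact h1 a

end HalfSpaces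

section RelativeWhitehead
variable {α : Type} [DecidableEq α]

theorem ltr_pow_succ_mem_half (u : α × Bool) (n : ℕ) : ltr u ^ (n + 1) ∈ half u := by
  induction n with
  | zero => simpa using ltr_mem_half u
  | succ n ih =>
    rw [pow_succ']
    exact ltr_mul_mem_half fun h => ne_lbar u (half_unique ih h)

theorem ltr_pow_notMem_half (u : α × Bool) (n : ℕ) : ltr (lbar u) ^ n ∉ half u := by
  cases n with
  | zero => simpa using one_notMem_half u
  | succ n => exact fun h => ne_lbar u (half_unique h (ltr_pow_succ_mem_half _ n))

theorem endsIn_tr_half (g : FreeGroup α) (u : α × Bool) : endsIn (tr g (half u)) g (ltr u) := by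
  rw [endsIn_tr, inv_mul_cancel]
  refine Filter.eventually_atTop.2 ⟨1, fun k hk => ?_⟩
  obtain ⟨k, rfl⟩ := Nat.exists_eq_add_of_le' hk
  simpa using ltr_pow_succ_mem_half u k

theorem not_endsIn_tr_half (g : FreeGroup α) (u : α × Bool) :
    ¬ endsIn (tr g (half u)) g (ltr (lbar u)) := by
  rw [endsIn_tr, inv_mul_cancel]
  intro h
  obtain ⟨k, hk⟩ := h.exists
  exact ltr_pow_notMem_half u k (by simpa using hk)

theorem endsIn_shift {A : Set (FreeGroup α)} {h w : FreeGroup α} (j : ℕ) :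
    endsIn A (h * w ^ j) w ↔ endsIn A h w := by
  unfold endsIn
  have : (fun k : ℕ => h * w ^ j * w ^ k ∈ A) = fun k => h * w ^ (k + j) ∈ A := by
    funext k; rw [mul_assoc, ← pow_add, add_comm]
  rw [this, ← Filter.eventually_map (m := fun k : ℕ => k + j) (P := fun k => h * w ^ k ∈ A),
    Filter.map_add_atTop_eq_nat]

theorem endsIn_shift_inv {A : Set (FreeGroup α)} {h w : FreeGroup α} (j : ℕ) :
    endsIn A (h * w⁻¹ ^ j) w ↔ endsIn A h w := by
  rw [← endsIn_shift j]; simp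

theorem exists_switch {P : ℕ → Prop} {N : ℕ} (h0 : ¬ P 0) (hN : P N) :
    ∃ m, ¬ P m ∧ P (m + 1) := by
  by_contra hc
  push Not at hc
  have : ∀ m, ¬ P m := fun m => by
    induction m with
    | zero => exact h0
    | succ m ih => exact hc m ih
  exact this N hN

/-- A half-space separating a line in direction `u` is bounded by an edge labelled `u`. -/
theorem eq_of_separates {g h : FreeGroup α} {u v : α × Bool}
    (h1 : endsIn (tr g (half v)) h (ltr u)) (h2 : ¬ endsIn (tr g (half v)) h (ltr (lbar u))) :
    v = u := by
  obtain ⟨K, hK⟩ : ∃ K, h * ltr (lbar u) ^ K ∉ tr g (half v) := by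
    by_contra hc; push Not at hc
    exact h2 (Filter.Eventually.of_forall hc)
  have h3 : endsIn (tr g (half v)) (h * (ltr (lbar u)) ^ K) (ltr u) := by
    rw [← ltr_inv, endsIn_shift_inv]; exact h1
  obtain ⟨N, hN⟩ := h3.exists
  obtain ⟨m, hm1, hm2⟩ := exists_switch
    (P := fun m => h * ltr (lbar u) ^ K * ltr u ^ m ∈ tr g (half v)) (by simpa using hK) hN
  rw [pow_succ, ← mul_assoc, mem_tr, ← mul_assoc] at hm2
  rw [mem_tr] at hm1
  rcases mem_half_mul_ltr (g := g⁻¹ * (h * ltr (lbar u) ^ K * ltr u ^ m)) (u := v) (x := u)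
    (fun h => hm1 (h.2 hm2)) with ⟨_, h⟩ | ⟨h, _⟩
  · exact h.symm
  · rw [h] at hm1; exact absurd (ltr_mem_half v) hm1

/-- The union of half-spaces at the base point indexed by a set of letters. -/
def halfU (U : Set (α × Bool)) : Set (FreeGroup α) := {g | ∃ v ∈ U, g ∈ half v}

variable {Λ : Type} [AddCommGroup Λ] [LinearOrder Λ] [IsOrderedAddMonoid Λ]
  {ν : Set (FreeGroup α) → Λ}

theorem nu_half_lbar (htr : ∀ g A, ν (tr g A) = ν A) (hc : ∀ A, ν Aᶜ = ν A) (u : α × Bool) :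
    ν (half (lbar u)) = ν (half u) := by
  rw [← hc (half u), compl_half, htr]

theorem nu_le_of_uncrossed (htr : ∀ g A, ν (tr g A) = ν A) (hc : ∀ A, ν Aᶜ = ν A)
    {u : α × Bool}
    (irr : ∀ u' : α × Bool, u'.1 = u.1 → ∀ U : Set (α × Bool), u' ∈ U → lbar u' ∉ U →
      ν (half u') ≤ ν (halfU U))
    {A : Set (FreeGroup α)} (hA : AI A) (hcr : ∀ g v, ¬ Crossing A (tr g (half v)))
    {h : FreeGroup α} (h1 : endsIn A h (ltr u)) (h2 : ¬ endsIn A h (ltr (lbar u))) :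
    ν (half u) ≤ ν A := by
  -- a translate of `A` lies between two adjacent half-spaces
  obtain ⟨B, hνB, hBcr, hB1, hB2⟩ : ∃ B : Set (FreeGroup α), ν B = ν A ∧
      (∀ g v, ¬ Crossing B (tr g (half v))) ∧ half u ⊆ B ∧ B ⊆ (half (lbar u))ᶜ := by
    obtain ⟨K, hK⟩ : ∃ K, h * ltr (lbar u) ^ K ∉ A := by
      by_contra hc; push Not at hc
      exact h2 (Filter.Eventually.of_forall hc)
    set h0 := h * ltr (lbar u) ^ K * ltr (lbar u) with hh0
    have e1 : endsIn A h0 (ltr u) := by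
      rw [hh0, mul_assoc, ← pow_succ, ← ltr_inv, endsIn_shift_inv]; exact h1
    have e2 : ¬ endsIn A h0 (ltr (lbar u)) := by
      rw [hh0, mul_assoc, ← pow_succ, endsIn_shift]; exact h2
    have alt : ∀ m : ℕ, tr (h0 * ltr u ^ m) (half u) ⊆ A ∨ A ⊆ tr (h0 * ltr u ^ m) (half u) := by
      intro m
      have f1 : endsIn (tr (h0 * ltr u ^ m) (half u)) h0 (ltr u) := by
        rw [← endsIn_shift m]; exact endsIn_tr_half _ _
      have f2 : ¬ endsIn (tr (h0 * ltr u ^ m) (half u)) h0 (ltr (lbar u)) := by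
        rw [← endsIn_shift_inv m, ltr_inv, lbar_lbar]; exact not_endsIn_tr_half _ _
      rcases not_crossing_iff.1 (hcr (h0 * ltr u ^ m) u) with h | h | h | h
      · obtain ⟨k, hk1, hk2⟩ := (e1.and f1).exists
        exact absurd hk2 (h hk1)
      · exact Or.inr h
      · exact Or.inl h
      · exfalso
        rw [← endsIn_compl hA _ (ltr_pow_injective _)] at e2
        rw [← endsIn_compl ((AI_half u).tr _) _ (ltr_pow_injective _)] at f2
        obtain ⟨k, hk1, hk2⟩ := (e2.and f2).exists
        exact hk1 (h hk2)
    obtain ⟨N, hN⟩ := e1.exists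
    obtain ⟨m, hm1, hm2⟩ := exists_switch
      (P := fun m => ¬ A ⊆ tr (h0 * ltr u ^ m) (half u)) (N := N) (by
        rw [not_not]
        refine (alt 0).resolve_left fun hs => hK ?_
        have := @hs (h0 * ltr u) (by simpa [mem_tr] using ltr_mem_half u)
        simpa [hh0, mul_assoc] using this) (by
        intro hs
        have := hs hN
        rw [mem_tr, inv_mul_cancel] at this
        exact one_notMem_half u this)
    rw [not_not] at hm1
    have hm3 := (alt (m + 1)).resolve_right hm2
    refine ⟨tr (h0 * ltr u ^ (m + 1))⁻¹ A, htr _ _, ?_, ?_, ?_⟩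
    · intro g v
      rw [← crossing_tr_iff (h0 * ltr u ^ (m + 1)), tr_tr, tr_tr, mul_inv_cancel, tr_one]
      exact hcr _ _
    · intro w hw
      rw [mem_tr, inv_inv]
      apply hm3
      rw [mem_tr, inv_mul_cancel_left]
      exact hw
    · intro w hw
      rw [mem_tr, inv_inv] at hw
      have := hm1 hw
      rw [mem_tr, pow_succ] at this
      have h3 : ltr u * w ∈ half u := by
        simpa [mul_assoc] using this
      exact ltr_mul_mem_half_iff.1 h3
  rw [← hνB]
  -- hence it is a union of half-spaces at the base point
  set U : Set (α × Bool) := {v | half v ⊆ B} with hU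
  have hsub : ∀ v, half v ⊆ B ∨ ∀ w ∈ half v, w ∉ B := by
    intro v
    by_cases hv : v = lbar u
    · right; rintro w hw hwB
      rw [hv] at hw
      exact hB2 hwB hw
    by_cases hvu : v = u
    · left; rw [hvu]; exact hB1
    have := hBcr 1 v
    rw [tr_one] at this
    rcases not_crossing_iff.1 this with h | h | h | h
    · right; exact fun w hw hwB => h hwB hw
    · exact absurd (half_unique (ltr_mem_half u) (h (hB1 (ltr_mem_half u)))).symm hvu
    · exact Or.inl h
    · exfalso
      refine hB2 (h ?_) (ltr_mem_half (lbar u))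
      exact fun hw => hv (half_unique hw (ltr_mem_half (lbar u)))
  have hmem : ∀ w : FreeGroup α, w ≠ 1 → (w ∈ B ↔ w ∈ halfU U) := by
    intro w hw
    obtain ⟨v, hv⟩ := exists_half_of_ne_one hw
    constructor
    · intro hwB
      refine ⟨v, (hsub v).resolve_right fun h => h w hv hwB, hv⟩
    · rintro ⟨v', hv', hw'⟩
      exact hv' hw'
  have huU : u ∈ U := hB1
  have hubU : lbar u ∉ U := fun h => hB2 (h (ltr_mem_half _)) (ltr_mem_half _)
  by_cases h1B : (1 : FreeGroup α) ∈ B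
  · have : Bᶜ = halfU Uᶜ := by
      ext w
      by_cases hw : w = 1
      · subst hw
        simp only [Set.mem_compl_iff, h1B, not_true, false_iff]
        rintro ⟨v, _, hv⟩
        exact one_notMem_half v hv
      · rw [Set.mem_compl_iff, hmem w hw]
        obtain ⟨v, hv⟩ := exists_half_of_ne_one hw
        constructor
        · intro h
          exact ⟨v, fun hvU => h ⟨v, hvU, hv⟩, hv⟩
        · rintro ⟨v', hv', hw'⟩ ⟨v'', hv'', hw''⟩
          rw [half_unique hw' hw''] at hv'
          exact hv' hv''
    rw [← hc B, this, ← nu_half_lbar htr hc]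
    exact irr (lbar u) rfl Uᶜ hubU (by simpa using huU)
  · have : B = halfU U := by
      ext w
      by_cases hw : w = 1
      · subst hw
        simp only [h1B, false_iff]
        rintro ⟨v, _, hv⟩
        exact one_notMem_half v hv
      · exact hmem w hw
    rw [this]
    exact irr u rfl _ huU hubU

/-- Relative form of Whitehead's peak reduction: if no Whitehead move at a letter over `Z`
reduces `ν`, every almost invariant set separating a line in a direction over `Z` is at least
as large as the corresponding half-space. -/
theorem nu_half_le [Finite α] (htr : ∀ g A, ν (tr g A) = ν A) (hc : ∀ A, ν Aᶜ = ν A)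
    (hsub : ∀ A B, AI A → AI B → ν (A ∩ B) + ν (A ∪ B) ≤ ν A + ν B) {Z : Set α}
    (irr : ∀ u : α × Bool, u.1 ∈ Z → ∀ U : Set (α × Bool), u ∈ U → lbar u ∉ U →
      ν (half u) ≤ ν (halfU U)) :
    ∀ (n : ℕ) (A : Set (FreeGroup α)), (crossings A).ncard = n → AI A →
    (∀ (u : α × Bool) g, u.1 ∉ Z → ¬ Crossing A (tr g (half u))) →
    ∀ (h : FreeGroup α) (u : α × Bool), u.1 ∈ Z → endsIn A h (ltr u) →
      ¬ endsIn A h (ltr (lbar u)) → ν (half u) ≤ ν A := by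
  intro n
  induction n using Nat.strong_induction_on with
  | _ n ih =>
  intro A hn hA hJ h u hu h1 h2
  by_cases hcr : ∀ g v, ¬ Crossing A (tr g (half v))
  · exact nu_le_of_uncrossed htr hc (fun u' hu' => irr u' (hu' ▸ hu)) hA hcr h1 h2
  push Not at hcr
  -- corners have fewer crossings
  have corner : ∀ B g v, (B = A ∨ B = Aᶜ) → Crossing A (tr g (half v)) →
      ∀ C, (C = B ∩ tr g (half v) ∨ C = B ∪ tr g (half v)) →
      ∀ (h : FreeGroup α) (u : α × Bool), u.1 ∈ Z → endsIn C h (ltr u) →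
      ¬ endsIn C h (ltr (lbar u)) → ν (half u) ≤ ν C := by
    intro B g v hB hcv C hC
    have hBA : ∀ E, Crossing B E ↔ Crossing A E := by
      rcases hB with rfl | rfl
      · exact fun _ => Iff.rfl
      · exact fun _ => crossing_compl_left
    have hBAI : AI B := by
      rcases hB with rfl | rfl
      · exact hA
      · exact hA.compl
    have hBv := (hBA _).2 hcv
    have hCC : ∀ g' v', Crossing C (tr g' (half v')) → Crossing A (tr g' (half v')) := by
      intro g' v' hh
      by_contra hne
      rw [← hBA] at hne
      rcases hC with rfl | rfl
      · exact not_crossing_inter hBv hne (not_crossing_tr_half _ _ _ _) hh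
      · exact not_crossing_union hBv hne (not_crossing_tr_half _ _ _ _) hh
    refine ih _ ?_ C rfl ?_ ?_
    · rw [← hn]
      refine Set.ncard_lt_ncard ⟨fun p hp => hCC _ _ hp, fun hs => ?_⟩ (finite_crossings hA)
      have hg : Crossing C (tr g (half v)) := hs (show (g, v) ∈ crossings A from hcv)
      rcases hC with rfl | rfl
      · exact not_crossing_iff.2 (Or.inr (Or.inl Set.inter_subset_right)) hg
      · exact not_crossing_iff.2 (Or.inr (Or.inr (Or.inl Set.subset_union_right))) hg
    · rcases hC with rfl | rfl
      · exact hBAI.inter ((AI_half v).tr g)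
      · exact hBAI.union ((AI_half v).tr g)
    · intro u' g' hu' hh
      exact hJ u' g' hu' (hCC _ _ hh)
  have key : ∀ g v, Crossing A (tr g (half v)) → endsIn (tr g (half v)) h (ltr u) →
      ν (half u) ≤ ν A := by
    intro g v hgv e1
    have hE : AI (tr g (half v)) := (AI_half v).tr g
    have hvZ : v.1 ∈ Z := by
      by_contra hv; exact hJ v g hv hgv
    by_cases e2 : endsIn (tr g (half v)) h (ltr (lbar u))
    · -- both ends of the line lie in the half-space
      have gen : ∀ B, (B = A ∨ B = Aᶜ) → ¬ endsIn B g (ltr (lbar v)) →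
          ν (half u) ≤ ν (B ∩ tr g (half v)) → ν (half u) ≤ ν A := by
        intro B hB hd hle
        have hBAI : AI B := by
          rcases hB with rfl | rfl
          · exact hA
          · exact hA.compl
        have h3 := corner B g v hB hgv _ (Or.inr rfl) g v hvZ
          ((endsIn_union hBAI hE (ltr_pow_injective _)).2 (Or.inr (endsIn_tr_half g v)))
          (by
            rw [endsIn_union hBAI hE (ltr_pow_injective _)]
            rintro (h | h)
            · exact hd h
            · exact not_endsIn_tr_half g v h)
        have h4 := hsub B _ hBAI hE
        rw [htr] at h4
        have h5 : ν B = ν A := by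
          rcases hB with rfl | rfl
          · rfl
          · exact hc A
        rw [h5] at h4
        have h6 := (add_le_add hle h3).trans h4
        exact le_of_add_le_add_right h6
      by_cases hd : endsIn A g (ltr (lbar v))
      · refine gen Aᶜ (Or.inr rfl) ?_ ?_
        · rw [endsIn_compl hA _ (ltr_pow_injective _), not_not]; exact hd
        · rw [← nu_half_lbar htr hc]
          refine corner Aᶜ g v (Or.inr rfl) hgv _ (Or.inl rfl) h (lbar u) hu ?_ ?_
          · rw [endsIn_inter, endsIn_compl hA _ (ltr_pow_injective _)]
            exact ⟨h2, e2⟩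
          · rw [lbar_lbar, endsIn_inter, endsIn_compl hA _ (ltr_pow_injective _)]
            exact fun h => h.1 h1
      · refine gen A (Or.inl rfl) hd ?_
        refine corner A g v (Or.inl rfl) hgv _ (Or.inl rfl) h u hu ?_ ?_
        · rw [endsIn_inter]; exact ⟨h1, e1⟩
        · rw [endsIn_inter]; exact fun h => h2 h.1
    · obtain rfl := eq_of_separates e1 e2
      have h3 := corner A g v (Or.inl rfl) hgv _ (Or.inl rfl) h v hu
        (by rw [endsIn_inter]; exact ⟨h1, e1⟩) (by rw [endsIn_inter]; exact fun h => h2 h.1)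
      have h4 := corner A g v (Or.inl rfl) hgv _ (Or.inr rfl) h v hu
        (by rw [endsIn_union hA hE (ltr_pow_injective _)]; exact Or.inl h1)
        (by rw [endsIn_union hA hE (ltr_pow_injective _)]; tauto)
      have h5 := hsub A _ hA hE
      rw [htr] at h5
      exact le_of_add_le_add_right ((add_le_add h3 h4).trans h5)
  obtain ⟨g, v, hgv⟩ := hcr
  by_cases e1 : endsIn (tr g (half v)) h (ltr u)
  · exact key g v hgv e1
  · refine key (g * ltr v) (lbar v) ?_ ?_
    · rw [← compl_tr_half]; exact hgv.compl_right
    · rw [← compl_tr_half, endsIn_compl ((AI_half v).tr g) _ (ltr_pow_injective _)]; exact e1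

end RelativeWhitehead

section Counting
variable {α : Type} [DecidableEq α]

theorem dirSet_half_mul_ltr {w : FreeGroup α} {u x : α × Bool} (h : w⁻¹ ∉ half x) :
    dirSet (half u) (w * ltr x) = dirSet (half u) w ∪ (if x = u then {w⁻¹} else ∅) := by
  ext g
  have key : ¬ (g * w ∈ half u ↔ g * w * ltr x ∈ half u) →
      (g = w⁻¹ ∧ x = u) ∨ (g * w = ltr u ∧ x = lbar u) := fun h => by
    rcases mem_half_mul_ltr h with ⟨h1, h2⟩ | h1
    · exact Or.inl ⟨eq_inv_of_mul_eq_one_left h1, h2⟩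
    · exact Or.inr h1
  rw [Set.mem_union, mem_dirSet, mem_dirSet, ← mul_assoc]
  have h2 : g ∈ (if x = u then {w⁻¹} else (∅ : Set (FreeGroup α))) ↔ g = w⁻¹ ∧ x = u := by
    split_ifs with hx <;> simp [hx]
  rw [h2]
  constructor
  · rintro ⟨h3, h4⟩
    by_cases h5 : g * w ∈ half u
    · exact Or.inl ⟨h3, h5⟩
    · rcases key (fun hh => h5 (hh.2 h4)) with h6 | ⟨h6, _⟩
      · exact Or.inr h6
      · exact absurd (h6 ▸ ltr_mem_half u) h5
  · rintro (⟨h3, h4⟩ | ⟨rfl, rfl⟩)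
    · refine ⟨h3, ?_⟩
      by_contra h5
      rcases key (fun hh => h5 (hh.1 h4)) with ⟨h6, _⟩ | ⟨h6, h7⟩
      · rw [h6, inv_mul_cancel] at h4; exact one_notMem_half u h4
      · obtain rfl : g = ltr u * w⁻¹ := eq_mul_inv_of_mul_eq h6
        rw [ltr_mul_mem_half_iff, not_not, ← h7] at h3
        exact h h3
    · exact ⟨h, by simpa using ltr_mem_half x⟩

theorem dc_one {G : Type} [Group G] (A : Set G) : dc A 1 = 0 := by
  have : dirSet A 1 = ∅ := by ext g; simp [mem_dirSet]
  rw [dc, this, Set.ncard_empty]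

theorem dc_half_mul_ltr {w : FreeGroup α} {u x : α × Bool} (h : w⁻¹ ∉ half x) :
    dc (half u) (w * ltr x) = dc (half u) w + if x = u then 1 else 0 := by
  rw [dc, dirSet_half_mul_ltr h]
  split_ifs with hx
  · subst hx
    rw [Set.ncard_union_eq _ (AI_half x w) (Set.finite_singleton _), Set.ncard_singleton, dc]
    rw [Set.disjoint_singleton_right]
    intro h3
    have := h3.2
    rw [inv_mul_cancel] at this
    exact one_notMem_half _ this
  · rw [Set.union_empty, dc, add_zero]

theorem dc_half_false (a : α) (w : FreeGroup α) :
    dc (half (a, false)) w = dc (half (a, true)) w⁻¹ := by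
  rw [← dc_compl, compl_half, dc_tr]; rfl

theorem dc_half_inv (u : α × Bool) (w : FreeGroup α) :
    dc (half u) w⁻¹ = dc (half (lbar u)) w := by
  rw [← dc_compl, compl_half, dc_tr]

theorem exists_word [Fintype α] (w : FreeGroup α) :
    ∃ L : List (α × Bool), FreeGroup.mk L = w ∧ L.length = ∑ u, dc (half u) w := by
  refine right_induction (P := fun w => ∃ L : List (α × Bool),
    FreeGroup.mk L = w ∧ L.length = ∑ u, dc (half u) w) ?_ ?_ w
  · exact ⟨[], rfl, by simp [dc_one]⟩
  · rintro w x h ⟨L, rfl, hL⟩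
    refine ⟨L ++ [x], by rw [← FreeGroup.mul_mk]; rfl, ?_⟩
    simp [dc_half_mul_ltr h, Finset.sum_add_distrib, hL]

theorem finite_of_sum_dc_le [Fintype α] (n : ℕ) :
    {w : FreeGroup α | ∑ u, dc (half u) w ≤ n}.Finite := by
  refine ((List.finite_length_le (α × Bool) n).image FreeGroup.mk).subset ?_
  intro w hw
  obtain ⟨L, h1, h2⟩ := exists_word w
  exact ⟨L, by simp only [Set.mem_ofPred_eq] at hw ⊢; omega, h1⟩

theorem toAdd_expo_eq (a : α) (w : FreeGroup α) :
    Multiplicative.toAdd (expo a w) = (dc (half (a, true)) w : ℤ) - dc (half (a, true)) w⁻¹ := by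
  refine right_induction (P := fun w => Multiplicative.toAdd (expo a w) =
    (dc (half (a, true)) w : ℤ) - dc (half (a, true)) w⁻¹) ?_ ?_ w
  · simp [dc_one]
  · intro w x h ih
    rw [dc_half_inv] at ih ⊢
    rw [map_mul, toAdd_mul, ih, dc_half_mul_ltr h, dc_half_mul_ltr h]
    rcases x with ⟨b, _ | _⟩
    · rw [ltr_false, map_inv]
      by_cases hb : b = a <;> simp [expo, hb, lbar]; ring
    · rw [ltr_true]
      by_cases hb : b = a <;> simp [expo, hb, lbar]; ring

/-- A family of sets on which an automorphism plays ping-pong determines the images of the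
half-spaces. -/
theorem im_half_of_pingPong {ω : MulAut (FreeGroup α)} {B : α × Bool → Set (FreeGroup α)}
    (hd : ∀ v v' g, g ∈ B v → g ∈ B v' → v = v') (h1 : ∀ v, (1 : FreeGroup α) ∉ B v)
    (hp : ∀ v g, g ∉ B (lbar v) → ω (ltr v) * g ∈ B v) (v : α × Bool) : im ω (half v) = B v := by
  have key : ∀ (w : FreeGroup α) (v : α × Bool), w ∈ half v → ω w ∈ B v := by
    intro w
    refine left_induction (P := fun w => ∀ v : α × Bool, w ∈ half v → ω w ∈ B v) ?_ ?_ w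
    · exact fun v h => absurd h (one_notMem_half v)
    · intro a g hg ih v hv
      obtain rfl := half_unique (ltr_mul_mem_half hg) hv
      rw [map_mul]
      refine hp _ _ fun hB => ?_
      by_cases hg1 : g = 1
      · rw [hg1, map_one] at hB; exact h1 _ hB
      · obtain ⟨v', hv'⟩ := exists_half_of_ne_one hg1
        have := hd _ _ _ (ih v' hv') hB
        rw [this] at hv'; exact hg hv'
  ext w
  rw [mem_im]
  constructor
  · intro h; simpa using key _ _ h
  · intro h
    have hw : ω⁻¹ w ≠ 1 := by
      intro h0
      have : w = 1 := by rw [← MulAut.apply_inv_self _ ω w, h0, map_one]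
      rw [this] at h; exact h1 _ h
    obtain ⟨v', hv'⟩ := exists_half_of_ne_one hw
    have h2 := key _ _ hv'
    rw [MulAut.apply_inv_self] at h2
    rw [hd _ _ _ h h2]; exact hv'

/-- The endomorphism fixing the generator `z` and multiplying the others by given elements. -/
def twistHom (z : α) (s : α × Bool → FreeGroup α) : FreeGroup α →* FreeGroup α :=
  FreeGroup.lift fun a => if a = z then FreeGroup.of z else
    s (a, true) * FreeGroup.of a * (s (a, false))⁻¹

theorem twistHom_of_zpow (z : α) (s : α × Bool → FreeGroup α) {g : FreeGroup α}
    (h : g ∈ Subgroup.zpowers (FreeGroup.of z)) : twistHom z s g = g := by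
  obtain ⟨k, rfl⟩ := h
  simp [twistHom]

theorem twistHom_comp (z : α) {s : α × Bool → FreeGroup α}
    (h : ∀ v, s v ∈ Subgroup.zpowers (FreeGroup.of z)) :
    (twistHom z fun v => (s v)⁻¹).comp (twistHom z s) = MonoidHom.id _ := by
  refine FreeGroup.ext_hom _ _ fun a => ?_
  by_cases ha : a = z
  · simp [twistHom, ha]
  · rw [MonoidHom.comp_apply]
    conv_lhs => rw [twistHom, twistHom]
    simp only [FreeGroup.lift_apply_of, ha, if_false, map_mul, map_inv, MonoidHom.id_apply]
    have h1 := twistHom_of_zpow z (fun v => (s v)⁻¹) (h (a, true))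
    have h2 := twistHom_of_zpow z (fun v => (s v)⁻¹) (h (a, false))
    rw [twistHom] at h1 h2
    rw [h1, h2]
    simp [mul_assoc]

/-- The automorphism fixing the generator `z` and multiplying the others by powers of `z`. -/
def twist (z : α) (s : α × Bool → FreeGroup α)
    (h : ∀ v, s v ∈ Subgroup.zpowers (FreeGroup.of z)) : MulAut (FreeGroup α) :=
  MonoidHom.toMulEquiv (twistHom z s) (twistHom z fun v => (s v)⁻¹) (twistHom_comp z h) (by
    have := twistHom_comp z (s := fun v => (s v)⁻¹) (fun v => inv_mem (h v))
    simpa using this)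

theorem twist_apply (z : α) (s : α × Bool → FreeGroup α)
    (h : ∀ v, s v ∈ Subgroup.zpowers (FreeGroup.of z)) (g : FreeGroup α) :
    twist z s h g = twistHom z s g := rfl

theorem exists_whitehead {u : α × Bool} {U : Set (α × Bool)} (hu : u ∈ U) (hub : lbar u ∉ U) :
    ∃ ω : MulAut (FreeGroup α), im ω (half u) = halfU U ∧
      ∀ v : α × Bool, v.1 ≠ u.1 → ∃ g, im ω (half v) = tr g (half v) := by
  classical
  set s : α × Bool → FreeGroup α := fun v => if v ∈ U then (ltr u)⁻¹ else 1 with hs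
  have hz : ltr u ∈ Subgroup.zpowers (FreeGroup.of u.1) := by
    rcases u with ⟨a, _ | _⟩
    · rw [ltr_false]; exact inv_mem (Subgroup.mem_zpowers _)
    · exact Subgroup.mem_zpowers _
  have hsz : ∀ v, s v ∈ Subgroup.zpowers (FreeGroup.of u.1) := by
    intro v
    simp only [hs]
    split_ifs
    · exact inv_mem hz
    · exact one_mem _
  set ω := twist u.1 s hsz with hω
  have hωu : ω (ltr u) = ltr u := by
    rw [hω, twist_apply, twistHom_of_zpow _ _ hz]
  have hωv : ∀ v : α × Bool, v.1 ≠ u.1 → ω (ltr v) = s v * ltr v * (s (lbar v))⁻¹ := by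
    intro v hv
    have h1 : ω (FreeGroup.of v.1) = s (v.1, true) * FreeGroup.of v.1 * (s (v.1, false))⁻¹ := by
      rw [hω, twist_apply]; simp [twistHom, hv]
    rcases v with ⟨a, _ | _⟩
    · rw [ltr_false, map_inv, h1]; simp [lbar, mul_assoc]
    · rw [ltr_true, h1]; simp [lbar]
  have hcase : ∀ v : α × Bool, v.1 = u.1 → v = u ∨ v = lbar u := by
    rintro ⟨a, b⟩ h
    rcases u with ⟨c, d⟩
    simp only at h
    subst h
    cases b <;> cases d <;> simp [lbar]
  set B : α × Bool → Set (FreeGroup α) := fun v =>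
    if v = u then halfU U else if v = lbar u then tr (ltr u)⁻¹ (halfU U)ᶜ else
      tr (s v) (half v) with hB
  have hBu : B u = halfU U := by simp [hB]
  have hBub : B (lbar u) = tr (ltr u)⁻¹ (halfU U)ᶜ := by simp [hB, lbar_ne]
  have hBv : ∀ v, v ≠ u → v ≠ lbar u → B v = tr (s v) (half v) := by
    intro v h1 h2; simp [hB, h1, h2]
  have hUmem : ∀ g v, g ∈ half v → (g ∈ halfU U ↔ v ∈ U) := by
    intro g v hg
    constructor
    · rintro ⟨v', hv', hg'⟩; rwa [half_unique hg hg']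
    · exact fun h => ⟨v, h, hg⟩
  have hnb : ∀ g, g ∉ half (lbar u) → ltr u * g ∈ halfU U := fun g hg =>
    (hUmem _ _ (ltr_mul_mem_half hg)).2 hu
  -- the half-spaces with twisted label lie in the half-space of the inverse letter
  have hin : ∀ v g, v ≠ u → v ∈ U → g ∈ tr (s v) (half v) → g ∈ half (lbar u) := by
    intro v g hv hvU hg
    rw [mem_tr] at hg
    simp only [hs, hvU, if_true, inv_inv] at hg
    by_contra hh
    exact hv (half_unique hg (ltr_mul_mem_half hh))
  have hout : ∀ v g, v ∉ U → (g ∈ tr (s v) (half v) ↔ g ∈ half v) := by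
    intro v g hv
    rw [mem_tr]; simp [hs, hv]
  have d1 : ∀ v g, v ≠ u → v ≠ lbar u → g ∈ tr (s v) (half v) → g ∉ halfU U := by
    intro v g h1 h2 hg
    by_cases hv : v ∈ U
    · rw [hUmem g _ (hin v g h1 hv hg)]; exact hub
    · rw [hout v g hv] at hg
      rw [hUmem g _ hg]; exact hv
  have d2 : ∀ v g, v ≠ u → v ≠ lbar u → g ∈ tr (s v) (half v) → ltr u * g ∈ halfU U := by
    intro v g h1 h2 hg
    by_cases hv : v ∈ U
    · rw [mem_tr] at hg
      simp only [hs, hv, if_true, inv_inv] at hg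
      exact ⟨v, hv, hg⟩
    · rw [hout v g hv] at hg
      exact hnb g fun h => h2 (half_unique hg h)
  have mem_b : ∀ g, g ∈ B (lbar u) ↔ ltr u * g ∉ halfU U := by
    intro g; rw [hBub, mem_tr, inv_inv]; rfl
  have d3 : ∀ v v' g, v ≠ u → v' ≠ u → v ≠ lbar u → v' ≠ lbar u → g ∈ tr (s v) (half v) →
      g ∈ tr (s v') (half v') → v = v' := by
    intro v v' g h1 h1' h2 h2' hg hg'
    by_cases hv : v ∈ U <;> by_cases hv' : v' ∈ U
    · rw [mem_tr] at hg hg'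
      simp only [hs, hv, hv', if_true] at hg hg'
      exact half_unique hg hg'
    · rw [hout v' g hv'] at hg'
      exact absurd (half_unique hg' (hin v g h1 hv hg)) h2'
    · rw [hout v g hv] at hg
      exact absurd (half_unique hg (hin v' g h1' hv' hg')) h2
    · rw [hout v g hv] at hg
      rw [hout v' g hv'] at hg'
      exact half_unique hg hg'
  have hub' : ∀ g, g ∈ halfU U → ltr u * g ∈ halfU U := fun g hg =>
    hnb g fun h => hub ((hUmem g _ h).1 hg)
  have him := im_half_of_pingPong (ω := ω) (B := B) (by
    intro v v' g hg hg'
    by_cases h1 : v = u <;> by_cases h1' : v' = u <;> by_cases h2 : v = lbar u <;>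
      by_cases h2' : v' = lbar u
    all_goals first
      | (rw [h1, h1'])
      | (rw [h2, h2'])
      | skip
    all_goals first
      | exact absurd (h1.symm.trans h2) (ne_lbar u)
      | exact absurd (h1'.symm.trans h2') (ne_lbar u)
      | skip
    · rw [h1, hBu] at hg
      rw [h2', mem_b] at hg'
      exact absurd (hub' g hg) hg'
    · rw [h1, hBu] at hg
      rw [hBv v' h1' h2'] at hg'
      exact absurd hg (d1 _ _ h1' h2' hg')
    · rw [h1', hBu] at hg'
      rw [h2, mem_b] at hg
      exact absurd (hub' g hg') hg
    · rw [h1', hBu] at hg'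
      rw [hBv v h1 h2] at hg
      exact absurd hg' (d1 _ _ h1 h2 hg)
    · rw [h2, mem_b] at hg
      rw [hBv v' h1' h2'] at hg'
      exact absurd (d2 _ _ h1' h2' hg') hg
    · rw [h2', mem_b] at hg'
      rw [hBv v h1 h2] at hg
      exact absurd (d2 _ _ h1 h2 hg) hg'
    · rw [hBv v h1 h2] at hg
      rw [hBv v' h1' h2'] at hg'
      exact d3 v v' g h1 h1' h2 h2' hg hg') (by
    intro v
    by_cases h1 : v = u
    · rw [h1, hBu]
      rintro ⟨v', _, h⟩
      exact one_notMem_half _ h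
    · by_cases h2 : v = lbar u
      · rw [h2, mem_b, not_not, mul_one]
        exact ⟨u, hu, ltr_mem_half u⟩
      · rw [hBv v h1 h2, mem_tr]
        simp only [hs]
        split_ifs with hv
        · rw [inv_inv, mul_one]
          exact fun h => h1 (half_unique h (ltr_mem_half u))
        · simpa using one_notMem_half v) (by
    intro v g hg
    by_cases h1 : v = u
    · subst h1
      rw [mem_b, not_not] at hg
      rw [hωu, hBu]; exact hg
    · by_cases h2 : v = lbar u
      · subst h2
        rw [lbar_lbar, hBu] at hg
        rw [← ltr_inv, map_inv, hωu, ltr_inv, mem_b, ← mul_assoc, ltr_mul_lbar, one_mul]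
        exact hg
      · have h3 : v.1 ≠ u.1 := fun h => (hcase v h).elim h1 h2
        have h1' : lbar v ≠ u := fun h => h2 (by rw [← h, lbar_lbar])
        have h2' : lbar v ≠ lbar u := fun h => h1 (by rw [← lbar_lbar v, h, lbar_lbar])
        rw [hBv _ h1' h2', mem_tr] at hg
        rw [hωv v h3, hBv v h1 h2, mem_tr]
        rw [mul_assoc, mul_assoc, inv_mul_cancel_left]
        exact ltr_mul_mem_half hg)
  refine ⟨ω, (him u).trans hBu, fun v hv => ⟨s v, ?_⟩⟩
  rw [him v, hBv v]
  · rintro rfl; exact hv rfl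
  · rintro rfl; exact hv rfl

/-- The automorphism inverting the generator `z`. -/
theorem exists_flip (z : α) : ∃ ω : MulAut (FreeGroup α),
    im ω (half (z, true)) = half (z, false) ∧
      ∀ v : α × Bool, v.1 ≠ z → im ω (half v) = half v := by
  let f : FreeGroup α →* FreeGroup α := FreeGroup.lift fun a =>
    if a = z then (FreeGroup.of z)⁻¹ else FreeGroup.of a
  have hf : f.comp f = MonoidHom.id _ := by
    refine FreeGroup.ext_hom _ _ fun a => ?_
    by_cases h : a = z <;> simp [f, h]
  let ω : MulAut (FreeGroup α) := MonoidHom.toMulEquiv f f hf hf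
  let B : α × Bool → Set (FreeGroup α) := fun v => if v.1 = z then half (lbar v) else half v
  have hω : ∀ a, ω (FreeGroup.of a) = if a = z then (FreeGroup.of z)⁻¹ else FreeGroup.of a := by
    intro a; exact FreeGroup.lift_apply_of
  have hv : ∀ v : α × Bool, ω (ltr v) = if v.1 = z then ltr (lbar v) else ltr v := by
    rintro ⟨a, _ | _⟩
    · rw [ltr_false, map_inv, hω]
      by_cases h : a = z <;> simp [h, lbar, ltr_true, ltr_false]
    · rw [ltr_true, hω]
      by_cases h : a = z <;> simp [h, lbar, ltr_false, ltr_true]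
  have key := im_half_of_pingPong (ω := ω) (B := B) (by
      intro v v' g h h'
      simp only [B] at h h'
      split_ifs at h h' with h1 h2 h2
      · have := half_unique h h'
        rw [← lbar_lbar v, this, lbar_lbar]
      · exact absurd (by rw [← half_unique h h']; exact h1) h2
      · exact absurd (by rw [half_unique h h']; exact h2) h1
      · exact half_unique h h') (by
      intro v; simp only [B]; split_ifs <;> exact one_notMem_half _) (by
      intro v g h
      rw [hv]
      by_cases hz : v.1 = z
      · have hz' : (lbar v).1 = z := hz
        simp only [B, if_pos hz, if_pos hz'] at h ⊢; exact ltr_mul_mem_half h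
      · have hz' : (lbar v).1 ≠ z := hz
        simp only [B, if_neg hz, if_neg hz'] at h ⊢; exact ltr_mul_mem_half h)
  exact ⟨ω, by rw [key]; simp [B, lbar], fun v h => by rw [key]; simp [B, h]⟩

/-- A set with the coboundary counts of a half-space is a translate of it. -/
theorem exists_eq_tr_half {B : Set (FreeGroup α)} (hB : AI B) {u : α × Bool}
    (h : ∀ x, dc B (ltr x) = dc (half u) (ltr x)) : ∃ g, B = tr g (half u) := by
  have h1 : ∀ x, (dirSet B (ltr x)).ncard = if x = u then 1 else 0 := by
    intro x
    have := h x
    rw [dc, dc, dirSet_half_ltr] at this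
    rw [this]; split_ifs <;> simp
  obtain ⟨g, hg⟩ := Set.ncard_eq_one.1 ((h1 u).trans (if_pos rfl))
  have hne : ∀ x, x ≠ u → dirSet B (ltr x) = ∅ := by
    intro x hx
    have := h1 x
    rwa [if_neg hx, Set.ncard_eq_zero (hB _)] at this
  have hg' : g ∈ dirSet B (ltr u) := by rw [hg]; rfl
  have hcross : ∀ w x, ¬ (w ∈ B ↔ w * ltr x ∈ B) →
      (w = g ∧ x = u) ∨ (w = g * ltr u ∧ x = lbar u) := by
    have aux : ∀ w x, w ∈ dirSet B (ltr x) → w = g ∧ x = u := by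
      intro w x hw
      by_cases hx : x = u
      · subst hx; rw [hg] at hw; exact ⟨hw, rfl⟩
      · rw [hne x hx] at hw; exact absurd hw (Set.notMem_empty _)
    intro w x hw
    by_cases h2 : w ∈ B
    · have h3 : w * ltr x ∉ B := fun h3 => hw ⟨fun _ => h3, fun _ => h2⟩
      obtain ⟨h4, h5⟩ := aux (w * ltr x) (lbar x) ⟨h3, by simpa [mul_assoc] using h2⟩
      right
      rw [← h5, lbar_lbar, ← h4, mul_assoc, ltr_mul_lbar, mul_one]
      exact ⟨rfl, rfl⟩
    · left
      exact aux w x ⟨h2, by tauto⟩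
  refine ⟨g, ?_⟩
  have c1 := tr_half_connected (g := g) (u := u) (P := fun w => w ∈ B) (by
    intro w x hw hwx
    by_contra hc
    rcases hcross w x hc with ⟨rfl, rfl⟩ | ⟨rfl, rfl⟩
    · rw [mem_tr, inv_mul_cancel] at hw; exact one_notMem_half _ hw
    · rw [mul_assoc, ltr_mul_lbar, mul_one, mem_tr, inv_mul_cancel] at hwx
      exact one_notMem_half _ hwx)
  have c2 := tr_half_connected (g := g * ltr u) (u := lbar u) (P := fun w => w ∈ B) (by
    rw [← compl_tr_half]
    intro w x hw hwx
    by_contra hc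
    rcases hcross w x hc with ⟨rfl, rfl⟩ | ⟨rfl, rfl⟩
    · exact hwx (by rw [mem_tr, inv_mul_cancel_left]; exact ltr_mem_half _)
    · exact hw (by rw [mem_tr, inv_mul_cancel_left]; exact ltr_mem_half _))
  rw [← compl_tr_half, mul_assoc, ltr_mul_lbar, mul_one] at c2
  ext w
  by_cases hw : w ∈ tr g (half u)
  · exact iff_of_true ((c1 w hw).2 hg'.2) hw
  · exact iff_of_false (fun hwB => hg'.1 ((c2 w hw).1 hwB)) hw

end Counting

section Separation
variable {G : Type} [Group G]

theorem endsIn_mul_self {A : Set G} {h w : G} : endsIn A (h * w) w ↔ endsIn A h w := by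
  unfold endsIn
  have : (fun k : ℕ => h * w * w ^ k ∈ A) = fun k => h * w ^ (k + 1) ∈ A := by
    funext k; rw [mul_assoc, ← pow_succ']
  rw [this, ← Filter.eventually_map (m := fun k : ℕ => k + 1) (P := fun k => h * w ^ k ∈ A),
    Filter.map_add_atTop_eq_nat]

theorem finite_diff_endsIn {A : Set G} (hA : AI A) {w : G}
    (hw : Function.Injective fun k : ℕ => w ^ k)
    (hs : ∀ h, ¬ Sep A h w) : (A \ {g | endsIn A g w}).Finite := by
  have hwi : Function.Injective fun k : ℕ => w⁻¹ ^ k := fun a b h => hw (by simpa using h)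
  have key : ∀ x : G, (Function.Injective fun k : ℕ => x ^ k) → ∀ d, ¬ endsIn A d x →
      {k : ℕ | d * x ^ k ∈ A}.Finite := by
    intro x hx d hd
    rw [← endsIn_compl hA d hx] at hd
    obtain ⟨N, hN⟩ := Filter.eventually_atTop.1 hd
    refine (Set.finite_lt_nat N).subset fun k hk => ?_
    by_contra hkN
    exact hN k (not_lt.1 hkN) hk
  have hfin : (⋃ d ∈ {d ∈ dirSet Aᶜ w | ¬ endsIn A d w},
      (fun k : ℕ => d * w⁻¹ ^ k) '' {k : ℕ | d * w⁻¹ ^ k ∈ A}).Finite := by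
    refine ((hA.compl w).subset (Set.sep_subset _ _)).biUnion ?_
    rintro d ⟨_, hd⟩
    refine (key _ hwi d ?_).image _
    have := hs d
    unfold Sep at this
    tauto
  refine hfin.subset ?_
  rintro g ⟨hg, hge⟩
  have hge' : ¬ endsIn A g w := hge
  obtain ⟨m, hm1, hm2⟩ : ∃ m : ℕ, g * w ^ m ∈ A ∧ g * w ^ (m + 1) ∉ A := by
    by_contra hc
    push Not at hc
    refine hge' (Filter.Eventually.of_forall fun k => ?_)
    induction k with
    | zero => simpa using hg
    | succ k ih => exact hc k ih
  simp only [Set.mem_iUnion]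
  refine ⟨g * w ^ m, ⟨⟨fun h => h hm1, by simpa [pow_succ, mul_assoc] using hm2⟩, ?_⟩, m, ?_, ?_⟩
  · have : ∀ m : ℕ, ¬ endsIn A (g * w ^ m) w := by
      intro m
      induction m with
      | zero => simpa using hge'
      | succ m ih => rw [pow_succ, ← mul_assoc, endsIn_mul_self]; exact ih
    exact this m
  · simpa using hg
  · simp

/-- If a set does not separate any line in the direction `w` then it has as many boundary edges
in the direction `w` as in the opposite direction. -/
theorem dc_eq_dc_inv_of_not_sep {A : Set G} (hA : AI A) {w : G}
    (hw : Function.Injective fun k : ℕ => w ^ k)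
    (hs : ∀ h, ¬ Sep A h w) : dc A w = dc A w⁻¹ := by
  classical
  have hwi : Function.Injective fun k : ℕ => w⁻¹ ^ k := fun a b h => hw (by simpa using h)
  rw [← dc_compl]
  let E : Set G := {g | endsIn A g w}
  let f : G → ℤ := fun g => (if g ∈ A then 1 else 0) - if g ∈ E then 1 else 0
  have hf : (Function.support f).Finite := by
    refine ((finite_diff_endsIn hA hw hs).union
      (finite_diff_endsIn hA.compl hw (fun h => ?_))).subset ?_
    · have := hs h
      unfold Sep at *
      rw [endsIn_compl hA h hw, endsIn_compl hA h hwi]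
      tauto
    · intro g hg
      by_contra hc
      apply hg
      simp only [Set.mem_union, Set.mem_sdiff, Set.mem_compl_iff, Set.mem_ofPred_eq,
        endsIn_compl hA g hw] at hc
      have : g ∈ A ↔ g ∈ E := by
        change g ∈ A ↔ endsIn A g w
        tauto
      simp [f, this]
  have hd : ∀ B : Set G, AI B → (dc B w : ℤ) = ∑ᶠ g, if g ∈ dirSet B w then (1 : ℤ) else 0 := by
    intro B hB
    rw [dc, Set.ncard_eq_toFinset_card _ (hB w), finsum_eq_sum_of_support_subset
      (s := Set.Finite.toFinset (hB w)) _ (fun g hg => by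
        rw [Set.Finite.coe_toFinset]; by_contra h; simp [h] at hg)]
    rw [Finset.sum_congr rfl fun g hg => if_pos ((Set.Finite.mem_toFinset (hB w)).1 hg)]
    simp
  have h1 : ∑ᶠ g, f (g * w) = ∑ᶠ g, f g :=
    finsum_comp_equiv (Equiv.mulRight w)
  have hf' : (Function.support fun g => f (g * w)).Finite :=
    hf.preimage (mul_left_injective w).injOn
  have h2 : ∑ᶠ g, (f (g * w) - f g) = 0 := by
    rw [finsum_sub_distrib hf' hf, h1, sub_self]
  have h3 : ∀ g, f (g * w) - f g = (if g ∈ dirSet A w then (1 : ℤ) else 0) -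
      if g ∈ dirSet Aᶜ w then (1 : ℤ) else 0 := by
    intro g
    have hE : g * w ∈ E ↔ g ∈ E := endsIn_mul_self
    by_cases ha : g ∈ A <;> by_cases hb : g * w ∈ A <;>
      by_cases he : g ∈ E <;> simp [f, hE, mem_dirSet, ha, hb, he]
  rw [finsum_congr h3, finsum_sub_distrib, ← hd A hA, ← hd _ hA.compl, sub_eq_zero] at h2
  · exact_mod_cast h2
  · exact (hA w).subset fun g hg => by by_contra h; simp [h] at hg
  · exact (hA.compl w).subset fun g hg => by by_contra h; simp [h] at hg

end Separation

section Chambers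
variable {α : Type} [Fintype α] [DecidableEq α]

/-- The vertex attached to the generator `j` and the automorphism `φ`: it records how often `j`
occurs with exponent one in words with respect to the basis given by `φ`. -/
def vert (φ : MulAut (FreeGroup α)) (j : α) : FreeGroup α → ℕ :=
  fun w => dc (half (j, true)) (φ⁻¹ w)

theorem exists_enum : ∃ e : ℕ → FreeGroup α, Function.Surjective e := by
  have : Countable (FreeGroup α) :=
    Function.Surjective.countable (f := fun L : List (α × Bool) => FreeGroup.mk L) Quot.mk_surjective
  exact exists_surjective_nat _

/-- An enumeration of the free group. -/
def enum : ℕ → FreeGroup α := exists_enum.choose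

theorem enum_surjective : Function.Surjective (enum (α := α)) := exists_enum.choose_spec

/-- The symmetrized complexity of a vertex. -/
def symCx (v : FreeGroup α → ℕ) : Lex (ℕ → ℤ) := toLex fun k => Nat.casesOn k
  (∑ a, ((v (FreeGroup.of a) : ℤ) + v (FreeGroup.of a)⁻¹))
  (fun k => (v (enum k) : ℤ) + v (enum k)⁻¹)

/-- The complexity of a vertex. -/
def cx (v : FreeGroup α → ℕ) : Lex (Lex (ℕ → ℤ) × Lex (ℕ → ℤ)) :=
  toLex (symCx v, toLex fun k => (v (enum k) : ℤ))

theorem cx_injective : Function.Injective (cx (α := α)) := by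
  intro v v' h
  have h1 := (Prod.ext_iff.1 (toLex.injective h)).2
  funext w
  obtain ⟨k, rfl⟩ := enum_surjective w
  have := congrFun (toLex.injective h1) k
  exact_mod_cast this

theorem cx_lt {v v' : FreeGroup α → ℕ} (h : symCx v < symCx v') : cx v < cx v' :=
  Prod.Lex.toLex_lt_toLex.2 (Or.inl h)

theorem symCx_le_of_cx_le {v v' : FreeGroup α → ℕ} (h : cx v ≤ cx v') : symCx v ≤ symCx v' := by
  by_contra hc
  exact absurd h (not_le.2 (cx_lt (not_le.1 hc)))

theorem symCx_eq {v v' : FreeGroup α → ℕ} (h : symCx v = symCx v') (w : FreeGroup α) :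
    v w + v w⁻¹ = v' w + v' w⁻¹ := by
  obtain ⟨k, rfl⟩ := enum_surjective w
  have := congrFun (toLex.injective h) (k + 1)
  simp only at this
  exact_mod_cast this

theorem symCx_mono {v v' : FreeGroup α → ℕ} (h : v ≤ v') : symCx v ≤ symCx v' := by
  refine Pi.toLex_monotone fun k => ?_
  cases k with
  | zero => exact Finset.sum_le_sum fun a _ => by exact_mod_cast add_le_add (h _) (h _)
  | succ k => simp only; exact_mod_cast add_le_add (h _) (h _)

theorem symCx_add (v v' : FreeGroup α → ℕ) : symCx (v + v') = symCx v + symCx v' := by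
  unfold symCx
  rw [← toLex_add]
  congr 1
  funext k
  cases k with
  | zero =>
    change (∑ a : α, _ : ℤ) = (∑ a : α, _ : ℤ) + (∑ a : α, _ : ℤ)
    rw [← Finset.sum_add_distrib]
    exact Finset.sum_congr rfl fun a _ => by simp only [Pi.add_apply]; push_cast; ring
  | succ k => simp only [Pi.add_apply]; push_cast; ring

theorem symCx_inv (v : FreeGroup α → ℕ) : symCx (fun w => v w⁻¹) = symCx v := by
  unfold symCx
  congr 1
  funext k
  cases k with
  | zero => exact Finset.sum_congr rfl fun a _ => by simp [add_comm]
  | succ k => simp [add_comm]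

/-- The level of a chamber. -/
def level (φ : MulAut (FreeGroup α)) : Lex (Lex (ℕ → ℤ) × Lex (ℕ → ℤ)) :=
  ∑ j, cx (vert φ j)

/-- The leading coordinate of a complexity. -/
def lead : Lex (Lex (ℕ → ℤ) × Lex (ℕ → ℤ)) →+ ℤ where
  toFun x := ofLex (ofLex x).1 0
  map_zero' := rfl
  map_add' _ _ := rfl

theorem lead_mono {x y : Lex (Lex (ℕ → ℤ) × Lex (ℕ → ℤ))} (h : x ≤ y) : lead x ≤ lead y := by
  have h1 : (ofLex x).1 ≤ (ofLex y).1 := Prod.Lex.monotone_fst _ _ h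
  rcases h1.lt_or_eq with h2 | h2
  · obtain ⟨i, hi, hlt⟩ := h2
    rcases Nat.eq_zero_or_pos i with rfl | hpos
    · exact hlt.le
    · exact (hi 0 hpos).le
  · exact (congrFun (congrArg ofLex h2) 0).le

theorem lead_level (φ : MulAut (FreeGroup α)) :
    lead (level φ) = ∑ a, ((∑ u, dc (half u) (φ⁻¹ (FreeGroup.of a)) : ℕ) : ℤ) := by
  rw [level, map_sum]
  have : ∀ j, lead (cx (vert φ j)) =
      ∑ a, ((vert φ j (FreeGroup.of a) : ℤ) + vert φ j (FreeGroup.of a)⁻¹) := fun j => rfl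
  simp_rw [this]
  rw [Finset.sum_comm]
  refine Finset.sum_congr rfl fun a _ => ?_
  rw [Fintype.sum_prod_type]
  push_cast
  refine Finset.sum_congr rfl fun j _ => ?_
  rw [Fintype.sum_bool, dc_half_false, vert, vert, map_inv]

theorem finite_level_le (φ : MulAut (FreeGroup α)) :
    {ψ : MulAut (FreeGroup α) | level ψ ≤ level φ}.Finite := by
  obtain ⟨n, hn⟩ : ∃ n : ℕ, lead (level φ) = n := ⟨_, (lead_level φ).trans (Nat.cast_sum _ _).symm⟩
  let e : MulAut (FreeGroup α) → α → FreeGroup α := fun ψ a => ψ⁻¹ (FreeGroup.of a)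
  have he : Function.Injective e := by
    intro ψ ψ' h
    have : ψ⁻¹.toMonoidHom = ψ'⁻¹.toMonoidHom := FreeGroup.ext_hom _ _ fun a => congrFun h a
    apply inv_injective
    ext w
    exact DFunLike.congr_fun this w
  refine Set.Finite.of_finite_image (f := e) ?_ he.injOn
  refine (Set.Finite.pi (t := fun _ : α => {w : FreeGroup α | ∑ u, dc (half u) w ≤ n})
    fun _ => finite_of_sum_dc_le n).subset ?_
  rintro _ ⟨ψ, hψ, rfl⟩ a _
  have h1 := lead_mono hψ
  rw [hn, lead_level] at h1
  have h2 : ∑ a, ∑ u, dc (half u) (ψ⁻¹ (FreeGroup.of a)) ≤ n := by exact_mod_cast h1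
  exact (Finset.single_le_sum (f := fun a => ∑ u, dc (half u) (ψ⁻¹ (FreeGroup.of a)))
    (fun _ _ => Nat.zero_le _) (Finset.mem_univ a)).trans h2

/-- The rank of the level of a chamber among all levels. -/
def rk (φ : MulAut (FreeGroup α)) : ℕ :=
  {x | x ∈ Set.range (level (α := α)) ∧ x < level φ}.ncard

theorem finite_lt_level (φ : MulAut (FreeGroup α)) :
    {x | x ∈ Set.range (level (α := α)) ∧ x < level φ}.Finite := by
  refine ((finite_level_le φ).image level).subset ?_
  rintro _ ⟨⟨ψ, rfl⟩, h⟩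
  exact ⟨ψ, h.le, rfl⟩

theorem rk_le {φ ψ : MulAut (FreeGroup α)} (h : level φ ≤ level ψ) : rk φ ≤ rk ψ :=
  Set.ncard_le_ncard (fun _ hx => ⟨hx.1, hx.2.trans_le h⟩) (finite_lt_level ψ)

theorem rk_lt {φ ψ : MulAut (FreeGroup α)} (h : level φ < level ψ) : rk φ < rk ψ :=
  Set.ncard_lt_ncard ⟨fun _ hx => ⟨hx.1, hx.2.trans h⟩,
    fun hs => lt_irrefl _ (hs (show level φ ∈ _ from ⟨⟨φ, rfl⟩, h⟩)).2⟩ (finite_lt_level ψ)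

theorem level_le_of_rk_le {φ ψ : MulAut (FreeGroup α)} (h : rk φ ≤ rk ψ) : level φ ≤ level ψ := by
  by_contra hc
  exact absurd h (not_le.2 (rk_lt (not_le.1 hc)))

theorem cx_le_of_level_le {φ ψ : MulAut (FreeGroup α)} {z : α}
    (h : ∀ i ≠ z, vert φ i = vert ψ i) (hl : level φ ≤ level ψ) :
    cx (vert φ z) ≤ cx (vert ψ z) := by
  rw [level, level, ← Finset.add_sum_erase _ _ (Finset.mem_univ z),
    ← Finset.add_sum_erase _ (fun j => cx (vert ψ j)) (Finset.mem_univ z)] at hl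
  have : ∑ x ∈ Finset.univ.erase z, cx (vert φ x) = ∑ x ∈ Finset.univ.erase z, cx (vert ψ x) :=
    Finset.sum_congr rfl fun i hi => by rw [h i (Finset.ne_of_mem_erase hi)]
  rw [this] at hl
  exact le_of_add_le_add_right hl

theorem exists_perm_expo (θ : MulAut (FreeGroup α)) : ∃ σ : Equiv.Perm α, ∀ k,
    Multiplicative.toAdd (expo (σ k) (θ⁻¹ (FreeGroup.of k))) ≠ 0 := by
  have hexp : ∀ (i : α) (η : FreeGroup α →* FreeGroup α) (w : FreeGroup α),
      Multiplicative.toAdd (expo i (η w)) = ∑ k,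
        Multiplicative.toAdd (expo i (η (FreeGroup.of k))) * Multiplicative.toAdd (expo k w) := by
    intro i η w
    induction w using FreeGroup.induction_on with
    | C1 => simp
    | of a => simp [expo]
    | inv_of a h => rw [map_inv, map_inv, toAdd_inv, h]; simp [Finset.sum_neg_distrib]
    | mul x y hx hy => simp [hx, hy, mul_add, Finset.sum_add_distrib]
  let M : MulAut (FreeGroup α) → Matrix α α ℤ := fun η i k =>
    Multiplicative.toAdd (expo i (η (FreeGroup.of k)))
  have hM : M θ⁻¹ * M θ = 1 := by
    ext i k
    rw [Matrix.mul_apply]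
    have := hexp i (θ⁻¹).toMonoidHom (θ (FreeGroup.of k))
    simp only [MulEquiv.toMonoidHom_eq_coe, MonoidHom.coe_coe,
      MulAut.inv_apply_self] at this
    rw [← this]
    simp [expo, Matrix.one_apply, eq_comm]
  have hdet : (M θ⁻¹).det ≠ 0 := by
    intro h
    have := congrArg Matrix.det hM
    rw [Matrix.det_mul, h, zero_mul, Matrix.det_one] at this
    exact zero_ne_one this
  rw [Matrix.det_apply] at hdet
  obtain ⟨σ, _, hσ⟩ := Finset.exists_ne_zero_of_sum_ne_zero hdet
  refine ⟨σ, fun k h => hσ ?_⟩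
  rw [Finset.prod_eq_zero (Finset.mem_univ k) h, smul_zero]

theorem vert_eq_dc (φ ψ : MulAut (FreeGroup α)) (i : α) (w : FreeGroup α) :
    vert ψ i w = dc (im (φ⁻¹ * ψ) (half (i, true))) (φ⁻¹ w) := by
  rw [dc_im, vert]
  simp [mul_inv_rev, MulAut.mul_apply]

theorem peak_reduction (φ ψ : MulAut (FreeGroup α))
    (h : ∀ j, (∃ ψ', (∀ i ≠ j, vert φ i ∈ Set.range (vert ψ')) ∧ rk ψ' < rk φ) →
      vert φ j ∈ Set.range (vert ψ)) :
    rk φ ≤ rk ψ ∧ (rk φ = rk ψ → Set.range (vert φ) = Set.range (vert ψ)) := by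
  set Z : Set α := {j | vert φ j ∉ Set.range (vert ψ)} with hZ
  have hirr : ∀ z ∈ Z, ∀ ψ', (∀ i ≠ z, vert φ i = vert ψ' i) → cx (vert φ z) ≤ cx (vert ψ' z) := by
    intro z hz ψ' hψ'
    refine cx_le_of_level_le hψ' (level_le_of_rk_le ?_)
    by_contra hc
    exact hz (h z ⟨ψ', fun i hi => ⟨i, (hψ' i hi).symm⟩, not_le.1 hc⟩)
  set θ := φ⁻¹ * ψ with hθ
  let ν : Set (FreeGroup α) → Lex (ℕ → ℤ) := fun A => symCx fun w => dc A (φ⁻¹ w)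
  have htr : ∀ g A, ν (tr g A) = ν A := fun g A => by simp only [ν, dc_tr]
  have hc : ∀ A, ν Aᶜ = ν A := fun A => by
    simp only [ν, dc_compl]
    rw [← symCx_inv]
    simp
  have hsub : ∀ A B, AI A → AI B → ν (A ∩ B) + ν (A ∪ B) ≤ ν A + ν B := by
    intro A B hA hB
    simp only [ν]
    rw [← symCx_add, ← symCx_add]
    exact symCx_mono fun w => dc_inter_add_union hA hB _
  have hνψ : ∀ i, ν (im θ (half (i, true))) = symCx (vert ψ i) := fun i => by
    simp only [ν, hθ, ← vert_eq_dc]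
  have hνφ : ∀ i, ν (half (i, true)) = symCx (vert φ i) := fun i => rfl
  have hνu : ∀ u : α × Bool, ν (half u) = ν (half (u.1, true)) := by
    rintro ⟨a, _ | _⟩
    · exact nu_half_lbar htr hc (a, true)
    · rfl
  have irr : ∀ u : α × Bool, u.1 ∈ Z → ∀ U : Set (α × Bool), u ∈ U → lbar u ∉ U →
      ν (half u) ≤ ν (halfU U) := by
    intro u hu U huU hub
    obtain ⟨ω, h1, h2⟩ := exists_whitehead huU hub
    have h3 := hirr u.1 hu (φ * ω) (by
      intro i hi
      funext w
      obtain ⟨g, hg⟩ := h2 (i, true) hi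
      rw [vert_eq_dc φ (φ * ω), inv_mul_cancel_left, hg, dc_tr]; rfl)
    have h4 := symCx_le_of_cx_le h3
    rw [hνu, hνφ]
    refine h4.trans (le_of_eq ?_)
    have h5 : ν (im ω (half u)) = ν (im ω (half (u.1, true))) := by
      rcases u with ⟨a, _ | _⟩
      · have : half (a, false) = (tr (ltr (a, false)) (half (a, true)))ᶜ := by
          rw [← tr_compl, compl_half, tr_tr]
          simp [lbar, ltr_true, ltr_false, tr_one]
        rw [this, im_compl, hc, im_tr, htr]
      · rfl
    rw [← h1, h5]
    simp only [ν]
    congr 1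
    funext w
    rw [vert_eq_dc φ (φ * ω), inv_mul_cancel_left]
  -- the common vertices
  have hcomm : ∀ k ∉ Z, ∃ k', vert ψ k' = vert φ k ∧ ∃ g, im θ (half (k', true)) =
      tr g (half (k, true)) := by
    intro k hk
    simp only [hZ, Set.mem_ofPred_eq, not_not] at hk
    obtain ⟨k', hk'⟩ := hk
    refine ⟨k', hk', exists_eq_tr_half ((AI_half _).im θ) fun x => ?_⟩
    have := congrFun hk' (φ (ltr x))
    rw [vert_eq_dc φ ψ, vert, MulAut.inv_apply_self] at this
    exact this
  have hJ : ∀ i (u : α × Bool) g, u.1 ∉ Z →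
      ¬ Crossing (im θ (half (i, true))) (tr g (half u)) := by
    intro i u g hu
    obtain ⟨k', _, g', hg'⟩ := hcomm u.1 hu
    have h1 : ∀ g, ¬ Crossing (im θ (half (i, true))) (tr g (half (u.1, true))) := by
      intro g
      have : tr g (half (u.1, true)) = im θ (tr (θ⁻¹ (g * g'⁻¹)) (half (k', true))) := by
        rw [im_tr, hg', tr_tr]
        simp
      rw [this]
      have h2 := not_crossing_half (i, true) (k', true) (θ⁻¹ (g * g'⁻¹))
      intro hcr
      apply h2
      have conv : ∀ S T : Set (FreeGroup α), (im θ S ∩ im θ T).Nonempty → (S ∩ T).Nonempty := by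
        rintro S T ⟨x, hx⟩
        exact ⟨θ⁻¹ x, hx⟩
      exact ⟨conv _ _ hcr.1, conv _ _ hcr.2.1, conv _ _ hcr.2.2.1, conv _ _ hcr.2.2.2⟩
    rcases u with ⟨a, _ | _⟩
    · rw [← crossing_compl_right, compl_tr_half]; exact h1 _
    · exact h1 g
  obtain ⟨σ, hσ⟩ := exists_perm_expo θ
  have hexp : ∀ i w, Multiplicative.toAdd (expo i (θ⁻¹ w)) =
      (dc (im θ (half (i, true))) w : ℤ) - dc (im θ (half (i, true))) w⁻¹ := by
    intro i w
    rw [toAdd_expo_eq, dc_im, dc_im, map_inv]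
  have hle : ∀ k, cx (vert φ k) ≤ cx (vert ψ (σ k)) := by
    intro k
    by_cases hk : k ∈ Z
    · have hsep : ∃ g, Sep (im θ (half (σ k, true))) g (FreeGroup.of k) := by
        by_contra hno
        push Not at hno
        apply hσ k
        have := dc_eq_dc_inv_of_not_sep ((AI_half _).im θ) (ltr_pow_injective (k, true)) hno
        rw [ltr_true] at this
        rw [hexp, this, sub_self]
      obtain ⟨g, hg⟩ := hsep
      have hν : ν (half (k, true)) ≤ ν (im θ (half (σ k, true))) := by
        have main := nu_half_le htr hc hsub irr _ (im θ (half (σ k, true))) rfl ((AI_half _).im θ)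
          (hJ (σ k)) g
        unfold Sep at hg
        have hi : (FreeGroup.of k)⁻¹ = ltr (lbar (k, true)) := by rw [← ltr_inv]; rfl
        rw [hi] at hg
        by_cases h1 : endsIn (im θ (half (σ k, true))) g (ltr (k, true))
        · exact main (k, true) hk h1 fun h2 => hg ⟨fun _ => h2, fun _ => h1⟩
        · rw [← nu_half_lbar htr hc]
          refine main (lbar (k, true)) hk ?_ (by rwa [lbar_lbar])
          by_contra h2
          exact hg ⟨fun h => absurd h h1, fun h => absurd h h2⟩
      rw [hνφ, hνψ] at hν
      rcases hν.lt_or_eq with hlt | heq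
      · exact (cx_lt hlt).le
      -- equal symmetric complexity: the vertex is the old one or its inverse
      set B := im θ (half (σ k, true)) with hB
      have hBAI : AI B := (AI_half _).im θ
      have hsym : ∀ x, dc B (ltr x) + dc B (ltr x)⁻¹ =
          dc (half (k, true)) (ltr x) + dc (half (k, true)) (ltr x)⁻¹ := by
        intro x
        have := symCx_eq heq (φ (ltr x))
        rw [vert_eq_dc φ ψ, vert_eq_dc φ ψ, vert, vert, ← map_inv, MulAut.inv_apply_self,
          MulAut.inv_apply_self] at this
        exact this.symm
      have hval : ∀ u x : α × Bool, dc (half u) (ltr x) = if x = u then 1 else 0 := by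
        intro u x
        rw [dc, dirSet_half_ltr]; split_ifs <;> simp
      have hBx : ∀ x : α × Bool, x.1 ≠ k → dc B (ltr x) = 0 := by
        intro x hx
        have := hsym x
        rw [ltr_inv, hval, hval, if_neg (fun h => hx (by rw [h])),
          if_neg (fun h => hx (by rw [← lbar_fst, h]))] at this
        omega
      have hBk : dc B (ltr (k, true)) + dc B (ltr (k, false)) = 1 := by
        have := hsym (k, true)
        rw [ltr_inv, hval, hval] at this
        simpa [lbar] using this
      by_cases h1 : dc B (ltr (k, true)) = 1
      · have h2 : ∀ x, dc B (ltr x) = dc (half (k, true)) (ltr x) := by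
          rintro ⟨a, b⟩
          rw [hval]
          by_cases ha : a = k
          · subst ha
            cases b
            · simp; omega
            · simp [h1]
          · rw [hBx _ ha, if_neg (by simp [ha])]
        obtain ⟨g, hg⟩ := exists_eq_tr_half hBAI h2
        apply le_of_eq
        congr 1
        funext w
        rw [vert_eq_dc φ ψ, ← hθ, ← hB, hg, dc_tr]; rfl
      · have h2 : ∀ x, dc B (ltr x) = dc (half (k, false)) (ltr x) := by
          rintro ⟨a, b⟩
          rw [hval]
          by_cases ha : a = k
          · subst ha
            cases b
            · simp; omega
            · simp; omega
          · rw [hBx _ ha, if_neg (by simp [ha])]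
        obtain ⟨g, hg⟩ := exists_eq_tr_half hBAI h2
        obtain ⟨ω, hω1, hω2⟩ := exists_flip k
        have h3 := hirr k hk (φ * ω) (by
          intro i hi
          funext w
          rw [vert_eq_dc φ (φ * ω), inv_mul_cancel_left, hω2 (i, true) hi]; rfl)
        refine h3.trans (le_of_eq ?_)
        congr 1
        funext w
        rw [vert_eq_dc φ (φ * ω), inv_mul_cancel_left, hω1, vert_eq_dc φ ψ, ← hθ, ← hB, hg, dc_tr]
    · obtain ⟨k', h1, g, hg⟩ := hcomm k hk
      have : σ k = k' := by
        have h2 := hσ (σ.symm k')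
        rw [Equiv.apply_symm_apply, hexp, hg, dc_tr, dc_tr, ← toAdd_expo_eq] at h2
        have h3 : σ.symm k' = k := by
          by_contra hne
          exact h2 (by simp [expo, hne])
        rw [← h3, Equiv.apply_symm_apply]
      rw [this, h1]
  have hsum : level ψ = ∑ k, cx (vert ψ (σ k)) := (Equiv.sum_comp σ fun k => cx (vert ψ k)).symm
  have hlev : level φ ≤ level ψ := by
    rw [hsum]; exact Finset.sum_le_sum fun k _ => hle k
  refine ⟨rk_le hlev, fun heq => ?_⟩
  have hlev' := hlev.antisymm (level_le_of_rk_le heq.ge)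
  rw [hsum] at hlev'
  have hall := (Finset.sum_eq_sum_iff_of_le fun k _ => hle k).1 hlev'
  have hv : ∀ k, vert φ k = vert ψ (σ k) := fun k => cx_injective (hall k (Finset.mem_univ k))
  ext v
  constructor
  · rintro ⟨k, rfl⟩; exact ⟨σ k, (hv k).symm⟩
  · rintro ⟨k, rfl⟩; exact ⟨σ.symm k, by rw [hv, Equiv.apply_symm_apply]⟩

end Chambers

section ListComplex
variable {V M : Type} [AddCommGroup M]

/-- The alternating sum over the faces of a list. -/
def bd : (List V → M) → List V → M
  | _, [] => 0
  | f, y :: x => f x - bd (fun z => f (y :: z)) x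

theorem bd_congr {f g : List V → M} {x : List V} (h : ∀ z, z.Sublist x → z.length + 1 = x.length →
    f z = g z) : bd f x = bd g x := by
  induction x generalizing f g with
  | nil => rfl
  | cons y x ih =>
    rw [bd, bd, h x (List.sublist_cons_self y x) rfl, ih]
    exact fun z hz hl => h _ (hz.cons_cons y) (by simpa using hl)

theorem bd_add (f g : List V → M) (x : List V) : bd (f + g) x = bd f x + bd g x := by
  induction x generalizing f g with
  | nil => simp [bd]
  | cons y x ih =>
    have := ih (fun z => f (y :: z)) (fun z => g (y :: z))
    rw [bd, bd, bd, show (fun z => (f + g) (y :: z)) =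
      (fun z => f (y :: z)) + (fun z => g (y :: z)) from rfl, this, Pi.add_apply]
    abel

theorem bd_map {N : Type} [AddCommGroup N] (φ : M →+ N) (f : List V → M) (x : List V) :
    bd (fun z => φ (f z)) x = φ (bd f x) := by
  induction x generalizing f with
  | nil => simp [bd]
  | cons y x ih => rw [bd, bd, map_sub, ih]

theorem bd_sub (f g : List V → M) (x : List V) : bd (f - g) x = bd f x - bd g x := by
  rw [eq_sub_iff_add_eq, ← bd_add, sub_add_cancel]

theorem bd_zero (x : List V) : bd (0 : List V → M) x = 0 := by
  have := bd_sub (0 : List V → M) 0 x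
  simpa using this

theorem bd_bd (f : List V → M) (x : List V) : bd (bd f) x = 0 := by
  induction x generalizing f with
  | nil => rfl
  | cons y x ih =>
    rw [bd, show (fun z => bd f (y :: z)) = f - bd (fun z => f (y :: z)) from rfl, bd_sub, ih]
    simp

theorem bd_comp {W : Type} (σ : V → W) (f : List W → M) (x : List V) :
    bd (fun z => f (z.map σ)) x = bd f (x.map σ) := by
  induction x generalizing f with
  | nil => rfl
  | cons y x ih => rw [List.map_cons, bd, bd, ← ih]; rfl

end ListComplex

section Complex
variable {α : Type} [Fintype α] [DecidableEq α] {q : ℕ}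

/-- A list of vertices spanning a simplex. -/
def Valid (x : List (FreeGroup α → ℕ)) : Prop :=
  ∃ φ : MulAut (FreeGroup α), ∀ v ∈ x, v ∈ Set.range (vert φ)

/-- The elements which do not meet the vertices of a list. -/
def Avoid (x : List (FreeGroup α → ℕ)) (w : FreeGroup α) : Prop := ∀ v ∈ x, v w = 0 ∧ v w⁻¹ = 0

/-- A simplex and a tuple of elements avoiding it. -/
def Ok (x : List (FreeGroup α → ℕ)) (t : Fin q → FreeGroup α) : Prop :=
  Valid x ∧ ∀ k, Avoid x (t k)

theorem Valid.sublist {x z : List (FreeGroup α → ℕ)} (h : Valid x) (hz : z.Sublist x) : Valid z :=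
  h.imp fun _ hφ v hv => hφ v (hz.subset hv)

theorem Avoid.sublist {x z : List (FreeGroup α → ℕ)} {w : FreeGroup α} (h : Avoid x w)
    (hz : z.Sublist x) : Avoid z w := fun v hv => h v (hz.subset hv)

theorem Ok.sublist {x z : List (FreeGroup α → ℕ)} {t : Fin q → FreeGroup α} (h : Ok x t)
    (hz : z.Sublist x) : Ok z t := ⟨h.1.sublist hz, fun k => (h.2 k).sublist hz⟩

/-- Words not involving a given generator form a subgroup. -/
theorem dc_eq_zero_mul {A : Set (FreeGroup α)} (hA : AI A) {u w : FreeGroup α}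
    (hu : dc A u = 0) (hw : dc A w = 0) : dc A (u * w) = 0 := by
  rw [dc, Set.ncard_eq_zero (hA _)] at *
  rw [Set.eq_empty_iff_forall_notMem]
  rintro g ⟨h1, h2⟩
  by_cases h : g * u ∈ A
  · exact Set.eq_empty_iff_forall_notMem.1 hu g ⟨h1, h⟩
  · exact Set.eq_empty_iff_forall_notMem.1 hw (g * u) ⟨h, by rwa [mul_assoc]⟩

theorem Avoid.mul {x : List (FreeGroup α → ℕ)} (hx : Valid x) {u w : FreeGroup α}
    (hu : Avoid x u) (hw : Avoid x w) : Avoid x (u * w) := by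
  obtain ⟨φ, hφ⟩ := hx
  intro v hv
  obtain ⟨j, rfl⟩ := hφ v hv
  have h1 := hu _ hv
  have h2 := hw _ hv
  simp only [vert] at h1 h2 ⊢
  rw [mul_inv_rev, map_mul, map_mul]
  exact ⟨dc_eq_zero_mul (AI_half _) h1.1 h2.1, dc_eq_zero_mul (AI_half _) h2.2 h1.2⟩

theorem Avoid.inv {x : List (FreeGroup α → ℕ)} {u : FreeGroup α}
    (hu : Avoid x u) : Avoid x u⁻¹ := fun v hv => ⟨(hu v hv).2, by rw [inv_inv]; exact (hu v hv).1⟩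

theorem Avoid.one {x : List (FreeGroup α → ℕ)} (hx : Valid x) : Avoid x 1 := by
  obtain ⟨φ, hφ⟩ := hx
  intro v hv
  obtain ⟨j, rfl⟩ := hφ v hv
  simp [vert, dc_one]

theorem ok_update {x : List (FreeGroup α → ℕ)} {t : Fin q → FreeGroup α} (h : Ok x t) {k : Fin q}
    {w : FreeGroup α} : Ok x (Function.update t k w) ↔ Avoid x w := by
  constructor
  · intro h'; simpa using h'.2 k
  · intro hw
    refine ⟨h.1, fun j => ?_⟩
    by_cases hj : j = k
    · subst hj; simpa using hw
    · rw [Function.update_of_ne hj]; exact h.2 j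

variable (α q) in
/-- The cochains in degree `l`: multiadditive functions on the subgroups avoiding a simplex. -/
def Ch (l : ℕ) : Submodule ℚ (List (FreeGroup α → ℕ) → (Fin q → FreeGroup α) → ℚ) where
  carrier := {f | (∀ x t, ¬ (x.length = l ∧ Ok x t) → f x t = 0) ∧
    ∀ x t, Ok x t → ∀ k u w, Avoid x u → Avoid x w →
      f x (Function.update t k (u * w)) =
        f x (Function.update t k u) + f x (Function.update t k w)}
  add_mem' := by
    rintro f g ⟨h1, h2⟩ ⟨h3, h4⟩
    refine ⟨fun x t h => by simp [h1 x t h, h3 x t h], fun x t h k u w hu hw => ?_⟩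
    simp only [Pi.add_apply, h2 x t h k u w hu hw, h4 x t h k u w hu hw]
    ring
  zero_mem' := ⟨fun _ _ _ => rfl, fun _ _ _ _ _ _ _ _ => by simp⟩
  smul_mem' := by
    rintro c f ⟨h1, h2⟩
    refine ⟨fun x t h => by simp [h1 x t h], fun x t h k u w hu hw => ?_⟩
    simp only [Pi.smul_apply, smul_eq_mul, h2 x t h k u w hu hw]
    ring

open Classical in
/-- The truncation of a function to pairs of a simplex and a tuple avoiding it. -/
def trunc (f : List (FreeGroup α → ℕ) → (Fin q → FreeGroup α) → ℚ) :
    List (FreeGroup α → ℕ) → (Fin q → FreeGroup α) → ℚ := fun x t => if Ok x t then f x t else 0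

/-- The differential. -/
def dif (f : List (FreeGroup α → ℕ) → (Fin q → FreeGroup α) → ℚ) :
    List (FreeGroup α → ℕ) → (Fin q → FreeGroup α) → ℚ := trunc (bd f)

theorem dif_of_ok {f : List (FreeGroup α → ℕ) → (Fin q → FreeGroup α) → ℚ}
    {x : List (FreeGroup α → ℕ)} {t : Fin q → FreeGroup α} (h : Ok x t) :
    dif f x t = bd f x t := if_pos h

theorem bd_apply (f : List (FreeGroup α → ℕ) → (Fin q → FreeGroup α) → ℚ)
    (x : List (FreeGroup α → ℕ)) (t : Fin q → FreeGroup α) :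
    bd f x t = bd (fun z => f z t) x :=
  (bd_map (Pi.evalAddMonoidHom (fun _ : Fin q → FreeGroup α => ℚ) t) f x).symm

theorem dif_dif (f : List (FreeGroup α → ℕ) → (Fin q → FreeGroup α) → ℚ) : dif (dif f) = 0 := by
  funext x t
  by_cases h : Ok x t
  · rw [dif_of_ok h, bd_apply, bd_congr (g := fun z => bd f z t), ← bd_apply, bd_bd]
    · rfl
    · exact fun z hz _ => dif_of_ok (h.sublist hz)
  · exact if_neg h

theorem dif_add (f g : List (FreeGroup α → ℕ) → (Fin q → FreeGroup α) → ℚ) :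
    dif (f + g) = dif f + dif g := by
  funext x t
  by_cases h : Ok x t
  · rw [Pi.add_apply, Pi.add_apply, dif_of_ok h, dif_of_ok h, dif_of_ok h, bd_add]; rfl
  · simp [dif, trunc, h]

theorem dif_sub (f g : List (FreeGroup α → ℕ) → (Fin q → FreeGroup α) → ℚ) :
    dif (f - g) = dif f - dif g := by
  rw [eq_sub_iff_add_eq, ← dif_add, sub_add_cancel]

theorem dif_smul (c : ℚ) (f : List (FreeGroup α → ℕ) → (Fin q → FreeGroup α) → ℚ) :
    dif (c • f) = c • dif f := by
  funext x t
  by_cases h : Ok x t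
  · rw [Pi.smul_apply, Pi.smul_apply, dif_of_ok h, dif_of_ok h, bd_apply, bd_apply]
    exact bd_map (DistribSMul.toAddMonoidHom ℚ c) (fun z => f z t) x
  · simp [dif, trunc, h]

theorem dif_mem {l : ℕ} {f : List (FreeGroup α → ℕ) → (Fin q → FreeGroup α) → ℚ}
    (hf : f ∈ Ch α q l) : dif f ∈ Ch α q (l + 1) := by
  constructor
  · intro x t hn
    by_cases h : Ok x t
    · rw [dif_of_ok h, bd_apply, bd_congr (g := 0), bd_zero]
      intro z hz hl
      exact hf.1 z t fun h' => hn ⟨by omega, h⟩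
    · exact if_neg h
  · intro x t h k u w hu hw
    rw [dif_of_ok ((ok_update h).2 (hu.mul h.1 hw)), dif_of_ok ((ok_update h).2 hu),
      dif_of_ok ((ok_update h).2 hw), bd_apply, bd_apply, bd_apply, ← bd_add]
    refine bd_congr fun z hz _ => ?_
    exact hf.2 z t (h.sublist hz) k u w (hu.sublist hz) (hw.sublist hz)

end Complex

section Exactness
variable {α : Type} [Fintype α] [DecidableEq α] {q : ℕ}

theorem dc_of_mul_ltr_le {u x : α × Bool} {w : FreeGroup α} (h : w⁻¹ ∉ half x) :
    dc (half u) w ≤ dc (half u) (w * ltr x) ∧ dc (half u) (ltr x) ≤ dc (half u) (w * ltr x) := by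
  have h1 := dc_half_mul_ltr (u := u) (x := x) (w := 1) (by simpa using one_notMem_half x)
  rw [one_mul, dc_one] at h1
  rw [dc_half_mul_ltr h, h1]
  omega

theorem dc_ltr (u x : α × Bool) : dc (half u) (ltr x) = if x = u then 1 else 0 := by
  have h1 := dc_half_mul_ltr (u := u) (x := x) (w := 1) (by simpa using one_notMem_half x)
  simpa [dc_one] using h1

theorem vert_of (φ : MulAut (FreeGroup α)) (j k : α) :
    vert φ j (φ (FreeGroup.of k)) = if k = j then 1 else 0 := by
  rw [vert, MulAut.inv_apply_self, ← ltr_true, dc_ltr]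
  simp

theorem vert_of_inv (φ : MulAut (FreeGroup α)) (j k : α) :
    vert φ j (φ (FreeGroup.of k))⁻¹ = 0 := by
  rw [vert, ← map_inv, MulAut.inv_apply_self, ← ltr_false, dc_ltr]
  simp

theorem vert_injective (φ : MulAut (FreeGroup α)) : Function.Injective (vert φ) := by
  intro a b h
  have := congrFun h (φ (FreeGroup.of b))
  rw [vert_of, vert_of, if_pos rfl] at this
  by_contra hc
  rw [if_neg (Ne.symm hc)] at this
  omega

theorem avoid_of {x : List (FreeGroup α → ℕ)} {φ : MulAut (FreeGroup α)}
    (hφ : ∀ v ∈ x, v ∈ Set.range (vert φ)) (k : α) :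
    Avoid x (φ (FreeGroup.of k)) ↔ vert φ k ∉ x := by
  constructor
  · intro h hk
    have := (h _ hk).1
    rw [vert_of, if_pos rfl] at this
    omega
  · intro h v hv
    obtain ⟨j, rfl⟩ := hφ v hv
    refine ⟨?_, vert_of_inv _ _ _⟩
    rw [vert_of, if_neg]
    rintro rfl
    exact h hv

/-- An additive function on the elements avoiding a simplex is determined by its values on
generators. -/
theorem eq_zero_of_gens {x : List (FreeGroup α → ℕ)} {φ : MulAut (FreeGroup α)}
    (hφ : ∀ v ∈ x, v ∈ Set.range (vert φ)) (h : FreeGroup α → ℚ)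
    (hadd : ∀ u w, Avoid x u → Avoid x w → h (u * w) = h u + h w)
    (h0 : ∀ k, vert φ k ∉ x → h (φ (FreeGroup.of k)) = 0) (w : FreeGroup α) (hw : Avoid x w) :
    h w = 0 := by
  have hone : h 1 = 0 := by
    have := hadd 1 1 (Avoid.one ⟨φ, hφ⟩) (Avoid.one ⟨φ, hφ⟩)
    simpa using this
  have key : ∀ w, Avoid x (φ w) → h (φ w) = 0 := by
    refine right_induction ?_ ?_
    · intro _; simpa using hone
    · intro w y hy ih hav
      have hboth : Avoid x (φ w) ∧ Avoid x (φ (ltr y)) := by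
        have : ∀ v ∈ x, (v (φ w) = 0 ∧ v (φ w)⁻¹ = 0) ∧ v (φ (ltr y)) = 0 ∧ v (φ (ltr y))⁻¹ = 0 := by
          intro v hv
          have h1 := hav v hv
          obtain ⟨j, rfl⟩ := hφ v hv
          simp only [vert, ← map_inv, MulAut.inv_apply_self] at h1 ⊢
          simp only [dc_half_inv] at h1 ⊢
          have h2 := dc_of_mul_ltr_le (u := (j, true)) hy
          have h3 := dc_of_mul_ltr_le (u := lbar (j, true)) hy
          omega
        exact ⟨fun v hv => (this v hv).1, fun v hv => (this v hv).2⟩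
      rw [map_mul, hadd _ _ hboth.1 hboth.2, ih hboth.1, zero_add]
      obtain ⟨k, b⟩ := y
      cases b
      · rw [ltr_false, map_inv] at hboth ⊢
        have h1 := hboth.2.inv
        rw [inv_inv] at h1
        have h2 := hadd _ _ h1 hboth.2
        rw [mul_inv_cancel, hone, h0 k ((avoid_of hφ k).1 h1)] at h2
        linarith
      · rw [ltr_true] at hboth ⊢
        exact h0 k ((avoid_of hφ k).1 hboth.2)
  have := key (φ⁻¹ w)
  rw [MulAut.apply_inv_self] at this
  exact this hw

/-- Multiadditivity on the elements avoiding a simplex. -/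
def MultiAdd (x : List (FreeGroup α → ℕ)) (f : (Fin q → FreeGroup α) → ℚ) : Prop :=
  ∀ t, (∀ k, Avoid x (t k)) → ∀ k u w, Avoid x u → Avoid x w →
    f (Function.update t k (u * w)) = f (Function.update t k u) + f (Function.update t k w)

theorem MultiAdd.eq_of_gens {x : List (FreeGroup α → ℕ)} {φ : MulAut (FreeGroup α)}
    (hφ : ∀ v ∈ x, v ∈ Set.range (vert φ)) {f g : (Fin q → FreeGroup α) → ℚ}
    (hf : MultiAdd x f) (hg : MultiAdd x g)
    (h : ∀ s : Fin q → α, (∀ k, vert φ (s k) ∉ x) →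
      f (fun k => φ (FreeGroup.of (s k))) = g (fun k => φ (FreeGroup.of (s k))))
    (t : Fin q → FreeGroup α) (ht : ∀ k, Avoid x (t k)) : f t = g t := by
  classical
  have key : ∀ S : Finset (Fin q), ∀ t : Fin q → FreeGroup α, (∀ k, Avoid x (t k)) →
      (∀ k ∉ S, ∃ a, t k = φ (FreeGroup.of a)) → f t = g t := by
    intro S
    induction S using Finset.induction_on with
    | empty =>
      intro t ht h1
      choose s hs using fun k => h1 k (Finset.notMem_empty k)
      have e : t = fun k => φ (FreeGroup.of (s k)) := funext hs
      rw [e]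
      refine h s fun k => ?_
      rw [← avoid_of hφ, ← hs]
      exact ht k
    | insert k S hk ih =>
      intro t ht h1
      have := eq_zero_of_gens hφ
        (fun w => f (Function.update t k w) - g (Function.update t k w)) ?_ ?_ (t k) (ht k)
      · simpa [sub_eq_zero] using this
      · intro u w hu hw
        simp only [hf t ht k u w hu hw, hg t ht k u w hu hw]
        ring
      · intro a ha
        rw [sub_eq_zero]
        apply ih
        · intro j
          by_cases hj : j = k
          · subst hj; simpa using (avoid_of hφ a).2 ha
          · rw [Function.update_of_ne hj]; exact ht j
        · intro j hj
          by_cases hjk : j = k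
          · subst hjk; exact ⟨a, by simp⟩
          · rw [Function.update_of_ne hjk]
            exact h1 j (by simp [hj, hjk])
  exact key Finset.univ t ht (by simp)

/-- The product of the exponent sums of a tuple. -/
def coef (φ : MulAut (FreeGroup α)) (s : Fin q → α) (t : Fin q → FreeGroup α) : ℚ :=
  ∏ k, ((Multiplicative.toAdd (expo (s k) (φ⁻¹ (t k))) : ℤ) : ℚ)

theorem coef_update (φ : MulAut (FreeGroup α)) (s : Fin q → α) (t : Fin q → FreeGroup α)
    (k : Fin q) (u w : FreeGroup α) :
    coef φ s (Function.update t k (u * w)) =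
      coef φ s (Function.update t k u) + coef φ s (Function.update t k w) := by
  have : ∀ w, coef φ s (Function.update t k w) =
      ((Multiplicative.toAdd (expo (s k) (φ⁻¹ w)) : ℤ) : ℚ) * ∏ j ∈ Finset.univ.erase k,
        ((Multiplicative.toAdd (expo (s j) (φ⁻¹ (t j))) : ℤ) : ℚ) := by
    intro w
    rw [coef, ← Finset.mul_prod_erase _ _ (Finset.mem_univ k), Function.update_self]
    congr 1
    refine Finset.prod_congr rfl fun j hj => ?_
    rw [Function.update_of_ne (Finset.ne_of_mem_erase hj)]
  rw [this, this, this, map_mul, map_mul, toAdd_mul]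
  push_cast
  ring

theorem coef_of (φ : MulAut (FreeGroup α)) (s s' : Fin q → α) :
    coef φ s' (fun k => φ (FreeGroup.of (s k))) = if s = s' then 1 else 0 := by
  have : ∀ k, ((Multiplicative.toAdd (expo (s' k) (φ⁻¹ (φ (FreeGroup.of (s k))))) : ℤ) : ℚ) =
      if s k = s' k then 1 else 0 := by
    intro k
    rw [MulAut.inv_apply_self, expo, FreeGroup.lift_apply_of, toAdd_ofAdd]
    push_cast
    rfl
  simp only [coef, this]
  rw [Finset.prod_ite_zero]
  simp [funext_iff]

/-- The least rank of a basis containing a simplex. -/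
def rkL (x : List (FreeGroup α → ℕ)) : ℕ :=
  sInf {r | ∃ φ : MulAut (FreeGroup α), (∀ v ∈ x, v ∈ Set.range (vert φ)) ∧ rk φ = r}

theorem rkL_le {x : List (FreeGroup α → ℕ)} {φ : MulAut (FreeGroup α)}
    (h : ∀ v ∈ x, v ∈ Set.range (vert φ)) : rkL x ≤ rk φ := Nat.sInf_le ⟨φ, h, rfl⟩

theorem exists_rkL {x : List (FreeGroup α → ℕ)} (h : Valid x) : ∃ φ : MulAut (FreeGroup α),
    (∀ v ∈ x, v ∈ Set.range (vert φ)) ∧ rk φ = rkL x := by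
  obtain ⟨φ, hφ⟩ := h
  exact Nat.sInf_mem (s := {r | ∃ φ : MulAut (FreeGroup α),
    (∀ v ∈ x, v ∈ Set.range (vert φ)) ∧ rk φ = r}) ⟨_, φ, hφ, rfl⟩

theorem rkL_sublist {x z : List (FreeGroup α → ℕ)} (h : Valid x) (hz : z.Sublist x) :
    rkL z ≤ rkL x := by
  obtain ⟨φ, h1, h2⟩ := exists_rkL h
  rw [← h2]
  exact rkL_le fun v hv => h1 v (hz.subset hv)

/-- The rank can be lowered by changing one basis element. -/
def Red (φ : MulAut (FreeGroup α)) (j : α) : Prop :=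
  ∃ ψ' : MulAut (FreeGroup α), (∀ i ≠ j, vert φ i ∈ Set.range (vert ψ')) ∧ rk ψ' < rk φ

theorem mem_of_red {x : List (FreeGroup α → ℕ)} {φ : MulAut (FreeGroup α)}
    (h : ∀ v ∈ x, v ∈ Set.range (vert φ)) (hr : rk φ = rkL x) {j : α} (hj : Red φ j) :
    vert φ j ∈ x := by
  obtain ⟨ψ, h1, h2⟩ := hj
  by_contra hc
  have : rkL x ≤ rk ψ := rkL_le fun v hv => by
    obtain ⟨i, rfl⟩ := h v hv
    exact h1 i (by rintro rfl; exact hc hv)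
  omega

theorem range_eq_of_rkL {x : List (FreeGroup α → ℕ)} {φ ψ : MulAut (FreeGroup α)}
    (h : ∀ v ∈ x, v ∈ Set.range (vert φ)) (hr : rk φ = rkL x)
    (h' : ∀ v ∈ x, v ∈ Set.range (vert ψ)) (hr' : rk ψ = rkL x) :
    Set.range (vert φ) = Set.range (vert ψ) :=
  (peak_reduction φ ψ fun _ hj => h' _ (mem_of_red h hr hj)).2 (hr.trans hr'.symm)

theorem rk_eq_of_range_eq {φ ψ : MulAut (FreeGroup α)}
    (h : Set.range (vert φ) = Set.range (vert ψ)) : rk φ = rk ψ :=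
  le_antisymm (peak_reduction φ ψ fun j _ => h ▸ ⟨j, rfl⟩).1
    (peak_reduction ψ φ fun j _ => h ▸ ⟨j, rfl⟩).1

open Classical in
/-- A choice of an automorphism with a given set of vertices. -/
def rep (K : Set (FreeGroup α → ℕ)) : MulAut (FreeGroup α) :=
  if h : ∃ φ : MulAut (FreeGroup α), Set.range (vert φ) = K then h.choose else 1

theorem range_rep (φ : MulAut (FreeGroup α)) :
    Set.range (vert (rep (Set.range (vert φ)))) = Set.range (vert φ) := by
  have h : ∃ ψ : MulAut (FreeGroup α), Set.range (vert ψ) = Set.range (vert φ) := ⟨φ, rfl⟩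
  rw [rep, dif_pos h]
  exact h.choose_spec

/-- The preferred basis containing a simplex. -/
def pref (x : List (FreeGroup α → ℕ)) : MulAut (FreeGroup α) :=
  rep {v | ∃ φ : MulAut (FreeGroup α), (∀ u ∈ x, u ∈ Set.range (vert φ)) ∧ rk φ = rkL x ∧
    v ∈ Set.range (vert φ)}

theorem pref_eq {x : List (FreeGroup α → ℕ)} {φ : MulAut (FreeGroup α)}
    (h : ∀ v ∈ x, v ∈ Set.range (vert φ)) (hr : rk φ = rkL x) :
    pref x = rep (Set.range (vert φ)) := by
  rw [pref]
  congr 1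
  ext v
  constructor
  · rintro ⟨ψ, h1, h2, h3⟩
    rwa [range_eq_of_rkL h hr h1 h2]
  · exact fun hv => ⟨φ, h, hr, hv⟩

theorem mem_pref {x : List (FreeGroup α → ℕ)} (hx : Valid x) :
    ∀ v ∈ x, v ∈ Set.range (vert (pref x)) := by
  obtain ⟨φ, h1, h2⟩ := exists_rkL hx
  rw [pref_eq h1 h2, range_rep]
  exact h1

theorem rk_pref {x : List (FreeGroup α → ℕ)} (hx : Valid x) : rk (pref x) = rkL x := by
  obtain ⟨φ, h1, h2⟩ := exists_rkL hx
  rw [pref_eq h1 h2, rk_eq_of_range_eq (range_rep φ), h2]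

theorem pref_sublist {x z : List (FreeGroup α → ℕ)} (hx : Valid x) (hz : z.Sublist x)
    (hr : rkL z = rkL x) : pref z = pref x := by
  obtain ⟨φ, h1, h2⟩ := exists_rkL hx
  rw [pref_eq h1 h2, pref_eq (fun v hv => h1 v (hz.subset hv)) (h2.trans hr.symm)]

open Classical in
/-- A vertex of a basis which is neither reducible nor in a given tuple. -/
def cone (φ : MulAut (FreeGroup α)) (s : Fin q → α) : FreeGroup α → ℕ :=
  if h : ∃ y, ¬ Red φ y ∧ y ∉ Set.range s then vert φ h.choose else 0

theorem cone_spec {x : List (FreeGroup α → ℕ)} (hx : Valid x)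
    (hq : x.length + q < Fintype.card α) (s : Fin q → α) :
    ∃ y, ¬ Red (pref x) y ∧ y ∉ Set.range s ∧ cone (pref x) s = vert (pref x) y := by
  classical
  have h : ∃ y, ¬ Red (pref x) y ∧ y ∉ Set.range s := by
    by_contra hc
    push Not at hc
    have h1 : (Finset.univ : Finset α) ⊆
        (Finset.univ.filter fun y => vert (pref x) y ∈ x) ∪ Finset.univ.image s := by
      intro y _
      by_cases hy : Red (pref x) y
      · exact Finset.mem_union_left _
          (by simpa using mem_of_red (mem_pref hx) (rk_pref hx) hy)
      · exact Finset.mem_union_right _ (by simpa using hc y hy)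
    have h2 := (Finset.card_le_card h1).trans (Finset.card_union_le _ _)
    have h3 : (Finset.univ.filter fun y => vert (pref x) y ∈ x).card ≤ x.length := by
      rw [← Finset.card_image_of_injective _ (vert_injective (pref x))]
      refine (Finset.card_le_card (t := x.toFinset) ?_).trans x.toFinset_card_le
      intro v hv
      simp only [Finset.mem_image, Finset.mem_filter, Finset.mem_univ, true_and] at hv
      obtain ⟨a, ha, rfl⟩ := hv
      simpa using ha
    have h4 : (Finset.univ.image s).card ≤ q := by
      simpa using Finset.card_image_le (s := Finset.univ) (f := s)
    rw [Finset.card_univ] at h2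
    omega
  exact ⟨h.choose, h.choose_spec.1, h.choose_spec.2, dif_pos h⟩

open Classical in
/-- The contracting homotopy in a given rank. -/
def hop (l k : ℕ) (f : List (FreeGroup α → ℕ) → (Fin q → FreeGroup α) → ℚ) :
    List (FreeGroup α → ℕ) → (Fin q → FreeGroup α) → ℚ := fun z t =>
  if rkL z = k ∧ z.length = l ∧ Ok z t then ∑ s : Fin q → α, coef (pref z) s t *
    f (cone (pref z) s :: z) (fun k => pref z (FreeGroup.of (s k))) else 0

theorem hop_mem (l k : ℕ) (f : List (FreeGroup α → ℕ) → (Fin q → FreeGroup α) → ℚ) :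
    hop l k f ∈ Ch α q l := by
  constructor
  · intro x t h
    exact if_neg fun h' => h h'.2
  · intro x t h j u w hu hw
    by_cases hc : rkL x = k ∧ x.length = l
    · rw [hop, if_pos ⟨hc.1, hc.2, (ok_update h).2 (hu.mul h.1 hw)⟩, hop,
        if_pos ⟨hc.1, hc.2, (ok_update h).2 hu⟩, hop, if_pos ⟨hc.1, hc.2, (ok_update h).2 hw⟩,
        ← Finset.sum_add_distrib]
      refine Finset.sum_congr rfl fun s _ => ?_
      rw [coef_update]
      ring
    · rw [hop, if_neg (by tauto), hop, if_neg (by tauto), hop, if_neg (by tauto), add_zero]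

theorem multiAdd_of_mem {l : ℕ} {f : List (FreeGroup α → ℕ) → (Fin q → FreeGroup α) → ℚ}
    (hf : f ∈ Ch α q l) {x : List (FreeGroup α → ℕ)} (hx : Valid x) : MultiAdd x (f x) :=
  fun t ht k u w hu hw => hf.2 x t ⟨hx, ht⟩ k u w hu hw

theorem dif_hop {l k : ℕ} (hl : l + 1 + q < Fintype.card α)
    {f : List (FreeGroup α → ℕ) → (Fin q → FreeGroup α) → ℚ}
    (hf : f ∈ Ch α q (l + 1)) (hd : dif f = 0) (hk : ∀ z t, rkL z < k → f z t = 0)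
    {x : List (FreeGroup α → ℕ)} (hx : Valid x) (hxl : x.length = l + 1) (hxk : rkL x = k)
    {t : Fin q → FreeGroup α} (ht : ∀ k, Avoid x (t k)) : dif (hop l k f) x t = f x t := by
  have hφ := mem_pref hx
  refine MultiAdd.eq_of_gens hφ (multiAdd_of_mem (dif_mem (hop_mem l k f)) hx)
    (multiAdd_of_mem hf hx) ?_ t ht
  intro s hs
  set φ := pref x with hφd
  have hok : Ok x fun k => φ (FreeGroup.of (s k)) := ⟨hx, fun k => (avoid_of hφ _).2 (hs k)⟩
  obtain ⟨y, hy1, hy2, hy3⟩ := cone_spec hx (by omega) s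
  rw [← hφd] at hy1 hy3
  have hok' : Ok (vert φ y :: x) fun k => φ (FreeGroup.of (s k)) := by
    have hv : ∀ v ∈ vert φ y :: x, v ∈ Set.range (vert φ) := by
      intro v hv
      rcases List.mem_cons.1 hv with rfl | hv
      · exact ⟨y, rfl⟩
      · exact hφ v hv
    refine ⟨⟨φ, hv⟩, fun k => (avoid_of hv _).2 ?_⟩
    rw [List.mem_cons, not_or]
    exact ⟨fun h => hy2 ⟨k, vert_injective φ h⟩, hs k⟩
  rw [dif_of_ok hok, bd_apply,
    bd_congr (g := fun z => f (vert φ y :: z) fun k => φ (FreeGroup.of (s k)))]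
  · have h1 := congrFun (congrFun hd (vert φ y :: x)) fun k => φ (FreeGroup.of (s k))
    rw [dif_of_ok hok', bd_apply, bd] at h1
    exact (sub_eq_zero.1 h1).symm
  · intro z hz hzl
    by_cases hzk : rkL z = k
    · have hp : pref z = φ := pref_sublist hx hz (hzk.trans hxk.symm)
      rw [hop, if_pos ⟨hzk, by omega, hok.sublist hz⟩, hp]
      simp only [coef_of, ite_mul, one_mul, zero_mul, Finset.sum_ite_eq, Finset.mem_univ, if_true,
        hy3]
    · have hlt : rkL z < k := lt_of_le_of_ne (hxk ▸ rkL_sublist hx hz) hzk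
      rw [hop, if_neg fun h => hzk h.1]
      refine (hk _ _ ?_).symm
      obtain ⟨ψ, hψ1, hψ2⟩ := exists_rkL (hx.sublist hz)
      have hnot : ¬ ∀ j, Red φ j → vert φ j ∈ Set.range (vert ψ) := by
        intro h
        have h1 := (peak_reduction φ ψ h).1
        rw [rk_pref hx] at h1
        omega
      push Not at hnot
      obtain ⟨j, ⟨ψ', h1, h2⟩, h3⟩ := hnot
      rw [rk_pref hx, hxk] at h2
      refine lt_of_le_of_lt (rkL_le (φ := ψ') ?_) h2
      intro v hv
      rcases List.mem_cons.1 hv with rfl | hv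
      · refine h1 y ?_
        rintro rfl
        exact hy1 ⟨ψ', h1, by rw [rk_pref hx, hxk]; exact h2⟩
      · obtain ⟨i, rfl⟩ := hφ v (hz.subset hv)
        refine h1 i ?_
        rintro rfl
        exact h3 (hψ1 _ hv)

/-- Successive corrections of a cocycle. -/
def corr (l : ℕ) (f : List (FreeGroup α → ℕ) → (Fin q → FreeGroup α) → ℚ) :
    ℕ → List (FreeGroup α → ℕ) → (Fin q → FreeGroup α) → ℚ
  | 0 => f
  | k + 1 => corr l f k - dif (hop l k (corr l f k))

theorem corr_mem {l : ℕ} {f : List (FreeGroup α → ℕ) → (Fin q → FreeGroup α) → ℚ}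
    (hf : f ∈ Ch α q (l + 1)) (k : ℕ) : corr l f k ∈ Ch α q (l + 1) := by
  induction k with
  | zero => exact hf
  | succ k ih => exact Submodule.sub_mem _ ih (dif_mem (hop_mem _ _ _))

theorem dif_corr {l : ℕ} {f : List (FreeGroup α → ℕ) → (Fin q → FreeGroup α) → ℚ}
    (hd : dif f = 0) (k : ℕ) : dif (corr l f k) = 0 := by
  induction k with
  | zero => exact hd
  | succ k ih => rw [corr, dif_sub, ih, dif_dif, sub_zero]

theorem corr_eq_zero {l : ℕ} (hl : l + 1 + q < Fintype.card α)
    {f : List (FreeGroup α → ℕ) → (Fin q → FreeGroup α) → ℚ}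
    (hf : f ∈ Ch α q (l + 1)) (hd : dif f = 0) (k : ℕ) :
    ∀ z t, rkL z < k → corr l f k z t = 0 := by
  induction k with
  | zero => intro z t h; omega
  | succ k ih =>
    intro z t h
    by_cases hz : z.length = l + 1 ∧ Ok z t
    · rw [corr, Pi.sub_apply, Pi.sub_apply]
      by_cases hk : rkL z = k
      · rw [dif_hop hl (corr_mem hf k) (dif_corr hd k) ih hz.2.1 hz.1 hk hz.2.2, sub_self]
      · rw [ih z t (by omega), dif_of_ok hz.2, bd_apply, bd_congr (g := 0), bd_zero, sub_zero]
        intro x hx _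
        have := rkL_sublist hz.2.1 hx
        exact if_neg fun h' => by omega
    · exact (corr_mem hf _).1 z t hz

theorem exists_dif_eq {l : ℕ} (hl : l + 1 + q < Fintype.card α)
    {f : List (FreeGroup α → ℕ) → (Fin q → FreeGroup α) → ℚ}
    (hf : f ∈ Ch α q (l + 1)) (hd : dif f = 0) : ∃ g ∈ Ch α q l, dif g = f := by
  refine ⟨fun z t => hop l (rkL z) (corr l f (rkL z)) z t, ⟨fun x t h => ?_, fun x t h => ?_⟩, ?_⟩
  · exact (hop_mem _ _ _).1 x t h
  · exact (hop_mem l (rkL x) (corr l f (rkL x))).2 x t h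
  · have key : ∀ k, corr l f k = f - dif (∑ j ∈ Finset.range k, hop l j (corr l f j)) := by
      intro k
      induction k with
      | zero =>
        rw [corr, Finset.range_zero, Finset.sum_empty]
        have := dif_smul (0 : ℚ) f
        simp only [zero_smul] at this
        rw [this, sub_zero]
      | succ k ih => rw [corr, Finset.sum_range_succ, dif_add, ← sub_sub, ← ih]
    funext x t
    by_cases hx : x.length = l + 1 ∧ Ok x t
    · have h1 := corr_eq_zero hl hf hd (rkL x + 1) x t (by omega)
      rw [key, Pi.sub_apply, Pi.sub_apply, sub_eq_zero] at h1
      rw [h1, dif_of_ok hx.2, dif_of_ok hx.2, bd_apply, bd_apply]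
      refine bd_congr fun z hz _ => ?_
      rw [Finset.sum_apply, Finset.sum_apply, Finset.sum_eq_single (rkL z)]
      · exact fun j _ hj => if_neg fun h' => hj h'.1.symm
      · intro h
        have := rkL_sublist hx.2.1 hz
        simp only [Finset.mem_range] at h
        omega
    · rw [hf.1 x t hx]
      refine (dif_mem (l := l) (f := fun z t => hop l (rkL z) (corr l f (rkL z)) z t) ?_).1 x t hx
      exact ⟨fun x t h => (hop_mem _ _ _).1 x t h,
        fun x t h => (hop_mem l (rkL x) (corr l f (rkL x))).2 x t h⟩

theorem eq_zero_of_dif {f : List (FreeGroup α → ℕ) → (Fin q → FreeGroup α) → ℚ}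
    (hq : q < Fintype.card α) (hf : f ∈ Ch α q 0) (hd : dif f = 0) : f = 0 := by
  have hv : Valid ([] : List (FreeGroup α → ℕ)) := ⟨1, by simp⟩
  have key : ∀ t : Fin q → FreeGroup α, (∀ k, Avoid [] (t k)) → f [] t = 0 := by
    refine MultiAdd.eq_of_gens (φ := 1) (by simp) (multiAdd_of_mem hf hv)
      (g := fun _ => 0) (fun _ _ _ _ _ _ _ => by simp) ?_
    intro s _
    obtain ⟨j, hj⟩ : ∃ j, j ∉ Set.range s := by
      by_contra hc
      push Not at hc
      have := Fintype.card_le_of_surjective s fun a => hc a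
      simp at this
      omega
    have hφ : ∀ v ∈ [vert (1 : MulAut (FreeGroup α)) j], v ∈ Set.range (vert 1) := by simp
    have hok : Ok [vert (1 : MulAut (FreeGroup α)) j]
        fun k => (1 : MulAut (FreeGroup α)) (FreeGroup.of (s k)) := by
      refine ⟨⟨1, hφ⟩, fun k => (avoid_of hφ _).2 ?_⟩
      rw [List.mem_singleton]
      exact fun h => hj ⟨k, vert_injective 1 h⟩
    have := congrFun (congrFun hd [vert (1 : MulAut (FreeGroup α)) j])
      fun k => (1 : MulAut (FreeGroup α)) (FreeGroup.of (s k))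
    rw [dif_of_ok hok, bd_apply] at this
    simpa [bd] using this
  funext x t
  by_cases hx : x = []
  · subst hx; exact key t fun k v hv => by simp at hv
  · exact hf.1 x t fun h => hx (List.length_eq_zero_iff.1 h.1)

end Exactness

section Homological
variable {G A B C D : Type} [Group G] [AddCommGroup A] [Module ℚ A] [AddCommGroup B] [Module ℚ B]
  [AddCommGroup C] [Module ℚ C] [AddCommGroup D] [Module ℚ D]
  {ρ : Representation ℚ G A} {σ : Representation ℚ G B} {τ : Representation ℚ G C}
  {υ : Representation ℚ G D}

/-- Vanishing of group cohomology in one degree. -/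
def HZ (ρ : Representation ℚ G A) (i : ℕ) : Prop := Limits.IsZero (groupCohomology (Rep.of ρ) i)

/-- Equivariance of a linear map. -/
def Eqv (ρ : Representation ℚ G A) (σ : Representation ℚ G B) (f : A →ₗ[ℚ] B) : Prop :=
  ∀ g a, f (ρ g a) = σ g (f a)

/-- The morphism of representations given by an equivariant linear map. -/
def Eqv.hom {f : A →ₗ[ℚ] B} (hf : Eqv ρ σ f) : Rep.of ρ ⟶ Rep.of σ :=
  Rep.ofHom ⟨f, fun g => LinearMap.ext fun a => hf g a⟩

theorem Eqv.comp {f : A →ₗ[ℚ] B} (hf : Eqv ρ σ f) {h : B →ₗ[ℚ] C} (hh : Eqv σ τ h) :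
    Eqv ρ τ (h ∘ₗ f) := fun g a => by
  rw [LinearMap.comp_apply, hf, hh]; rfl

/-- The map induced on cohomology by an equivariant linear map. -/
def Eqv.map {f : A →ₗ[ℚ] B} (hf : Eqv ρ σ f) (i : ℕ) :
    groupCohomology (Rep.of ρ) i ⟶ groupCohomology (Rep.of σ) i :=
  groupCohomology.map (MonoidHom.id G) hf.hom i

theorem Eqv.map_comp {f : A →ₗ[ℚ] B} (hf : Eqv ρ σ f) {h : B →ₗ[ℚ] C} (hh : Eqv σ τ h) (i : ℕ) :
    (hf.comp hh).map i = hf.map i ≫ hh.map i :=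
  groupCohomology.map_id_comp hf.hom hh.hom i

theorem Eqv.map_zero {f : A →ₗ[ℚ] B} (hf : Eqv ρ σ f) (h0 : f = 0) (i : ℕ) : hf.map i = 0 := by
  subst h0
  exact (groupCohomology.functor ℚ G i).map_zero _ _

theorem Eqv.map_id {f : A →ₗ[ℚ] A} (hf : Eqv ρ ρ f) (h0 : f = LinearMap.id) (i : ℕ) :
    hf.map i = 𝟙 _ := by
  subst h0
  exact (groupCohomology.functor ℚ G i).map_id _

instance (i : ℕ) : (groupCohomology.functor ℚ G i).Additive := by
  constructor
  intro X Y f g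
  have h : groupCohomology.cochainsMap (MonoidHom.id G) (f + g) =
    groupCohomology.cochainsMap (MonoidHom.id G) f +
      groupCohomology.cochainsMap (MonoidHom.id G) g :=
    (groupCohomology.cochainsFunctor ℚ G).map_add
  change HomologicalComplex.homologyMap (groupCohomology.cochainsMap (MonoidHom.id G) (f + g)) i
    = _
  rw [h, HomologicalComplex.homologyMap_add]
  rfl

theorem eqv_sum {ι : Type} (s : Finset ι) {f : ι → A →ₗ[ℚ] B} (hf : ∀ k, Eqv ρ σ (f k)) :
    Eqv ρ σ (∑ k ∈ s, f k) := fun g a => by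
  simp only [LinearMap.sum_apply, map_sum, hf _ g a]

theorem Eqv.map_add {f g : A →ₗ[ℚ] B} (hf : Eqv ρ σ f) (hg : Eqv ρ σ g) (h : Eqv ρ σ (f + g))
    (i : ℕ) : h.map i = hf.map i + hg.map i :=
  (groupCohomology.functor ℚ G i).map_add (f := hf.hom) (g := hg.hom)

theorem map_sum_eq {ι : Type} (s : Finset ι) {f : ι → A →ₗ[ℚ] B} (hf : ∀ k, Eqv ρ σ (f k))
    {g : A →ₗ[ℚ] B} (hg : Eqv ρ σ g) (h : g = ∑ k ∈ s, f k)
    (i : ℕ) : hg.map i = ∑ k ∈ s, (hf k).map i := by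
  classical
  induction s using Finset.induction_on generalizing g with
  | empty => exact Eqv.map_zero _ (by simpa using h) i
  | insert a s ha ih =>
    rw [Finset.sum_insert ha] at h ⊢
    rw [← ih (eqv_sum s hf) rfl]
    subst h
    exact Eqv.map_add _ _ _ i

/-- Vanishing of cohomology passes to a representation whose identity is a sum of maps
factoring through representations with vanishing cohomology. -/
theorem HZ.of_sum {ι : Type} [Fintype ι] {W : ι → Type} [∀ k, AddCommGroup (W k)]
    [∀ k, Module ℚ (W k)] {ω : ∀ k, Representation ℚ G (W k)} {i : ℕ} (h : ∀ k, HZ (ω k) i)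
    {s : ∀ k, A →ₗ[ℚ] W k} {r : ∀ k, W k →ₗ[ℚ] A} (hs : ∀ k, Eqv ρ (ω k) (s k))
    (hr : ∀ k, Eqv (ω k) ρ (r k)) (h1 : ∀ a, ∑ k, r k (s k a) = a) : HZ ρ i := by
  rw [HZ, Limits.IsZero.iff_id_eq_zero]
  have hid : Eqv ρ ρ LinearMap.id := fun _ _ => rfl
  have h2 := map_sum_eq Finset.univ (fun k => (hs k).comp (hr k)) hid
    (LinearMap.ext fun a => by simpa using (h1 a).symm) i
  rw [Eqv.map_id _ rfl] at h2
  rw [h2]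
  refine Finset.sum_eq_zero fun k _ => ?_
  rw [Eqv.map_comp (hs k) (hr k), (h k).eq_of_tgt ((hs k).map i) 0, Limits.zero_comp]

theorem HZ.retract {i : ℕ} (h : HZ σ i) {s : A →ₗ[ℚ] B} {r : B →ₗ[ℚ] A} (hs : Eqv ρ σ s)
    (hr : Eqv σ ρ r) (h1 : ∀ a, r (s a) = a) : HZ ρ i := by
  refine HZ.of_sum (ι := Unit) (W := fun _ => B) (ω := fun _ => σ) (fun _ => h) (s := fun _ => s)
    (r := fun _ => r) (fun _ => hs) (fun _ => hr) (by simpa using h1)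

theorem Eqv.symm (e : A ≃ₗ[ℚ] B) (he : Eqv ρ σ e.toLinearMap) : Eqv σ ρ e.symm.toLinearMap :=
  fun g a => by
    apply e.injective
    have := he g (e.symm a)
    simp only [LinearEquiv.coe_coe, LinearEquiv.apply_symm_apply] at this ⊢
    exact this.symm

theorem HZ.of_bijective {i : ℕ} (h : HZ σ i) (f : A →ₗ[ℚ] B) (hf : Eqv ρ σ f)
    (hb : Function.Bijective f) : HZ ρ i :=
  h.retract (s := (LinearEquiv.ofBijective f hb).toLinearMap) (fun g a => hf g a)
    (Eqv.symm (LinearEquiv.ofBijective f hb) (fun g a => hf g a)) fun a => by simp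

theorem HZ.of_bijective' {i : ℕ} (h : HZ ρ i) (f : A →ₗ[ℚ] B) (hf : Eqv ρ σ f)
    (hb : Function.Bijective f) : HZ σ i :=
  h.of_bijective (LinearEquiv.ofBijective f hb).symm.toLinearMap
    (Eqv.symm (LinearEquiv.ofBijective f hb) (fun g a => hf g a)) (LinearEquiv.bijective _)

/-- Transport along an isomorphism of groups. -/
theorem HZ.transport {H : Type} [Group H] {κ : Representation ℚ H B} {i : ℕ} (h : HZ κ i)
    (e : G ≃* H) (f : A ≃ₗ[ℚ] B) (hf : ∀ g a, f (ρ g a) = κ (e g) (f a)) : HZ ρ i :=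
  Limits.IsZero.of_iso h (groupCohomology.mapIso (A := Rep.of κ) (B := Rep.of ρ) e f
    (fun g => LinearMap.ext fun a => hf g a) i)

/-- A short exact sequence of representations. -/
structure SES (ρ : Representation ℚ G A) (σ : Representation ℚ G B) (τ : Representation ℚ G C)
    (f : A →ₗ[ℚ] B) (g : B →ₗ[ℚ] C) : Prop where
  eqf : Eqv ρ σ f
  eqg : Eqv σ τ g
  inj : Function.Injective f
  surj : Function.Surjective g
  zero : ∀ a, g (f a) = 0
  exact : ∀ b, g b = 0 → ∃ a, f a = b

namespace SES
variable {f : A →ₗ[ℚ] B} {g : B →ₗ[ℚ] C} (S : SES ρ σ τ f g)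

/-- The short complex of a short exact sequence. -/
def sc : ShortComplex (Rep ℚ G) :=
  ShortComplex.mk S.eqf.hom S.eqg.hom (by ext a; exact S.zero a)

theorem shortExact : S.sc.ShortExact where
  exact := by
    rw [← ShortComplex.exact_map_iff_of_faithful _ (forget₂ (Rep ℚ G) (ModuleCat ℚ)),
      ShortComplex.moduleCat_exact_iff]
    intro b hb
    exact S.exact b hb
  mono_f := (Rep.mono_iff_injective _).2 S.inj
  epi_g := (Rep.epi_iff_surjective _).2 S.surj

include S

theorem hz₁ {i : ℕ} (hC : HZ τ i) (hB : HZ σ (i + 1)) : HZ ρ (i + 1) :=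
  (groupCohomology.mapShortComplex₁_exact S.shortExact rfl).isZero_of_both_zeros
    (hC.eq_of_src _ _) (hB.eq_of_tgt _ _)

theorem hz₃ {i : ℕ} (hB : HZ σ i) (hA : HZ ρ (i + 1)) : HZ τ i :=
  (groupCohomology.mapShortComplex₃_exact S.shortExact rfl).isZero_of_both_zeros
    (hB.eq_of_src _ _) (hA.eq_of_tgt _ _)

theorem mono_map {i : ℕ} (hC : HZ τ i) : Mono (S.eqf.map (i + 1)) :=
  (groupCohomology.mapShortComplex₁_exact S.shortExact rfl).mono_g (hC.eq_of_src _ _)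

theorem epi_δ {i : ℕ} (hB : HZ σ (i + 1)) :
    Epi (groupCohomology.δ S.shortExact i (i + 1) rfl) :=
  groupCohomology.epi_δ_of_isZero S.shortExact i hB

end SES
end Homological

section Shapiro
variable {G P V B : Type} [Group G] [Group P] [AddCommGroup V] [Module ℚ V]
  [AddCommGroup B] [Module ℚ B]

/-- A representation of `G` is coinduced from a representation of `P`. -/
structure IsCoind (ι : P →* G) (ρ : Representation ℚ G V) (β : Representation ℚ P B)
    (e : V →ₗ[ℚ] B) : Prop where
  inj : Function.Injective ι
  eqv : ∀ p v, e (ρ (ι p) v) = β p (e v)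
  ext : ∀ v, (∀ g, e (ρ g v) = 0) → v = 0
  lift : ∀ f : G → B, (∀ p g, f (ι p * g) = β p (f g)) → ∃ v, ∀ g, e (ρ g v) = f g

/-- Shapiro's lemma. -/
theorem IsCoind.hz {ι : P →* G} {ρ : Representation ℚ G V} {β : Representation ℚ P B}
    {e : V →ₗ[ℚ] B} (h : IsCoind ι ρ β e) {i : ℕ} (hB : HZ β i) : HZ ρ i := by
  set m := MonoidHom.ofInjective h.inj with hm
  have hmι : ∀ s : ι.range, ι (m.symm s) = s := fun s => by
    have := congrArg Subtype.val (m.apply_symm_apply s)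
    rwa [hm, MonoidHom.ofInjective_apply] at this
  set β' : Representation ℚ ι.range B := β.comp m.symm.toMonoidHom with hβ
  have h' : HZ β' i := hB.transport m.symm (LinearEquiv.refl ℚ B) fun g a => rfl
  have h2 : HZ (Representation.coind ι.range.subtype β') i :=
    Limits.IsZero.of_iso h' (groupCohomology.coindIso (Rep.of β') i)
  let T : V →ₗ[ℚ] Representation.coindV ι.range.subtype β' :=
    LinearMap.codRestrict _ (LinearMap.pi fun g => e ∘ₗ ρ g) fun v s g => by
      change e (ρ (s * g) v) = β (m.symm s) (e (ρ g v))
      rw [← h.eqv, hmι, map_mul]; rfl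
  refine h2.of_bijective T (fun g v => ?_) ⟨?_, ?_⟩
  · apply Subtype.ext
    funext x
    change e (ρ x (ρ g v)) = e (ρ (x * g) v)
    rw [map_mul]; rfl
  · rw [injective_iff_map_eq_zero]
    exact fun v hv => h.ext v fun g => congrFun (congrArg Subtype.val hv) g
  · intro f
    obtain ⟨v, hv⟩ := h.lift f.1 fun p g => by
      have := f.2 (m p) g
      change f.1 (m p * g) = β (m.symm (m p)) (f.1 g) at this
      rwa [m.symm_apply_apply, hm, MonoidHom.ofInjective_apply] at this
    exact ⟨v, Subtype.ext (funext hv)⟩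

variable (ι : P →* G) (β : Representation ℚ P B)

theorem isCoind_coind (hι : Function.Injective ι) :
    IsCoind ι (Representation.coind ι β) β
      (LinearMap.proj 1 ∘ₗ (Representation.coindV ι β).subtype) where
  inj := hι
  eqv p v := by
    change v.1 (1 * ι p) = _
    have := v.2 p 1
    rw [one_mul]; rwa [mul_one] at this
  ext v hv := by
    apply Subtype.ext
    funext g
    have := hv g
    change v.1 (1 * g) = 0 at this
    rwa [one_mul] at this
  lift f hf := ⟨⟨f, hf⟩, fun g => by change f (1 * g) = _; rw [one_mul]⟩

theorem hz_coind (hι : Function.Injective ι) {i : ℕ} (h : HZ β i) :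
    HZ (Representation.coind ι β) i := (isCoind_coind ι β hι).hz h

end Shapiro

section Functions
variable {G A : Type} [Group G] [AddCommGroup A] [Module ℚ A] {ρ : Representation ℚ G A}

variable (ρ) in
/-- The representation on functions from a `G`-set. -/
def funRep {X : Type} [MulAction G X] : Representation ℚ G (X → A) where
  toFun g := LinearMap.pi fun x => ρ g ∘ₗ LinearMap.proj (g⁻¹ • x)
  map_one' := by ext; simp
  map_mul' g h := by ext; simp [mul_smul]

@[simp] theorem funRep_apply {X : Type} [MulAction G X] (g : G) (F : X → A) (x : X) :
    funRep ρ g F x = ρ g (F (g⁻¹ • x)) := rfl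

theorem hz_succ_of_subsingleton [Subsingleton G] (i : ℕ) : HZ ρ (i + 1) :=
  isZero_groupCohomology_succ_of_subsingleton (Rep.of ρ) i

theorem isCoind_funRep_self : IsCoind (1 : PUnit →* G) (funRep ρ (X := G))
    (1 : Representation ℚ PUnit A) (LinearMap.proj 1) where
  inj _ _ _ := rfl
  eqv p v := by simp
  ext v hv := by
    funext g
    have := hv g⁻¹
    simp only [LinearMap.proj_apply, funRep_apply, smul_eq_mul, inv_inv, mul_one] at this
    have h2 := congrArg (ρ g) this
    rwa [← Module.End.mul_apply, ← map_mul, mul_inv_cancel, map_one, map_zero] at h2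
  lift f hf := ⟨fun g => ρ g (f g⁻¹), fun g => by
    simp only [LinearMap.proj_apply, funRep_apply, smul_eq_mul, mul_one, inv_inv]
    rw [← Module.End.mul_apply, ← map_mul, mul_inv_cancel, map_one]; rfl⟩

theorem hz_funRep_self (i : ℕ) : HZ (funRep ρ (X := G)) (i + 1) :=
  isCoind_funRep_self.hz (hz_succ_of_subsingleton i)

/-- A representation with an equivariant averaging of functions on the group is acyclic. -/
theorem hz_of_average (r : (G → A) →ₗ[ℚ] A) (hr : Eqv (funRep ρ (X := G)) ρ r)
    (h1 : ∀ a, r (fun _ => a) = a) (i : ℕ) : HZ ρ (i + 1) :=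
  (hz_funRep_self (ρ := ρ) i).retract (s := LinearMap.pi fun _ => LinearMap.id)
    (fun g a => by ext; simp) hr h1

end Functions

section LowDegree
variable {G A : Type} [Group G] [AddCommGroup A] [Module ℚ A] {ρ : Representation ℚ G A}

theorem hz_zero : HZ ρ 0 ↔ ∀ a, (∀ g, ρ g a = a) → a = 0 := by
  rw [HZ, (groupCohomology.H0Iso (Rep.of ρ)).isZero_iff, ModuleCat.isZero_iff_subsingleton]
  constructor
  · intro h a ha
    exact congrArg Subtype.val (h.elim (⟨a, ha⟩ : ρ.invariants) 0)
  · intro h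
    constructor
    intro a b
    apply Subtype.ext
    rw [h a.1 a.2, h b.1 b.2]

theorem hz_one : HZ ρ 1 ↔ ∀ z : G → A, (∀ g h, z (g * h) = ρ g (z h) + z g) →
    ∃ a, ∀ g, z g = ρ g a - a := by
  rw [HZ, ModuleCat.isZero_iff_subsingleton]
  constructor
  · intro h z hz
    have := h.elim (groupCohomology.H1π (Rep.of ρ)
      ⟨z, (groupCohomology.mem_cocycles₁_iff (A := Rep.of ρ) z).2 hz⟩) 0
    rw [groupCohomology.H1π_eq_zero_iff] at this
    obtain ⟨a, ha⟩ := this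
    exact ⟨a, fun g => (congrFun ha g).symm⟩
  · intro h
    have key : ∀ x : groupCohomology (Rep.of ρ) 1, x = 0 := by
      intro x
      induction x using groupCohomology.H1_induction_on with
      | h z =>
        rw [groupCohomology.H1π_eq_zero_iff]
        obtain ⟨a, ha⟩ := h z.1 ((groupCohomology.mem_cocycles₁_iff (A := Rep.of ρ) z.1).1 z.2)
        exact ⟨a, funext fun g => (ha g).symm⟩
    exact ⟨fun a b => by rw [key a, key b]⟩

end LowDegree

section Quotients
variable {G H A B C : Type} [Group G] [Group H] [AddCommGroup A] [Module ℚ A] [AddCommGroup B]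
  [Module ℚ B] [AddCommGroup C] [Module ℚ C]
  {ρ : Representation ℚ G A} {σ : Representation ℚ G B} {τ : Representation ℚ G C}

/-- The cokernel of an equivariant map. -/
def cokRep (σ : Representation ℚ G B) (f : A →ₗ[ℚ] B) (hf : Eqv ρ σ f) :
    Representation ℚ G (B ⧸ LinearMap.range f) :=
  σ.quotient (LinearMap.range f) fun g => by
    rintro _ ⟨a, rfl⟩
    exact ⟨ρ g a, hf g a⟩

theorem ses_cok {f : A →ₗ[ℚ] B} (hf : Eqv ρ σ f) (hi : Function.Injective f) :
    SES ρ σ (cokRep σ f hf) f (LinearMap.range f).mkQ where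
  eqf := hf
  eqg _ _ := rfl
  inj := hi
  surj := Submodule.mkQ_surjective _
  zero a := (Submodule.Quotient.mk_eq_zero _).2 ⟨a, rfl⟩
  exact _ hb := (Submodule.Quotient.mk_eq_zero _).1 hb

theorem SES.comp {f : A →ₗ[ℚ] B} {g : B →ₗ[ℚ] C} (S : SES ρ σ τ f g) (φ : H →* G) :
    SES (ρ.comp φ) (σ.comp φ) (τ.comp φ) f g where
  eqf h a := S.eqf (φ h) a
  eqg h b := S.eqg (φ h) b
  inj := S.inj
  surj := S.surj
  zero := S.zero
  exact := S.exact

end Quotients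

section Inflation
variable {N Γ : Type} [Group N] [Group Γ] {π : Γ →* MulAut N}
  {A B C : Type} [AddCommGroup A] [Module ℚ A] [AddCommGroup B] [Module ℚ B]
  [AddCommGroup C] [Module ℚ C]

open SemidirectProduct

theorem inr_mul_inl (γ : Γ) (n : N) :
    (inr γ * inl n : N ⋊[π] Γ) = inl (π γ n) * inr γ := by
  ext <;> simp

/-- Restriction to the normal subgroup. -/
abbrev resN (ρ : Representation ℚ (N ⋊[π] Γ) A) : Representation ℚ N A := ρ.comp inl

/-- The action of the complement on the invariants of the normal subgroup. -/
def fixRep (ρ : Representation ℚ (N ⋊[π] Γ) A) :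
    Representation ℚ Γ (resN ρ).invariants where
  toFun γ := (ρ (inr γ)).restrict fun a ha n => by
    change ρ (inl n) (ρ (inr γ) a) = _
    have h : (inl n * inr γ : N ⋊[π] Γ) = inr γ * inl ((π γ)⁻¹ n) := by
      rw [inr_mul_inl, MulAut.apply_inv_self]
    rw [← Module.End.mul_apply, ← map_mul, h, map_mul, Module.End.mul_apply]
    exact congrArg _ (ha _)
  map_one' := by ext; simp
  map_mul' g h := by ext; simp; rfl

/-- Equivariant maps restrict to invariants. -/
def fixMap {ρ : Representation ℚ (N ⋊[π] Γ) A} {σ : Representation ℚ (N ⋊[π] Γ) B}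
    (f : A →ₗ[ℚ] B) (hf : Eqv ρ σ f) :
    (resN ρ).invariants →ₗ[ℚ]
      (resN σ).invariants :=
  f.restrict fun a ha n => by
    change σ (inl n) (f a) = f a
    rw [← hf]
    exact congrArg f (ha n)

theorem SES.fix {ρ : Representation ℚ (N ⋊[π] Γ) A} {σ : Representation ℚ (N ⋊[π] Γ) B}
    {τ : Representation ℚ (N ⋊[π] Γ) C} {f : A →ₗ[ℚ] B} {g : B →ₗ[ℚ] C} (S : SES ρ σ τ f g)
    (h : HZ (resN ρ) 1) :
    SES (fixRep ρ) (fixRep σ) (fixRep τ) (fixMap f S.eqf) (fixMap g S.eqg) where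
  eqf γ a := Subtype.ext (S.eqf (inr γ) a)
  eqg γ b := Subtype.ext (S.eqg (inr γ) b)
  inj a b hab := Subtype.ext (S.inj (congrArg Subtype.val hab))
  zero a := Subtype.ext (S.zero a)
  exact b hb := by
    obtain ⟨a, ha⟩ := S.exact b.1 (congrArg Subtype.val hb)
    refine ⟨⟨a, fun n => S.inj ?_⟩, Subtype.ext ha⟩
    change f (ρ (inl n) a) = f a
    rw [S.eqf, ha]
    exact b.2 n
  surj c := by
    obtain ⟨b, hb⟩ := S.surj c.1
    have h1 : ∀ n : N, ∃ a, f a = σ (inl n) b - b := fun n => S.exact _ (by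
      rw [map_sub, S.eqg, hb, sub_eq_zero]
      exact c.2 n)
    choose z hz using h1
    obtain ⟨a, ha⟩ := hz_one.1 h z fun n m => S.inj (by
      rw [map_add, MonoidHom.comp_apply, S.eqf, hz, hz, hz, map_mul, map_mul, map_sub]
      simp)
    refine ⟨⟨b - f a, fun n => ?_⟩, Subtype.ext ?_⟩
    · change σ (inl n) (b - f a) = b - f a
      have h2 := hz n
      rw [ha n, map_sub, MonoidHom.comp_apply, S.eqf] at h2
      rw [map_sub, sub_eq_sub_iff_sub_eq_sub, ← h2]
    · change g (b - f a) = c.1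
      rw [map_sub, S.zero, hb, sub_zero]

theorem hz_inl_funRep (ρ : Representation ℚ (N ⋊[π] Γ) A) (i : ℕ) :
    HZ ((funRep ρ (X := N ⋊[π] Γ)).comp inl : Representation ℚ N (N ⋊[π] Γ → A)) (i + 1) := by
  let r : (N → N ⋊[π] Γ → A) →ₗ[ℚ] N ⋊[π] Γ → A :=
    { toFun := fun F x => F x.left x
      map_add' := fun _ _ => rfl
      map_smul' := fun _ _ => rfl }
  refine hz_of_average r (fun g F => ?_) (fun a => rfl) i
  funext x
  change ρ (inl g) (F (g⁻¹ * x.left) ((inl g)⁻¹ * x)) =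
    ρ (inl g) (F ((inl g)⁻¹ * x).left ((inl g)⁻¹ * x))
  rw [← map_inv inl g]
  simp

theorem hz_fixRep_funRep (ρ : Representation ℚ (N ⋊[π] Γ) A) (i : ℕ) :
    HZ (fixRep (funRep ρ (X := N ⋊[π] Γ))) (i + 1) := by
  let r : (Γ → (resN (funRep ρ (X := N ⋊[π] Γ))).invariants) →ₗ[ℚ]
      (resN (funRep ρ (X := N ⋊[π] Γ))).invariants :=
    { toFun := fun F => ⟨fun x => (F x.right).1 x, fun n => by
        funext x
        have := congrFun ((F x.right).2 n) x
        change ρ (inl n) ((F x.right).1 ((inl n)⁻¹ * x)) = _ at this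
        change ρ (inl n) ((F ((inl n)⁻¹ * x).right).1 ((inl n)⁻¹ * x)) = _
        rw [← this, ← map_inv inl n]
        simp⟩
      map_add' := fun _ _ => rfl
      map_smul' := fun _ _ => rfl }
  refine hz_of_average r (fun g F => ?_) (fun a => rfl) i
  apply Subtype.ext
  funext x
  change ρ (inr g) ((F (g⁻¹ * x.right)).1 ((inr g)⁻¹ * x)) =
    ρ (inr g) ((F ((inr g)⁻¹ * x).right).1 ((inr g)⁻¹ * x))
  rw [← map_inv inr g]
  simp

theorem hz_one_of_fix (ρ : Representation ℚ (N ⋊[π] Γ) A)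
    (h1 : HZ (resN ρ) 1) (h2 : HZ (fixRep ρ) 1) : HZ ρ 1 := by
  rw [hz_one]
  intro z hz
  obtain ⟨a, ha⟩ := hz_one.1 h1 (fun n => z (inl n)) fun n m => by
    rw [map_mul, hz]; rfl
  set y : N ⋊[π] Γ → A := fun g => z g - (ρ g a - a) with hy
  have hyc : ∀ g h, y (g * h) = ρ g (y h) + y g := fun g h => by
    simp only [hy, hz, map_mul, map_sub, Module.End.mul_apply]
    abel
  have hyn : ∀ n : N, y (inl n) = 0 := fun n => by
    simp only [hy, ha]
    exact sub_self _
  have hyi : ∀ (n : N) γ, ρ (inl n) (y (inr γ)) = y (inr γ) := fun n γ => by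
    have e1 := hyc (inl n) (inr γ)
    have e2 := hyc (inr γ) (inl ((π γ)⁻¹ n))
    rw [inr_mul_inl, MulAut.apply_inv_self, hyn, map_zero, zero_add] at e2
    rw [hyn, add_zero, e2] at e1
    exact e1.symm
  obtain ⟨b, hb⟩ := hz_one.1 h2 (fun γ => ⟨y (inr γ), fun n => hyi n γ⟩) fun γ δ =>
    Subtype.ext (by
      change y (inr (γ * δ)) = _
      rw [map_mul, hyc]; rfl)
  refine ⟨a + b, fun g => ?_⟩
  have h3 := hyc (inl g.left) (inr g.right)
  rw [inl_left_mul_inr_right, hyi, hyn, add_zero] at h3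
  have h4 : y (inr g.right) = ρ (inr g.right) b - b := congrArg Subtype.val (hb g.right)
  have h5 : ρ g b = ρ (inr g.right) b := by
    conv_lhs => rw [← inl_left_mul_inr_right g, map_mul, Module.End.mul_apply]
    exact (fixRep ρ g.right b).2 g.left
  rw [h4, ← h5] at h3
  have h6 : z g = y g + (ρ g a - a) := by simp [hy]
  rw [h6, h3, map_add]
  abel

/-- Inflation: if the normal subgroup acts acyclically, vanishing can be checked on invariants. -/
theorem hz_of_fix (k : ℕ) : ∀ {A : Type} [AddCommGroup A] [Module ℚ A]
    (ρ : Representation ℚ (N ⋊[π] Γ) A),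
    (∀ m, HZ (resN ρ) (m + 1)) → HZ (fixRep ρ) k → HZ ρ k := by
  induction k with
  | zero =>
    intro A _ _ ρ _ h
    rw [hz_zero] at h ⊢
    intro a ha
    exact congrArg Subtype.val (h ⟨a, fun n => ha (inl n)⟩ fun γ => Subtype.ext (ha (inr γ)))
  | succ k ih =>
    intro A _ _ ρ h1 h2
    obtain _ | k := k
    · exact hz_one_of_fix ρ (h1 0) h2
    have hc : Eqv ρ (funRep ρ (X := N ⋊[π] Γ)) (LinearMap.pi fun _ => LinearMap.id) :=
      fun g a => by ext; simp
    have S := ses_cok hc fun a b hab => congrFun hab 1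
    refine S.hz₁ (ih _ (fun m => ?_) ?_) (hz_funRep_self _)
    · exact (S.comp inl).hz₃ (hz_inl_funRep ρ m) (h1 _)
    · exact (S.fix (h1 0)).hz₃ (hz_fixRep_funRep ρ k) h2

end Inflation

section Free
variable {β A : Type} [AddCommGroup A] [Module ℚ A]

theorem exists_primitive (c : β → FreeGroup β → A) : ∃ F : FreeGroup β → A, ∀ s x,
    F (x * FreeGroup.of s) - F x = c s x := by
  let σ : β → Equiv.Perm (FreeGroup β × A) := fun s =>
    { toFun := fun p => (p.1 * FreeGroup.of s, p.2 + c s p.1)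
      invFun := fun p => (p.1 * (FreeGroup.of s)⁻¹, p.2 - c s (p.1 * (FreeGroup.of s)⁻¹))
      left_inv := fun p => by simp
      right_inv := fun p => by simp }
  let P : FreeGroup β →* Equiv.Perm (FreeGroup β × A) := FreeGroup.lift fun s => (σ s)⁻¹
  have hs : ∀ s x, P (x * FreeGroup.of s)⁻¹ (1, 0) = σ s (P x⁻¹ (1, 0)) := fun s x => by
    rw [mul_inv_rev, map_mul, map_inv, Equiv.Perm.mul_apply]
    simp [P]
  have h2 : ∀ x p, (P x p).1 = p.1 * x⁻¹ := by
    intro x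
    induction x using FreeGroup.induction_on with
    | C1 => simp
    | of s => intro p; simp [P, σ, Equiv.Perm.inv_def]
    | inv_of s _ => intro p; simp [P, σ]
    | mul x y hx hy => intro p; rw [map_mul, Equiv.Perm.mul_apply, hx, hy, mul_inv_rev, mul_assoc]
  have h1 : ∀ x, (P x⁻¹ (1, 0)).1 = x := fun x => by rw [h2, one_mul, inv_inv]
  refine ⟨fun x => (P x⁻¹ (1, 0)).2, fun s x => ?_⟩
  beta_reduce; rw [hs]
  change (P x⁻¹ (1, 0)).2 + c s (P x⁻¹ (1, 0)).1 - (P x⁻¹ (1, 0)).2 = c s x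
  rw [h1, add_sub_cancel_left]

end Free

section FreeVanishing
variable {β A : Type} [AddCommGroup A] [Module ℚ A]

theorem eq_of_mul_of {N : Type} {F : FreeGroup β → N}
    (h : ∀ x s, F (x * FreeGroup.of s) = F x) (x y : FreeGroup β) : F (x * y) = F x := by
  induction y using FreeGroup.induction_on generalizing x with
  | C1 => rw [mul_one]
  | of s => exact h x s
  | inv_of s _ => rw [← h, inv_mul_cancel_right]
  | mul y z hy hz => rw [← mul_assoc, hz, hy]

/-- Componentwise action on a power. -/
def powRep {G : Type} [Group G] (β : Type) (ρ : Representation ℚ G A) :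
    Representation ℚ G (β → A) where
  toFun g := LinearMap.pi fun s => ρ g ∘ₗ LinearMap.proj s
  map_one' := by ext; simp
  map_mul' g h := by ext; simp

/-- Free groups have cohomological dimension at most one. -/
theorem hz_free (ρ : Representation ℚ (FreeGroup β) A) (m : ℕ) : HZ ρ (m + 2) := by
  let f : A →ₗ[ℚ] (FreeGroup β → A) := LinearMap.pi fun _ => LinearMap.id
  let g : (FreeGroup β → A) →ₗ[ℚ] FreeGroup β → β → A :=
    { toFun := fun F x s => F (x * FreeGroup.of s) - F x
      map_add' := fun F F' => by
        funext x s
        simp only [Pi.add_apply]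
        abel
      map_smul' := fun c F => by
        funext x s
        simp [smul_sub] }
  have S : SES ρ (funRep ρ (X := FreeGroup β)) (funRep (powRep β ρ) (X := FreeGroup β)) f g := {
    eqf := fun _ _ => rfl
    eqg := fun h F => by
      funext x s
      change ρ h (F (h⁻¹ * (x * FreeGroup.of s))) - ρ h (F (h⁻¹ * x)) =
        ρ h (F (h⁻¹ * x * FreeGroup.of s) - F (h⁻¹ * x))
      rw [map_sub, mul_assoc]
    inj := fun a b hab => congrFun hab 1
    surj := fun c => by
      obtain ⟨F, hF⟩ := exists_primitive fun s x => c x s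
      exact ⟨F, funext fun x => funext fun s => hF s x⟩
    zero := fun a => by
      funext x s
      exact sub_self a
    exact := fun F hF => ⟨F 1, funext fun x => by
      have := eq_of_mul_of (F := F) (fun x s => sub_eq_zero.1 (congrFun (congrFun hF x) s)) 1 x
      rw [one_mul] at this
      exact this.symm⟩ }
  exact S.hz₁ (hz_funRep_self m) (hz_funRep_self (m + 1))

end FreeVanishing

section Twisted
open SemidirectProduct
variable {N Γ : Type} [Group N] [Group Γ] {π : Γ →* MulAut N}
  {M M' M'' : Type} [AddCommGroup M] [Module ℚ M] [AddCommGroup M'] [Module ℚ M']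
  [AddCommGroup M''] [Module ℚ M'']

/-- The affine action of a semidirect product on its normal factor. -/
instance affAction : MulAction (N ⋊[π] Γ) N where
  smul g x := g.left * π g.right x
  one_smul x := by
    change (1 : N ⋊[π] Γ).left * π (1 : N ⋊[π] Γ).right x = x
    simp
  mul_smul g h x := by
    change (g * h).left * π (g * h).right x = g.left * π g.right (h.left * π h.right x)
    simp [mul_assoc]

theorem aff_smul (g : N ⋊[π] Γ) (x : N) : g • x = g.left * π g.right x := rfl

theorem inl_smul (n x : N) : (inl n : N ⋊[π] Γ) • x = n * x := by simp [aff_smul]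

theorem inr_smul (γ : Γ) (x : N) : (inr γ : N ⋊[π] Γ) • x = π γ x := by simp [aff_smul]

variable (π) in
/-- A representation of the complement, inflated. -/
abbrev infl (μ : Representation ℚ Γ M) : Representation ℚ (N ⋊[π] Γ) M := μ.comp rightHom

variable (π) in
/-- Functions on the normal factor. -/
abbrev twRep (μ : Representation ℚ Γ M) : Representation ℚ (N ⋊[π] Γ) (N → M) :=
  funRep (infl π μ) (X := N)

theorem twRep_inl (μ : Representation ℚ Γ M) (n : N) (F : N → M) (x : N) :
    twRep π μ (inl n) F x = F (n⁻¹ * x) := by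
  rw [twRep, funRep_apply, ← map_inv, inl_smul]
  simp

theorem twRep_inr (μ : Representation ℚ Γ M) (γ : Γ) (F : N → M) (x : N) :
    twRep π μ (inr γ) F x = μ γ (F (π γ⁻¹ x)) := by
  rw [twRep, funRep_apply, ← map_inv, inr_smul]
  simp

theorem isCoind_twRep (μ : Representation ℚ Γ M) :
    IsCoind (inr : Γ →* N ⋊[π] Γ) (twRep π μ) μ (LinearMap.proj 1) where
  inj := inr_injective
  eqv p v := by
    simp only [LinearMap.proj_apply]
    rw [twRep_inr, map_one]
  ext v hv := by
    funext x
    have := hv (inl x⁻¹)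
    rw [LinearMap.proj_apply, twRep_inl] at this
    simpa using this
  lift f hf := ⟨fun x => f (inl x⁻¹), fun g => by
    rw [LinearMap.proj_apply, twRep, funRep_apply, MonoidHom.comp_apply, rightHom_eq_right, ← hf]
    congr 1
    ext <;> simp [aff_smul]⟩

theorem hz_twRep {μ : Representation ℚ Γ M} {i : ℕ} (h : HZ μ i) : HZ (twRep π μ) i :=
  (isCoind_twRep μ).hz h

theorem hz_resN_twRep (μ : Representation ℚ Γ M) (i : ℕ) : HZ (resN (twRep π μ)) (i + 1) := by
  refine (hz_funRep_self (ρ := (1 : Representation ℚ N M)) i).of_bijective LinearMap.id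
    (fun n F => ?_) Function.bijective_id
  funext x
  exact twRep_inl μ n F x

/-- Additive maps out of a group. -/
def homs (N M : Type) [Group N] [AddCommGroup M] [Module ℚ M] : Submodule ℚ (N → M) where
  carrier := {f | ∀ x y, f (x * y) = f x + f y}
  add_mem' {f g} hf hg x y := by
    simp only [Pi.add_apply]
    rw [hf, hg]
    abel
  zero_mem' x y := by simp
  smul_mem' c f hf x y := by
    simp only [Pi.smul_apply]
    rw [hf, smul_add]

theorem homs_one (f : homs N M) : f.1 1 = 0 := by
  have := f.2 1 1
  rwa [mul_one, left_eq_add] at this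

theorem homs_inv (f : homs N M) (x : N) : f.1 x⁻¹ = - f.1 x := by
  have := f.2 x x⁻¹
  rw [mul_inv_cancel, homs_one] at this
  exact eq_neg_of_add_eq_zero_right this.symm

variable (π) in
/-- The action on additive maps. -/
def homRep (μ : Representation ℚ Γ M) : Representation ℚ Γ (homs N M) where
  toFun γ :=
    { toFun := fun f => ⟨fun x => μ γ (f.1 (π γ⁻¹ x)), fun x y => by
        beta_reduce
        rw [map_mul, f.2, map_add]⟩
      map_add' := fun f g => by
        ext
        simp
      map_smul' := fun c f => by
        ext
        simp }
  map_one' := by ext; simp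
  map_mul' g h := by ext; simp

end Twisted

section Acyclic
open SemidirectProduct
variable {β Γ : Type} [Group Γ] {π : Γ →* MulAut (FreeGroup β)}
  {M X : Type} [AddCommGroup M] [Module ℚ M] [AddCommGroup X] [Module ℚ X]
  {μ : Representation ℚ Γ M} {κ : Representation ℚ (FreeGroup β ⋊[π] Γ) X}

theorem hz_cokRep_twRep {f : X →ₗ[ℚ] (FreeGroup β → M)} (hf : Eqv κ (twRep π μ) f)
    (hi : Function.Injective f) {j : ℕ} (h : HZ (fixRep (cokRep _ f hf)) j) :
    HZ (cokRep _ f hf) j :=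
  hz_of_fix j _ (fun m => ((ses_cok hf hi).comp inl).hz₃ (hz_resN_twRep μ m) (hz_free _ m)) h

/-- Cohomology of inflated modules. -/
theorem hz_infl : ∀ {j : ℕ}, HZ μ j → (∀ k, j = k + 1 → HZ (homRep π μ) k) →
    HZ (infl π μ) j := by
  rintro (_ | j) h1 h2
  · rw [hz_zero] at h1 ⊢
    exact fun a ha => h1 a fun γ => by simpa using ha (inr γ)
  let c : M →ₗ[ℚ] (FreeGroup β → M) := LinearMap.pi fun _ => LinearMap.id
  have hc : Eqv (infl π μ) (twRep π μ) c := fun _ _ => rfl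
  have hi : Function.Injective c := fun a b hab => congrFun hab 1
  refine (ses_cok hc hi).hz₁ (hz_cokRep_twRep hc hi ?_) (hz_twRep h1)
  have hmem : ∀ F : FreeGroup β → M,
      F ∈ LinearMap.range c ↔ ∀ x, F x = F 1 :=
    fun F => ⟨by rintro ⟨a, rfl⟩ x; rfl, fun h => ⟨F 1, funext fun x => (h x).symm⟩⟩
  let T : homs (FreeGroup β) M →ₗ[ℚ] (resN (cokRep _ c hc)).invariants :=
    LinearMap.codRestrict _ ((LinearMap.range c).mkQ ∘ₗ Submodule.subtype _) fun f n => by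
      change (LinearMap.range c).mkQ (twRep π μ (inl n) f.1) = (LinearMap.range c).mkQ f.1
      rw [← sub_eq_zero, ← map_sub, Submodule.mkQ_apply, Submodule.Quotient.mk_eq_zero, hmem]
      intro x
      simp only [Pi.sub_apply]
      rw [twRep_inl, twRep_inl, f.2, f.2 _ 1]
      abel
  refine (h2 j rfl).of_bijective' T (fun γ f => Subtype.ext ?_) ⟨?_, ?_⟩
  · change (LinearMap.range c).mkQ (homRep π μ γ f).1 =
      (LinearMap.range c).mkQ (twRep π μ (inr γ) f.1)
    congr 1
    funext x
    rw [twRep_inr]; rfl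
  · rw [injective_iff_map_eq_zero]
    intro f hf
    have h3 : (LinearMap.range c).mkQ f.1 = 0 := congrArg Subtype.val hf
    rw [Submodule.mkQ_apply, Submodule.Quotient.mk_eq_zero, hmem] at h3
    exact Subtype.ext (funext fun x => (h3 x).trans (homs_one f))
  · rintro ⟨y, hy⟩
    obtain ⟨F, rfl⟩ := Submodule.mkQ_surjective _ y
    have h3 : ∀ n x, F (n * x) - F x = F n - F 1 := fun n x => by
      have := hy n⁻¹
      change (LinearMap.range c).mkQ (twRep π μ (inl n⁻¹) F) = (LinearMap.range c).mkQ F at this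
      rw [← sub_eq_zero, ← map_sub, Submodule.mkQ_apply, Submodule.Quotient.mk_eq_zero, hmem]
        at this
      have := this x
      simp only [Pi.sub_apply] at this
      rwa [twRep_inl, twRep_inl, inv_inv, mul_one] at this
    refine ⟨⟨fun x => F x - F 1, fun x y => ?_⟩, Subtype.ext ?_⟩
    · have := h3 x y
      rw [sub_eq_iff_eq_add] at this
      beta_reduce
      rw [this]
      abel
    · change (LinearMap.range c).mkQ _ = (LinearMap.range c).mkQ F
      rw [← sub_eq_zero, ← map_sub, Submodule.mkQ_apply, Submodule.Quotient.mk_eq_zero, hmem]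
      intro x
      simp

end Acyclic

section Naturality
variable {G A B C A' B' C' : Type} [Group G] [AddCommGroup A] [Module ℚ A] [AddCommGroup B]
  [Module ℚ B] [AddCommGroup C] [Module ℚ C] [AddCommGroup A'] [Module ℚ A'] [AddCommGroup B']
  [Module ℚ B'] [AddCommGroup C'] [Module ℚ C']
  {ρ : Representation ℚ G A} {σ : Representation ℚ G B} {τ : Representation ℚ G C}
  {ρ' : Representation ℚ G A'} {σ' : Representation ℚ G B'} {τ' : Representation ℚ G C'}
  {f : A →ₗ[ℚ] B} {g : B →ₗ[ℚ] C} {f' : A' →ₗ[ℚ] B'} {g' : B' →ₗ[ℚ] C'}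

theorem SES.epi_map_succ (S : SES ρ σ τ f g) (S' : SES ρ' σ' τ' f' g') {a : A →ₗ[ℚ] A'}
    {b : B →ₗ[ℚ] B'} {c : C →ₗ[ℚ] C'} (ha : Eqv ρ ρ' a) (hb : Eqv σ σ' b) (hc : Eqv τ τ' c)
    (h₁ : ∀ x, b (f x) = f' (a x)) (h₂ : ∀ x, c (g x) = g' (b x)) {i : ℕ}
    (hB : HZ σ' (i + 1)) (he : Epi (hc.map i)) : Epi (ha.map (i + 1)) := by
  let φ : S.sc ⟶ S'.sc :=
    { τ₁ := ha.hom
      τ₂ := hb.hom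
      τ₃ := hc.hom
      comm₁₂ := by ext x; exact (h₁ x).symm
      comm₂₃ := by ext x; exact (h₂ x).symm }
  have hn := HomologicalComplex.HomologySequence.δ_naturality
    ((groupCohomology.cochainsFunctor ℚ G).mapShortComplex.map φ)
    (groupCohomology.map_cochainsFunctor_shortExact S.shortExact)
    (groupCohomology.map_cochainsFunctor_shortExact S'.shortExact) i (i + 1) rfl
  let d : groupCohomology (Rep.of τ) i ⟶ groupCohomology (Rep.of ρ) (i + 1) :=
    groupCohomology.δ S.shortExact i (i + 1) rfl
  let d' : groupCohomology (Rep.of τ') i ⟶ groupCohomology (Rep.of ρ') (i + 1) :=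
    groupCohomology.δ S'.shortExact i (i + 1) rfl
  have hδ : Epi d' := S'.epi_δ hB
  have h4 : d ≫ ha.map (i + 1) = hc.map i ≫ d' := hn
  have h3 : Epi (hc.map i ≫ d') := epi_comp _ _
  rw [← h4] at h3
  exact epi_of_epi d _

theorem Eqv.epi_map_zero {f : A →ₗ[ℚ] B} (hf : Eqv ρ σ f)
    (h : ∀ b, (∀ g, σ g b = b) → ∃ a, (∀ g, ρ g a = a) ∧ f a = b) : Epi (hf.map 0) := by
  have h1 : hf.map 0 ≫ (groupCohomology.H0Iso (Rep.of σ)).hom =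
      (groupCohomology.H0Iso (Rep.of ρ)).hom ≫ (Rep.invariantsFunctor ℚ G).map hf.hom :=
    groupCohomology.map_id_comp_H0Iso_hom hf.hom
  have h2 : Epi ((Rep.invariantsFunctor ℚ G).map hf.hom) := by
    rw [ModuleCat.epi_iff_surjective]
    rintro ⟨b, hb⟩
    obtain ⟨a, ha, rfl⟩ := h b hb
    exact ⟨⟨a, ha⟩, rfl⟩
  have h3 : hf.map 0 = ((groupCohomology.H0Iso (Rep.of ρ)).hom ≫
      (Rep.invariantsFunctor ℚ G).map hf.hom) ≫ (groupCohomology.H0Iso (Rep.of σ)).inv := by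
    rw [← h1, Category.assoc, Iso.hom_inv_id, Category.comp_id]
  rw [h3]
  exact epi_comp _ _

theorem Eqv.mono_map_zero {f : A →ₗ[ℚ] B} (hf : Eqv ρ σ f) (h : Function.Injective f) :
    Mono (hf.map 0) := by
  have : Mono hf.hom := (Rep.mono_iff_injective _).2 h
  exact groupCohomology.mono_map_0_of_mono hf.hom

end Naturality

section Coinduction
variable {P G A B C V : Type} [Group P] [Group G] [AddCommGroup A] [Module ℚ A] [AddCommGroup B]
  [Module ℚ B] [AddCommGroup C] [Module ℚ C] [AddCommGroup V] [Module ℚ V]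
  {ρ : Representation ℚ P A} {σ : Representation ℚ P B} {τ : Representation ℚ P C}
  (ι : P →* G)

/-- Functoriality of coinduction. -/
def coindMap' {f : A →ₗ[ℚ] B} (hf : Eqv ρ σ f) :
    Representation.coindV ι ρ →ₗ[ℚ] Representation.coindV ι σ where
  toFun v := ⟨fun g => f (v.1 g), fun p g => by
    beta_reduce
    rw [v.2, hf]⟩
  map_add' v w := by ext; simp
  map_smul' c v := by ext; simp

theorem eqv_coindMap' {f : A →ₗ[ℚ] B} (hf : Eqv ρ σ f) :
    Eqv (Representation.coind ι ρ) (Representation.coind ι σ) (coindMap' ι hf) :=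
  fun _ _ => rfl

theorem coindMap'_surjective (hι : Function.Injective ι) {f : A →ₗ[ℚ] B} (hf : Eqv ρ σ f)
    (hs : Function.Surjective f) : Function.Surjective (coindMap' ι hf) := by
  intro y
  let r := QuotientGroup.rightRel ι.range
  choose s hs using hs
  let c : G → G := fun g => Quotient.out (Quotient.mk r g)
  have hc : ∀ g, ∃ p, ι p * c g = g := fun g => by
    have : r (c g) g := Quotient.mk_out g
    obtain ⟨p, hp⟩ := QuotientGroup.rightRel_apply.1 this
    exact ⟨p, by rw [hp, inv_mul_cancel_right]⟩
  choose γ hγ using hc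
  have hcc : ∀ p g, c (ι p * g) = c g := fun p g =>
    congrArg Quotient.out (Quotient.sound (QuotientGroup.rightRel_apply.2
      ⟨p⁻¹, by rw [mul_inv_rev, mul_inv_cancel_left, map_inv]⟩))
  have hγγ : ∀ p g, γ (ι p * g) = p * γ g := fun p g => hι (by
    have h1 := hγ (ι p * g)
    rw [hcc] at h1
    rw [map_mul, ← mul_left_inj (c g), h1, mul_assoc, hγ])
  refine ⟨⟨fun g => ρ (γ g) (s (y.1 (c g))), fun p g => ?_⟩, Subtype.ext (funext fun g => ?_)⟩
  · beta_reduce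
    rw [hγγ, hcc, map_mul]; rfl
  · change f (ρ (γ g) (s (y.1 (c g)))) = y.1 g
    rw [hf, hs, ← y.2, hγ]

theorem SES.coind {f : A →ₗ[ℚ] B} {g : B →ₗ[ℚ] C} (S : SES ρ σ τ f g)
    (hι : Function.Injective ι) :
    SES (Representation.coind ι ρ) (Representation.coind ι σ) (Representation.coind ι τ)
      (coindMap' ι S.eqf) (coindMap' ι S.eqg) where
  eqf := eqv_coindMap' ι _
  eqg := eqv_coindMap' ι _
  inj v w h := Subtype.ext (funext fun x => S.inj (congrFun (congrArg Subtype.val h) x))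
  surj := coindMap'_surjective ι hι S.eqg S.surj
  zero v := Subtype.ext (funext fun x => S.zero (v.1 x))
  exact v hv := by
    choose a ha using fun x => S.exact (v.1 x) (congrFun (congrArg Subtype.val hv) x)
    refine ⟨⟨a, fun p g => S.inj ?_⟩, Subtype.ext (funext ha)⟩
    rw [S.eqf, ha, ha, v.2]

/-- Frobenius reciprocity. -/
def frob (υ : Representation ℚ G V) {e : V →ₗ[ℚ] A} (he : Eqv (υ.comp ι) ρ e) :
    V →ₗ[ℚ] Representation.coindV ι ρ where
  toFun v := ⟨fun g => e (υ g v), fun p g => by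
    beta_reduce
    rw [← he, map_mul]; rfl⟩
  map_add' v w := by ext; simp
  map_smul' c v := by ext; simp

theorem eqv_frob (υ : Representation ℚ G V) {e : V →ₗ[ℚ] A} (he : Eqv (υ.comp ι) ρ e) :
    Eqv υ (Representation.coind ι ρ) (frob ι υ he) := fun g v =>
  Subtype.ext (funext fun x => by
    change e (υ x (υ g v)) = e (υ (x * g) v)
    rw [map_mul]; rfl)

theorem IsCoind.bijective_frob {ι : P →* G} {υ : Representation ℚ G V} {e : V →ₗ[ℚ] A}
    (h : IsCoind ι υ ρ e) : Function.Bijective (frob ι υ (e := e) h.eqv) := by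
  constructor
  · rw [injective_iff_map_eq_zero]
    exact fun v hv => h.ext v fun g => congrFun (congrArg Subtype.val hv) g
  · intro f
    obtain ⟨v, hv⟩ := h.lift f.1 f.2
    exact ⟨v, Subtype.ext (funext hv)⟩

end Coinduction

section Affine
open SemidirectProduct
variable {N Γ : Type} [Group N] [Group Γ] {π : Γ →* MulAut N}
  {A B C M : Type} [AddCommGroup M] [Module ℚ M] [AddCommGroup A] [Module ℚ A] [AddCommGroup B]
  [Module ℚ B] [AddCommGroup C] [Module ℚ C]

/-- Affine functions on a group. -/
def affs (N M : Type) [Group N] [AddCommGroup M] [Module ℚ M] : Submodule ℚ (N → M) where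
  carrier := {F | ∀ x y, F (x * y) = F x + F y - F 1}
  add_mem' {f g} hf hg x y := by
    simp only [Pi.add_apply]
    rw [hf, hg]
    abel
  zero_mem' x y := by simp
  smul_mem' c f hf x y := by
    simp only [Pi.smul_apply]
    rw [hf, smul_sub, smul_add]

variable (π) in
/-- The action on affine functions. -/
def affRep (μ : Representation ℚ Γ M) :
    Representation ℚ (N ⋊[π] Γ) (affs N M) where
  toFun g := (twRep π μ g).restrict fun F hF x y => by
    have h : ∀ x, twRep π μ g F x = μ g.right (F (g⁻¹.left * π g⁻¹.right x)) := fun _ => rfl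
    rw [h, h, h, h, map_mul, ← mul_assoc, map_one, mul_one]
    have hF' : ∀ x y, F (x * y) = F x + F y - F 1 := hF
    rw [← map_add, ← map_sub]
    congr 1
    simp only [hF']
    abel
  map_one' := by ext; simp
  map_mul' g h := by ext; simp; rfl

theorem eqv_affs_subtype (μ : Representation ℚ Γ M) :
    Eqv (affRep π μ) (twRep π μ) (affs N M).subtype := fun _ _ => rfl

/-- Constant functions. -/
def constMap (N M : Type) [Group N] [AddCommGroup M] [Module ℚ M] : M →ₗ[ℚ] affs N M where
  toFun a := ⟨fun _ => a, fun x y => by simp⟩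
  map_add' _ _ := rfl
  map_smul' _ _ := rfl

theorem eqv_constMap (μ : Representation ℚ Γ M) :
    Eqv (infl π μ) (affRep π μ) (constMap N M) := fun _ _ => rfl

/-- The linear part of an affine function. -/
def linPart (N M : Type) [Group N] [AddCommGroup M] [Module ℚ M] : affs N M →ₗ[ℚ] homs N M where
  toFun F := ⟨fun x => F.1 x - F.1 1, fun x y => by
    beta_reduce
    rw [F.2]
    abel⟩
  map_add' F F' := by
    ext x
    change F.1 x + F'.1 x - (F.1 1 + F'.1 1) = F.1 x - F.1 1 + (F'.1 x - F'.1 1)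
    abel
  map_smul' c F := by
    ext x
    exact (smul_sub c (F.1 x) (F.1 1)).symm

theorem eqv_linPart (μ : Representation ℚ Γ M) :
    Eqv (affRep π μ) (infl π (homRep π μ)) (linPart N M) := fun g F => by
  ext x
  have h : ∀ x, twRep π μ g F.1 x = μ g.right (F.1 (g⁻¹.left * π g⁻¹.right x)) := fun _ => rfl
  change twRep π μ g F.1 x - twRep π μ g F.1 1 = μ g.right (F.1 (π g.right⁻¹ x) - F.1 1)
  rw [h, h, map_one, mul_one, ← map_sub, F.2]
  congr 1
  simp only [inv_left, inv_right, map_inv, MulAut.inv_apply]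
  abel

theorem linPart_comp_constMap : linPart N M ∘ₗ constMap N M = 0 := by
  ext a x
  exact sub_self a

/-- The second difference of a function. -/
def secondDiff (N M : Type) [Group N] [AddCommGroup M] [Module ℚ M] :
    (N → M) →ₗ[ℚ] N → N → M where
  toFun F x y := F (x * y) - F x - F y + F 1
  map_add' F F' := by
    funext x y
    simp only [Pi.add_apply]
    abel
  map_smul' c F := by
    funext x y
    simp [smul_sub]

theorem secondDiff_eq_zero {F : N → M} : secondDiff N M F = 0 ↔ F ∈ affs N M := by
  constructor
  · intro h x y
    have : F (x * y) - F x - F y + F 1 = 0 := congrFun (congrFun h x) y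
    rw [← sub_eq_zero, ← this]
    abel
  · intro h
    funext x y
    change F (x * y) - F x - F y + F 1 = 0
    rw [h x y]
    abel

/-- The second difference on functions modulo affine functions. -/
def secondDiffQ (N M : Type) [Group N] [AddCommGroup M] [Module ℚ M] :
    ((N → M) ⧸ LinearMap.range (affs N M).subtype) →ₗ[ℚ] N → N → M :=
  Submodule.liftQ _ (secondDiff N M) (by
    rintro _ ⟨F, rfl⟩
    exact secondDiff_eq_zero.2 F.2)

theorem mem_fix_iff (μ : Representation ℚ Γ M) (F : N → M) :
    (LinearMap.range (affs N M).subtype).mkQ F ∈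
      (resN (cokRep _ _ (eqv_affs_subtype (π := π) μ))).invariants ↔
    ∀ n, (fun x => F (n * x) - F x) ∈ affs N M := by
  have h : ∀ n, ((fun x => F (n⁻¹ * x) - F x) ∈ affs N M ↔
      resN (cokRep _ _ (eqv_affs_subtype (π := π) μ)) n
        ((LinearMap.range (affs N M).subtype).mkQ F) =
      (LinearMap.range (affs N M).subtype).mkQ F) := fun n => by
    change _ ↔ (LinearMap.range (affs N M).subtype).mkQ (twRep π μ (inl n) F) =
      (LinearMap.range (affs N M).subtype).mkQ F
    rw [← sub_eq_zero, ← map_sub, Submodule.mkQ_apply, Submodule.Quotient.mk_eq_zero,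
      Submodule.range_subtype]
    have : twRep π μ (inl n) F - F = fun x => F (n⁻¹ * x) - F x := by
      funext x
      rw [Pi.sub_apply, twRep_inl]
    rw [this]
  constructor
  · intro hF n
    simpa using (h n⁻¹).2 (hF n⁻¹)
  · exact fun hF n => (h n).1 (hF n⁻¹)

theorem secondDiff_of_fix {F : N → M} (hF : ∀ n, (fun x => F (n * x) - F x) ∈ affs N M) :
    (∀ x y z, secondDiff N M F x (y * z) = secondDiff N M F x y + secondDiff N M F x z) ∧
    ∀ x y z, secondDiff N M F (x * y) z = secondDiff N M F x z + secondDiff N M F y z := by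
  have h : ∀ n x y, F (n * (x * y)) - F (x * y) =
      F (n * x) - F x + (F (n * y) - F y) - (F (n * 1) - F 1) := fun n x y => hF n x y
  have hd : ∀ x y, secondDiff N M F x y = F (x * y) - F x - F y + F 1 := fun _ _ => rfl
  constructor
  · intro x y z
    have := h x y z
    rw [sub_eq_iff_eq_add] at this
    rw [hd, hd, hd, this, mul_one]
    abel
  · intro x y z
    have := h x y z
    rw [sub_eq_iff_eq_add] at this
    rw [hd, hd, hd, mul_assoc, this, mul_one]
    abel

end Affine

section AffineFree
open SemidirectProduct
variable {β Γ : Type} [Group Γ] {π : Γ →* MulAut (FreeGroup β)}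
  {M : Type} [AddCommGroup M] [Module ℚ M] {μ : Representation ℚ Γ M}

theorem exists_secondDiff_eq (B : homs (FreeGroup β) (homs (FreeGroup β) M)) :
    ∃ F, ∀ x y, secondDiff (FreeGroup β) M F x y = (B.1 x).1 y := by
  obtain ⟨F, hF⟩ := exists_primitive fun s x => (B.1 x).1 (FreeGroup.of s)
  refine ⟨F, fun x y => ?_⟩
  have hB : ∀ x y z, (B.1 (x * y)).1 z = (B.1 x).1 z + (B.1 y).1 z := fun x y z => by
    rw [B.2]; rfl
  have h := eq_of_mul_of (F := fun y => F (x * y) - F y - (B.1 x).1 y) (fun y s => by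
    have h1 := hF s (x * y)
    have h2 := hF s y
    rw [sub_eq_iff_eq_add] at h1 h2
    rw [← mul_assoc, h1, h2, hB, (B.1 x).2]
    abel) 1 y
  beta_reduce at h
  rw [one_mul, mul_one, homs_one, sub_zero, sub_eq_iff_eq_add, sub_eq_iff_eq_add] at h
  change F (x * y) - F x - F y + F 1 = _
  rw [h]
  abel

theorem hz_cokRep_affs {k : ℕ} (h : HZ (A := homs (FreeGroup β) (homs (FreeGroup β) M)) (homRep π (homRep π μ)) k) :
    HZ (cokRep _ _ (eqv_affs_subtype (π := π) μ)) k := by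
  refine hz_cokRep_twRep _ (Submodule.subtype_injective _) ?_
  have hfix : ∀ c : (resN (cokRep _ _ (eqv_affs_subtype (π := π) μ))).invariants,
      (∀ x y z, secondDiffQ (FreeGroup β) M c.1 x (y * z) =
        secondDiffQ (FreeGroup β) M c.1 x y + secondDiffQ (FreeGroup β) M c.1 x z) ∧
      ∀ x y z, secondDiffQ (FreeGroup β) M c.1 (x * y) z =
        secondDiffQ (FreeGroup β) M c.1 x z + secondDiffQ (FreeGroup β) M c.1 y z := by
    rintro ⟨c, hc⟩
    obtain ⟨F, rfl⟩ := Submodule.mkQ_surjective _ c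
    exact secondDiff_of_fix ((mem_fix_iff μ F).1 hc)
  let T : (resN (cokRep _ _ (eqv_affs_subtype (π := π) μ))).invariants →ₗ[ℚ]
      homs (FreeGroup β) (homs (FreeGroup β) M) :=
    { toFun := fun c => ⟨fun x => ⟨secondDiffQ (FreeGroup β) M c.1 x, (hfix c).1 x⟩,
        fun x y => Subtype.ext (funext ((hfix c).2 x y))⟩
      map_add' := fun c d => Subtype.ext (funext fun x => Subtype.ext (funext fun y =>
        congrFun (congrFun (map_add (secondDiffQ (FreeGroup β) M) c.1 d.1) x) y))
      map_smul' := fun r c => Subtype.ext (funext fun x => Subtype.ext (funext fun y =>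
        congrFun (congrFun (map_smul (secondDiffQ (FreeGroup β) M) r c.1) x) y)) }
  refine h.of_bijective T (fun γ => ?_) ⟨?_, ?_⟩
  · rintro ⟨c, hc⟩
    obtain ⟨F, rfl⟩ := Submodule.mkQ_surjective _ c
    refine Subtype.ext (funext fun x => Subtype.ext (funext fun y => ?_))
    change secondDiff _ _ (twRep π μ (inr γ) F) x y =
      μ γ (secondDiff _ _ F (π γ⁻¹ x) (π γ⁻¹ y))
    change twRep π μ (inr γ) F (x * y) - twRep π μ (inr γ) F x - twRep π μ (inr γ) F y +
      twRep π μ (inr γ) F 1 = μ γ (F (π γ⁻¹ x * π γ⁻¹ y) - F (π γ⁻¹ x) - F (π γ⁻¹ y) + F 1)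
    simp only [twRep_inr, map_sub, map_add, map_mul, map_one]
  · rw [injective_iff_map_eq_zero]
    rintro ⟨c, hc⟩ h0
    obtain ⟨F, rfl⟩ := Submodule.mkQ_surjective _ c
    apply Subtype.ext
    change (LinearMap.range _).mkQ F = 0
    rw [Submodule.mkQ_apply, Submodule.Quotient.mk_eq_zero, Submodule.range_subtype,
      ← secondDiff_eq_zero]
    funext x y
    exact congrFun (congrArg Subtype.val (congrFun (congrArg Subtype.val h0) x)) y
  · intro B
    obtain ⟨F, hF⟩ := exists_secondDiff_eq B
    have hF' : ∀ x y, F (x * y) = (B.1 x).1 y + (F x + F y - F 1) := fun x y => by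
      rw [← hF, secondDiff, LinearMap.coe_mk, AddHom.coe_mk]
      abel
    refine ⟨⟨(LinearMap.range _).mkQ F, (mem_fix_iff μ F).2 fun n x y => ?_⟩,
      Subtype.ext (funext fun x => Subtype.ext (funext fun y => hF x y))⟩
    beta_reduce
    rw [hF' n (x * y), hF' n x, hF' n y, mul_one, (B.1 n).2]
    abel

end AffineFree

section Vanishing
open SemidirectProduct
variable {N Γ G : Type} [Group N] [Group Γ] [Group G] {π : Γ →* MulAut N}
  {A B C : Type} [AddCommGroup A] [Module ℚ A] [AddCommGroup B]
  [Module ℚ B] [AddCommGroup C] [Module ℚ C]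

theorem SES.tw {ρ : Representation ℚ Γ A} {σ : Representation ℚ Γ B} {τ : Representation ℚ Γ C}
    {f : A →ₗ[ℚ] B} {g : B →ₗ[ℚ] C} (S : SES ρ σ τ f g) :
    SES (twRep π ρ) (twRep π σ) (twRep π τ) (f.compLeft N) (g.compLeft N) where
  eqf h F := funext fun x => S.eqf _ _
  eqg h F := funext fun x => S.eqg _ _
  inj F F' h := funext fun x => S.inj (congrFun h x)
  surj F := by
    choose b hb using fun x => S.surj (F x)
    exact ⟨b, funext hb⟩
  zero F := funext fun x => S.zero _
  exact F hF := by
    choose a ha using fun x => S.exact (F x) (congrFun hF x)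
    exact ⟨a, funext ha⟩

theorem eqv_const (μ : Representation ℚ Γ A) :
    Eqv (infl π μ) (twRep π μ) ((affs N A).subtype ∘ₗ constMap N A) := fun _ _ => rfl

variable {ι : N ⋊[π] Γ →* G}

theorem epi_map_const (hι : Function.Injective ι) (i : ℕ) :
    ∀ {A : Type} [AddCommGroup A] [Module ℚ A] (μ : Representation ℚ Γ A),
      Epi ((eqv_coindMap' ι (eqv_const μ)).map i) := by
  induction i with
  | zero =>
    intro A _ _ μ
    refine Eqv.epi_map_zero _ fun b hb => ?_
    have hb1 : ∀ g, b.1 g = b.1 1 := fun g => by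
      have : b.1 (1 * g) = b.1 1 := congrFun (congrArg Subtype.val (hb g)) 1
      rwa [one_mul] at this
    have hb2 : ∀ p, twRep π μ p (b.1 1) = b.1 1 := fun p => by
      rw [← b.2, hb1]
    have hb3 : ∀ x, b.1 1 x = b.1 1 1 := fun x => by
      have := congrFun (hb2 (inl x)) x
      rw [twRep_inl, inv_mul_cancel] at this
      exact this.symm
    have hb4 : ∀ p, infl π μ p (b.1 1 1) = b.1 1 1 := fun p => by
      have := congrFun (hb2 p) 1
      rwa [funRep_apply, hb3] at this
    exact ⟨⟨fun _ => b.1 1 1, fun p _ => (hb4 p).symm⟩, fun g => rfl,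
      Subtype.ext (funext fun g => funext fun x =>
        (hb3 x).symm.trans (congrFun (hb1 g).symm x))⟩
  | succ i ih =>
    intro A _ _ μ
    have hc : Eqv μ (funRep μ (X := Γ)) (LinearMap.pi fun _ => LinearMap.id) :=
      fun g a => by ext; simp
    have S := ses_cok hc fun a b hab => congrFun hab 1
    exact SES.epi_map_succ ((S.comp rightHom).coind ι hι) ((S.tw (π := π)).coind ι hι) _
      (eqv_coindMap' ι (eqv_const (π := π) _)) _ (fun _ => rfl) (fun _ => rfl)
      (hz_coind ι _ hι (hz_twRep (hz_funRep_self i))) (ih _)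

end Vanishing

section Cancel
variable {G A B C : Type} [Group G] [AddCommGroup A] [Module ℚ A] [AddCommGroup B]
  [Module ℚ B] [AddCommGroup C] [Module ℚ C] {ρ : Representation ℚ G A}
  {σ : Representation ℚ G B} {τ : Representation ℚ G C}

theorem Eqv.map_eq_zero_of_comp {f : A →ₗ[ℚ] B} (hf : Eqv ρ σ f) {g : B →ₗ[ℚ] C}
    (hg : Eqv σ τ g) (hb : Function.Bijective g) {i : ℕ} (h : (hf.comp hg).map i = 0) :
    hf.map i = 0 := by
  let E := LinearEquiv.ofBijective g hb
  have hE : Eqv σ τ E.toLinearMap := hg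
  have h1 := Eqv.map_comp (hf.comp hg) (Eqv.symm E hE) i
  rw [h, Limits.zero_comp] at h1
  rw [← h1]
  congr 1
  exact LinearMap.ext fun v => (E.symm_apply_apply (f v)).symm

end Cancel

section VanishingFree
open SemidirectProduct
variable {β Γ G : Type} [Group Γ] [Group G] {π : Γ →* MulAut (FreeGroup β)}
  {M V₀ V₁ : Type} [AddCommGroup M] [Module ℚ M] [AddCommGroup V₀] [Module ℚ V₀]
  [AddCommGroup V₁] [Module ℚ V₁] {μ : Representation ℚ Γ M} {ι : FreeGroup β ⋊[π] Γ →* G}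
  {υ₀ : Representation ℚ G V₀} {υ₁ : Representation ℚ G V₁}

theorem map_linPart_eq_zero (hι : Function.Injective ι) {i : ℕ}
    (h : ∀ k, i = k + 1 → HZ (A := homs (FreeGroup β) (homs (FreeGroup β) M)) (homRep π (homRep π μ)) k) :
    (eqv_coindMap' ι (eqv_linPart (π := π) μ)).map i = 0 := by
  have S := (ses_cok (eqv_affs_subtype (π := π) μ) (Submodule.subtype_injective _)).coind ι hι
  have hm : Mono ((eqv_coindMap' ι (eqv_affs_subtype (π := π) μ)).map i) := by
    obtain _ | k := i
    · exact Eqv.mono_map_zero _ S.inj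
    · exact S.mono_map (hz_coind ι _ hι (hz_cokRep_affs (h k rfl)))
  have hcomp := Eqv.map_comp (eqv_coindMap' ι (eqv_constMap (π := π) μ))
    (eqv_coindMap' ι (eqv_affs_subtype (π := π) μ)) i
  have he : Epi ((eqv_coindMap' ι (eqv_const (π := π) μ)).map i) := epi_map_const hι i μ
  have he2 : Epi ((eqv_coindMap' ι (eqv_constMap (π := π) μ)).map i ≫
      (eqv_coindMap' ι (eqv_affs_subtype (π := π) μ)).map i) := by
    rw [← hcomp]
    exact he
  have he3 := epi_of_epi ((eqv_coindMap' ι (eqv_constMap (π := π) μ)).map i)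
    ((eqv_coindMap' ι (eqv_affs_subtype (π := π) μ)).map i)
  have hiso := isIso_of_mono_of_epi ((eqv_coindMap' ι (eqv_affs_subtype (π := π) μ)).map i)
  have he4 : Epi ((eqv_coindMap' ι (eqv_constMap (π := π) μ)).map i) := by
    rw [← Category.comp_id ((eqv_coindMap' ι (eqv_constMap (π := π) μ)).map i),
      ← IsIso.hom_inv_id ((eqv_coindMap' ι (eqv_affs_subtype (π := π) μ)).map i),
      ← Category.assoc]
    exact epi_comp _ _
  rw [← cancel_epi ((eqv_coindMap' ι (eqv_constMap (π := π) μ)).map i), Limits.comp_zero,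
    ← Eqv.map_comp]
  refine Eqv.map_zero _ (LinearMap.ext fun v => Subtype.ext (funext fun g => ?_)) i
  exact LinearMap.congr_fun linPart_comp_constMap (v.1 g)

/-- A map to a module coinduced from additive maps vanishes on cohomology if it lifts to affine
maps. -/
theorem map_eq_zero_of_affs {e₁ : V₁ →ₗ[ℚ] homs (FreeGroup β) M}
    (hc : IsCoind ι υ₁ (infl π (homRep π μ)) e₁) {r : V₀ →ₗ[ℚ] V₁} (hr : Eqv υ₀ υ₁ r)
    {e₀ : V₀ →ₗ[ℚ] affs (FreeGroup β) M} (he₀ : Eqv (υ₀.comp ι) (affRep π μ) e₀)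
    (h : ∀ v, e₁ (r v) = linPart _ _ (e₀ v)) {i : ℕ}
    (hz : ∀ k, i = k + 1 → HZ (A := homs (FreeGroup β) (homs (FreeGroup β) M)) (homRep π (homRep π μ)) k) : hr.map i = 0 := by
  have h1 := Eqv.map_comp hr (eqv_frob ι υ₁ hc.eqv) i
  have h2 := Eqv.map_comp (eqv_frob ι υ₀ he₀) (eqv_coindMap' ι (eqv_linPart (π := π) μ)) i
  have h3 : frob ι υ₁ hc.eqv ∘ₗ r = coindMap' ι (eqv_linPart (π := π) μ) ∘ₗ frob ι υ₀ he₀ :=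
    LinearMap.ext fun v => Subtype.ext (funext fun g => by
      change e₁ (υ₁ g (r v)) = linPart _ _ (e₀ (υ₀ g v))
      rw [← hr, h])
  rw [map_linPart_eq_zero hc.inj hz, Limits.comp_zero] at h2
  refine hr.map_eq_zero_of_comp (eqv_frob ι υ₁ hc.eqv) hc.bijective_frob ?_
  rw [← h2]
  congr 1

end VanishingFree

section Forms
open SemidirectProduct
variable {N : Type} [Group N]

/-- Multiadditive forms on a group. -/
def mf (q : ℕ) (N : Type) [Group N] : Submodule ℚ ((Fin q → N) → ℚ) where
  carrier := {F | ∀ t k u w, F (Function.update t k (u * w)) =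
    F (Function.update t k u) + F (Function.update t k w)}
  add_mem' {F G} hF hG t k u w := by
    simp only [Pi.add_apply]
    rw [hF, hG]
    ring
  zero_mem' t k u w := by simp
  smul_mem' c F hF t k u w := by
    simp only [Pi.smul_apply]
    rw [hF, smul_add]

theorem comp_update {q : ℕ} {N' : Type} (f : N → N') (t : Fin q → N) (k : Fin q) (u : N) :
    (fun i => f (Function.update t k u i)) = Function.update (fun i => f (t i)) k (f u) := by
  funext i
  rcases eq_or_ne i k with rfl | h
  · simp
  · simp [h]

variable (N) in
/-- Automorphisms act on multiadditive forms. -/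
def mfRep (q : ℕ) : Representation ℚ (MulAut N) (mf q N) where
  toFun φ :=
    { toFun := fun F => ⟨fun t => F.1 fun i => φ⁻¹ (t i), fun t k u w => by
        beta_reduce
        rw [comp_update, comp_update, comp_update, map_mul, F.2]⟩
      map_add' := fun _ _ => rfl
      map_smul' := fun _ _ => rfl }
  map_one' := rfl
  map_mul' φ ψ := by
    ext F t
    change F.1 _ = F.1 _
    rw [mul_inv_rev]
    rfl

theorem mfRep_apply {q : ℕ} (φ : MulAut N) (F : mf q N) (t : Fin q → N) :
    (mfRep N q φ F).1 t = F.1 fun i => φ⁻¹ (t i) := rfl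

theorem mf_conj {q : ℕ} (F : mf q N) (t : Fin q → N) (c : N) :
    F.1 (fun i => MulAut.conj c (t i)) = F.1 t := by
  have key : ∀ s : Finset (Fin q),
      F.1 (fun i => if i ∈ s then MulAut.conj c (t i) else t i) = F.1 t := by
    intro s
    induction s using Finset.induction_on with
    | empty => simp
    | insert k s hk ih =>
      have h0 : ∀ T, F.1 (Function.update T k 1) = 0 := fun T => by
        have := F.2 T k 1 1
        rwa [mul_one, left_eq_add] at this
      have h1 : ∀ T, F.1 (Function.update T k (c * t k * c⁻¹)) = F.1 (Function.update T k (t k)) :=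
        fun T => by
          have h2 := F.2 T k c c⁻¹
          rw [mul_inv_cancel, h0] at h2
          rw [F.2, F.2]
          linarith
      rw [← ih]
      convert h1 (fun i => if i ∈ s then MulAut.conj c (t i) else t i) using 2
      · funext i
        rcases eq_or_ne i k with rfl | hi
        · simp
        · simp [hi]
      · funext i
        rcases eq_or_ne i k with rfl | hi
        · simp [hk]
        · simp [hi]
  simpa using key Finset.univ

theorem mfRep_conj (q : ℕ) (c : N) (g : MulAut N) :
    mfRep N q (MulAut.conj c * g) = mfRep N q g := by
  rw [map_mul]
  refine LinearMap.ext fun F => Subtype.ext (funext fun t => ?_)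
  change (mfRep N q g F).1 (fun i => (MulAut.conj c)⁻¹ (t i)) = _
  rw [← map_inv]
  exact mf_conj _ _ _

/-- Currying multiadditive forms. -/
def mfCurry (q : ℕ) (N : Type) [Group N] : mf (q + 1) N ≃ₗ[ℚ] homs N (mf q N) where
  toFun F := ⟨fun h => ⟨fun t => F.1 (Fin.cons h t), fun t k u w => by
      beta_reduce
      rw [Fin.cons_update, Fin.cons_update, Fin.cons_update, F.2]⟩, fun x y => by
      ext t
      have := F.2 (Fin.cons 1 t) 0 x y
      rw [Fin.update_cons_zero, Fin.update_cons_zero, Fin.update_cons_zero] at this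
      exact this⟩
  map_add' _ _ := rfl
  map_smul' _ _ := rfl
  invFun f := ⟨fun t => (f.1 (t 0)).1 (Fin.tail t), fun t k u w => by
    beta_reduce
    induction k using Fin.cases with
    | zero =>
      simp only [Function.update_self, Fin.tail_update_zero]
      rw [f.2]
      rfl
    | succ k =>
      simp only [Fin.tail_update_succ]
      rw [Function.update_of_ne (Fin.succ_ne_zero k).symm,
        Function.update_of_ne (Fin.succ_ne_zero k).symm,
        Function.update_of_ne (Fin.succ_ne_zero k).symm, (f.1 (t 0)).2]⟩
  left_inv F := by
    ext t
    change F.1 (Fin.cons (t 0) (Fin.tail t)) = _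
    rw [Fin.cons_self_tail]
  right_inv f := rfl

variable {Γ Γ' : Type} [Group Γ] [Group Γ']

theorem mfCurry_eqv (π : Γ →* MulAut N) (q : ℕ) :
    Eqv (A := mf (q + 1) N) (B := homs N (mf q N)) ((mfRep N (q + 1)).comp π) (homRep π ((mfRep N q).comp π))
      (mfCurry q N).toLinearMap := by
  intro γ F
  ext h t
  change F.1 (fun i => (π γ)⁻¹ ((Fin.cons h t : Fin (q + 1) → N) i)) =
    F.1 (Fin.cons (π γ⁻¹ h) fun i => (π γ)⁻¹ (t i))
  refine congrArg F.1 (funext fun i => ?_)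
  induction i using Fin.cases with
  | zero => simp
  | succ i => simp

theorem hz_homRep_mf {π : Γ →* MulAut N} {q i : ℕ} (h : HZ ((mfRep N (q + 1)).comp π) i) :
    HZ (A := homs N (mf q N)) (homRep π ((mfRep N q).comp π)) i :=
  h.of_bijective' (B := homs N (mf q N)) (mfCurry q N).toLinearMap (mfCurry_eqv π q) (mfCurry q N).bijective

/-- Vanishing of the cohomology of multiadditive forms in a range. -/
def Good (π : Γ →* MulAut N) (J c : ℕ) : Prop :=
  ∀ j ≤ J, ∀ q, 1 ≤ q → 2 * j + q + 2 ≤ c → HZ ((mfRep N q).comp π) j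

theorem Good.infl {β : Type} {π : Γ →* MulAut (FreeGroup β)} {J c : ℕ} (h : Good π J c) :
    Good (π.comp (rightHom : FreeGroup β ⋊[π] Γ →* Γ)) J c := by
  intro j hj q hq hc
  refine hz_infl (π := π) (μ := (mfRep (FreeGroup β) q).comp π) (h j hj q hq hc) ?_
  rintro k rfl
  exact hz_homRep_mf (h k (by omega) (q + 1) (by omega) (by omega))

theorem Good.transport {π : Γ →* MulAut N} {π' : Γ' →* MulAut N} {J c : ℕ} (h : Good π J c)
    (e : Γ' ≃* Γ) (he : ∀ g, π (e g) = π' g) : Good π' J c := by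
  intro j hj q hq hc
  refine (h j hj q hq hc).transport e (LinearEquiv.refl ℚ _) fun g a => ?_
  change mfRep N q (π' g) a = mfRep N q (π (e g)) a
  rw [he]

/-- Tuples of elements of a group, extended by automorphisms. -/
abbrev Hol (κ N : Type) [Group N] : Type :=
  (κ → N) ⋊[MulDistribMulAction.toMulAut (MulAut N) (κ → N)] MulAut N

/-- The projection onto the automorphism factor. -/
def holPr (κ N : Type) [Group N] : Hol κ N →* MulAut N := rightHom

theorem Good.hol {β : Type} {J c : ℕ} (h : Good (MonoidHom.id (MulAut (FreeGroup β))) J c)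
    (κ : Type) [Finite κ] : Good (holPr κ (FreeGroup β)) J c := by
  induction κ using Finite.induction_empty_option with
  | of_equiv e ih =>
    rename_i κ κ'
    refine ih.transport
      { toFun := fun g => ⟨fun k => g.left (e k), g.right⟩
        invFun := fun g => ⟨fun k => g.left (e.symm k), g.right⟩
        left_inv := fun g => by ext <;> simp
        right_inv := fun g => by ext <;> simp
        map_mul' := fun g g' => rfl } fun g => rfl
  | h_empty =>
    exact h.transport
      { toFun := fun g => g.right
        invFun := fun g => ⟨1, g⟩
        left_inv := fun g => SemidirectProduct.ext (Subsingleton.elim _ _) rfl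
        right_inv := fun g => rfl
        map_mul' := fun g g' => rfl } fun g => rfl
  | h_option ih =>
    rename_i κ _
    refine ih.infl.transport
      { toFun := fun g => ⟨g.left none, ⟨fun k => g.left (some k), g.right⟩⟩
        invFun := fun g => ⟨fun k => k.elim g.left g.right.left, g.right.right⟩
        left_inv := fun g => by
          refine SemidirectProduct.ext (funext fun k => ?_) rfl
          cases k <;> rfl
        right_inv := fun g => rfl
        map_mul' := fun g g' => rfl } fun g => rfl

end Forms

section Stabilizer
variable {α : Type} [Fintype α] [DecidableEq α] {J : Finset α}

/-- The free group on the letters outside a finite set. -/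
abbrev Nf (J : Finset α) : Type := FreeGroup {i // i ∉ J}

variable (J) in
/-- The inclusion of the free group on the letters outside a finite set. -/
def incl : Nf J →* FreeGroup α := FreeGroup.map Subtype.val

variable (J) in
/-- The projection killing the letters in a finite set. -/
def retr : FreeGroup α →* Nf J :=
  FreeGroup.lift fun i => if h : i ∉ J then FreeGroup.of ⟨i, h⟩ else 1

theorem incl_of (i : {i // i ∉ J}) : incl J (FreeGroup.of i) = FreeGroup.of i.1 :=
  FreeGroup.map.of

theorem retr_of {i : α} (h : i ∉ J) : retr J (FreeGroup.of i) = FreeGroup.of ⟨i, h⟩ := by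
  rw [retr, FreeGroup.lift_apply_of, dif_pos h]

theorem retr_of_mem {i : α} (h : i ∈ J) : retr J (FreeGroup.of i) = 1 := by
  rw [retr, FreeGroup.lift_apply_of, dif_neg (not_not.2 h)]

theorem retr_incl (n : Nf J) : retr J (incl J n) = n := by
  have : (retr J).comp (incl J) = MonoidHom.id _ := by
    ext i
    simp [incl_of, retr_of i.2]
  exact DFunLike.congr_fun this n

theorem incl_injective : Function.Injective (incl J) :=
  Function.LeftInverse.injective retr_incl

/-- The endomorphism attached to an automorphism of the complementary free factor and to multipliers. -/
def stabEnd (p : Hol ({j // j ∈ J} × Bool) (Nf J)) : FreeGroup α →* FreeGroup α :=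
  FreeGroup.lift fun i => if h : i ∈ J then
    incl J (p.left (⟨i, h⟩, false))⁻¹ * FreeGroup.of i * incl J (p.left (⟨i, h⟩, true))
    else incl J (p.right (FreeGroup.of ⟨i, h⟩))

theorem stabEnd_of_mem (p : Hol ({j // j ∈ J} × Bool) (Nf J)) {i : α} (h : i ∈ J) :
    stabEnd p (FreeGroup.of i) =
      incl J (p.left (⟨i, h⟩, false))⁻¹ * FreeGroup.of i * incl J (p.left (⟨i, h⟩, true)) := by
  rw [stabEnd, FreeGroup.lift_apply_of, dif_pos h]

theorem stabEnd_of_notMem (p : Hol ({j // j ∈ J} × Bool) (Nf J)) {i : α} (h : i ∉ J) :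
    stabEnd p (FreeGroup.of i) = incl J (p.right (FreeGroup.of ⟨i, h⟩)) := by
  rw [stabEnd, FreeGroup.lift_apply_of, dif_neg h]

theorem stabEnd_incl (p : Hol ({j // j ∈ J} × Bool) (Nf J)) (n : Nf J) :
    stabEnd p (incl J n) = incl J (p.right n) := by
  have : (stabEnd p).comp (incl J) = (incl J).comp p.right.toMonoidHom := by
    ext i
    simp [incl_of, stabEnd_of_notMem p i.2]
  exact DFunLike.congr_fun this n

theorem stabEnd_mul (p p' : Hol ({j // j ∈ J} × Bool) (Nf J)) :
    stabEnd (p * p') = (stabEnd p).comp (stabEnd p') := by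
  ext i
  rw [MonoidHom.comp_apply]
  by_cases h : i ∈ J
  · rw [stabEnd_of_mem p' h, stabEnd_of_mem (p * p') h, map_mul, map_mul, stabEnd_incl,
      stabEnd_incl, stabEnd_of_mem p h]
    have h1 : ∀ k, (p * p').left k = p.left k * p.right (p'.left k) := fun _ => rfl
    simp only [h1, mul_inv_rev, map_mul, map_inv, mul_assoc]
  · rw [stabEnd_of_notMem p' h, stabEnd_of_notMem (p * p') h, stabEnd_incl]
    rfl

theorem stabEnd_one : stabEnd (1 : Hol ({j // j ∈ J} × Bool) (Nf J)) = MonoidHom.id _ := by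
  ext i
  by_cases h : i ∈ J
  · simp [stabEnd_of_mem 1 h]
  · simp [stabEnd_of_notMem 1 h, incl_of]

variable (J) in
/-- The stabilizer of some coordinates. -/
def stabHom : Hol ({j // j ∈ J} × Bool) (Nf J) →* MulAut (FreeGroup α) where
  toFun p := (stabEnd p).toMulEquiv (stabEnd p⁻¹)
    (by rw [← stabEnd_mul, inv_mul_cancel, stabEnd_one])
    (by rw [← stabEnd_mul, mul_inv_cancel, stabEnd_one])
  map_one' := by
    ext w
    exact DFunLike.congr_fun stabEnd_one w
  map_mul' p p' := by
    ext w
    exact DFunLike.congr_fun (stabEnd_mul p p') w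

theorem stabHom_apply (p : Hol ({j // j ∈ J} × Bool) (Nf J)) (w : FreeGroup α) :
    stabHom J p w = stabEnd p w := rfl

theorem stabHom_incl (p : Hol ({j // j ∈ J} × Bool) (Nf J)) (n : Nf J) :
    stabHom J p (incl J n) = incl J (p.right n) := stabEnd_incl p n

theorem eq_one_of_commute {j : α} (h : j ∈ J) {m n : Nf J}
    (hmn : FreeGroup.of j * incl J m = incl J n * FreeGroup.of j) : m = 1 := by
  have hr := congrArg (retr J) hmn
  rw [map_mul, map_mul, retr_incl, retr_incl, retr_of_mem h, one_mul, mul_one] at hr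
  subst hr
  by_contra hm
  classical
  let L : Nf J →* Equiv.Perm (Nf J) := MulAction.toPermHom (Nf J) (Nf J)
  let ψ : FreeGroup α →* Equiv.Perm (Nf J) :=
    FreeGroup.lift fun i => if i ∈ J then Equiv.swap 1 m else L (retr J (FreeGroup.of i))
  have h1 : ∀ n, ψ (incl J n) = L n := by
    intro n
    have : ψ.comp (incl J) = L := by
      ext1 i
      simp [ψ, incl_of, i.2, retr_of i.2]
    exact DFunLike.congr_fun this n
  have h2 : ψ (FreeGroup.of j) = Equiv.swap 1 m := by simp [ψ, h]
  have h3 := congrArg ψ hmn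
  rw [map_mul, map_mul, h1, h2] at h3
  have h4 : Equiv.swap 1 m (m * 1) = m * Equiv.swap 1 m 1 := DFunLike.congr_fun h3 1
  rw [mul_one, Equiv.swap_apply_right, Equiv.swap_apply_left] at h4
  apply hm
  have : m ^ 2 = 1 ^ 2 := by rw [pow_two, ← h4, one_pow]
  exact (pow_left_injective two_ne_zero) this

theorem stabHom_injective : Function.Injective (stabHom J) := by
  rw [injective_iff_map_eq_one]
  intro p hp
  have h0 : ∀ w, stabEnd p w = w := fun w => by rw [← stabHom_apply, hp]; rfl
  have hr : p.right = 1 := by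
    ext n
    apply incl_injective
    rw [← stabEnd_incl, h0]
    rfl
  refine SemidirectProduct.ext (funext ?_) hr
  have key : ∀ j : {j // j ∈ J}, p.left (j, true) = 1 ∧ p.left (j, false) = 1 := by
    intro j
    have h1 := h0 (FreeGroup.of j.1)
    rw [stabEnd_of_mem p j.2, map_inv, mul_assoc, inv_mul_eq_iff_eq_mul] at h1
    have h2 := eq_one_of_commute j.2 h1
    refine ⟨h2, ?_⟩
    rw [h2, map_one, mul_one, right_eq_mul] at h1
    exact incl_injective (by rw [h1, map_one])
  rintro ⟨j, b⟩
  cases b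
  · exact (key j).2
  · exact (key j).1

theorem AI.dc_mul_le {A : Set (FreeGroup α)} (hA : AI A) (u w : FreeGroup α) :
    dc A (u * w) ≤ dc A u + dc A w := by
  have h : dirSet A (u * w) ⊆ dirSet A u ∪ (fun g => g * u⁻¹) '' dirSet A w := by
    rintro g ⟨h1, h2⟩
    by_cases h : g * u ∈ A
    · exact Or.inl ⟨h1, h⟩
    · exact Or.inr ⟨g * u, ⟨h, by rwa [mul_assoc]⟩, by simp⟩
  refine (Set.ncard_le_ncard h ((hA _).union ((hA _).image _))).trans
    ((Set.ncard_union_le _ _).trans ?_)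
  exact Nat.add_le_add_left (Set.ncard_image_le (hA _)) _

theorem dc_incl {j : α} (hj : j ∈ J) (b : Bool) (n : Nf J) : dc (half (j, b)) (incl J n) = 0 := by
  induction n using FreeGroup.induction_on with
  | C1 => rw [map_one, dc_one]
  | of i =>
    rw [incl_of, ← ltr_true, dc_ltr, if_neg]
    rintro h
    exact i.2 (by rw [show i.1 = j from congrArg Prod.fst h]; exact hj)
  | inv_of i _ =>
    rw [map_inv, incl_of, ← ltr_false, dc_ltr, if_neg]
    rintro h
    exact i.2 (by rw [show i.1 = j from congrArg Prod.fst h]; exact hj)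
  | mul x y hx hy => rw [map_mul]; exact dc_eq_zero_mul (AI_half _) hx hy

theorem dc_stabEnd_le (p : Hol ({j // j ∈ J} × Bool) (Nf J)) {j : α} (hj : j ∈ J)
    (w : FreeGroup α) : dc (half (j, true)) (stabEnd p w) ≤ dc (half (j, true)) w := by
  have hA := AI_half (α := α) (j, true)
  have hx : ∀ x, dc (half (j, true)) (stabEnd p (ltr x)) ≤ dc (half (j, true)) (ltr x) := by
    rintro ⟨i, b⟩
    by_cases hi : i ∈ J
    · have h1 : ∀ m n : Nf J, ∀ b, dc (half (j, true)) (incl J m * ltr (i, b) * incl J n) ≤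
          dc (half (j, true)) (ltr (i, b)) := fun m n b => by
        have h2 := hA.dc_mul_le (incl J m * ltr (i, b)) (incl J n)
        have h3 := hA.dc_mul_le (incl J m) (ltr (i, b))
        rw [dc_incl hj] at h2 h3
        omega
      cases b
      · rw [ltr_false, map_inv, stabEnd_of_mem p hi, mul_inv_rev, mul_inv_rev, ← map_inv,
          ← map_inv, ← mul_assoc, ← ltr_false]
        exact h1 _ _ _
      · rw [ltr_true, stabEnd_of_mem p hi, ← ltr_true]
        exact h1 _ _ _
    · refine le_of_eq_of_le ?_ (Nat.zero_le _)
      cases b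
      · rw [ltr_false, map_inv, stabEnd_of_notMem p hi, ← map_inv, dc_incl hj]
      · rw [ltr_true, stabEnd_of_notMem p hi, dc_incl hj]
  induction w using right_induction with
  | h1 => rw [map_one]
  | hs w x h ih =>
    rw [map_mul, dc_half_mul_ltr h]
    have := hA.dc_mul_le (stabEnd p w) (stabEnd p (ltr x))
    have h2 := hx x
    rw [dc_ltr] at h2
    omega

theorem vert_stabHom (p : Hol ({j // j ∈ J} × Bool) (Nf J)) {j : α} (hj : j ∈ J) :
    vert (stabHom J p) j = vert 1 j := by
  have h : ∀ p : Hol ({j // j ∈ J} × Bool) (Nf J), ∀ w,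
      vert (stabHom J p) j w ≤ vert 1 j w := fun p w => by
    rw [vert, ← map_inv]
    exact dc_stabEnd_le _ hj _
  funext w
  refine le_antisymm (h p w) ?_
  have := h p⁻¹ ((stabHom J p)⁻¹ w)
  rw [vert, map_inv, inv_inv, MulAut.apply_inv_self] at this
  exact this

theorem mem_range_incl {w : FreeGroup α}
    (h : ∀ j ∈ J, dc (half (j, true)) w = 0 ∧ dc (half (j, true)) w⁻¹ = 0) :
    w ∈ (incl J).range := by
  induction w using right_induction with
  | h1 => exact one_mem _
  | hs w x hw ih =>
    simp only [dc_half_inv, dc_half_mul_ltr hw] at h ih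
    refine mul_mem (ih fun j hj => ?_) ?_
    · have := h j hj
      omega
    · obtain ⟨i, b⟩ := x
      have hi : i ∉ J := fun hi => by
        have := h i hi
        cases b <;> simp [lbar] at this
      have : FreeGroup.of i ∈ (incl J).range := ⟨FreeGroup.of ⟨i, hi⟩, incl_of _⟩
      cases b
      · rw [ltr_false]
        exact inv_mem this
      · exact this

theorem exists_incl_mul {w : FreeGroup α} {i : α} (hi : i ∈ J)
    (h : ∀ j ∈ J, dc (half (j, true)) w = (if i = j then 1 else 0) ∧ dc (half (j, true)) w⁻¹ = 0) :
    ∃ a b : Nf J, w = incl J a * FreeGroup.of i * incl J b := by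
  induction w using right_induction with
  | h1 =>
    have := (h i hi).1
    simp [dc_one] at this
  | hs w x hw ih =>
    simp only [dc_half_inv, dc_half_mul_ltr hw] at h ih
    by_cases hx : x = (i, true)
    · subst hx
      have : w ∈ (incl J).range := mem_range_incl fun j hj => by
        have := h j hj
        rw [dc_half_inv]
        by_cases hij : i = j
        · simp [hij] at this ⊢
          exact ⟨this.1, this.2.1⟩
        · have h2 : (i, true) ≠ (j, true) := fun h => hij (congrArg Prod.fst h)
          simp [hij] at this ⊢
          exact ⟨this.1, this.2.1⟩
      obtain ⟨a, rfl⟩ := this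
      exact ⟨a, 1, by rw [map_one, mul_one, ltr_true]⟩
    · obtain ⟨k, b⟩ := x
      have hk : k ∉ J := fun hk => by
        have := h k hk
        by_cases hik : i = k
        · subst hik
          cases b
          · simp [lbar] at this
          · exact hx rfl
        · cases b <;> simp [lbar, hik] at this
      obtain ⟨a, c, hac⟩ := ih fun j hj => by
        have h1 : (k, b) ≠ (j, true) := fun h => hk (by
          rw [show k = j from congrArg Prod.fst h]
          exact hj)
        have h2 : (k, b) ≠ lbar (j, true) := fun h => hk (by
          rw [show k = j from congrArg Prod.fst h]
          exact hj)
        have := h j hj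
        rwa [if_neg h1, if_neg h2] at this
      cases b
      · refine ⟨a, c * (FreeGroup.of ⟨k, hk⟩)⁻¹, ?_⟩
        rw [hac, map_mul, map_inv, incl_of, ltr_false, mul_assoc _ (incl J c)]
      · refine ⟨a, c * FreeGroup.of ⟨k, hk⟩, ?_⟩
        rw [hac, map_mul, incl_of, ltr_true, mul_assoc _ (incl J c)]

theorem exists_stabHom {φ : MulAut (FreeGroup α)} (h : ∀ j ∈ J, vert φ j = vert 1 j) :
    ∃ p, stabHom J p = φ := by
  have h1 : ∀ j ∈ J, ∀ w, dc (half (j, true)) (φ⁻¹ w) = dc (half (j, true)) w := fun j hj w =>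
    congrFun (h j hj) w
  have h2 : ∀ j ∈ J, ∀ w, dc (half (j, true)) (φ w) = dc (half (j, true)) w := fun j hj w => by
    rw [← h1 j hj, MulAut.inv_apply_self]
  have key : ∀ ψ : MulAut (FreeGroup α),
      (∀ j ∈ J, ∀ w, dc (half (j, true)) (ψ w) = dc (half (j, true)) w) → ∀ n : Nf J,
      incl J (retr J (ψ (incl J n))) = ψ (incl J n) := by
    intro ψ hψ n
    obtain ⟨m, hm⟩ := mem_range_incl (J := J) (w := ψ (incl J n)) fun j hj => by
      rw [← map_inv, hψ j hj, hψ j hj, ← map_inv, dc_incl hj, dc_incl hj]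
      exact ⟨rfl, rfl⟩
    rw [← hm, retr_incl]
  have h3 := key φ h2
  have h4 := key φ⁻¹ h1
  let g : MulAut (Nf J) := MonoidHom.toMulEquiv ((retr J).comp (φ.toMonoidHom.comp (incl J)))
    ((retr J).comp (φ⁻¹.toMonoidHom.comp (incl J)))
    (by
      ext n
      change retr J (φ⁻¹ (incl J (retr J (φ (incl J (FreeGroup.of n)))))) = _
      rw [h3, MulAut.inv_apply_self, retr_incl]
      rfl)
    (by
      ext n
      change retr J (φ (incl J (retr J (φ⁻¹ (incl J (FreeGroup.of n)))))) = _
      rw [h4, MulAut.apply_inv_self, retr_incl]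
      rfl)
  have hg : ∀ n, incl J (g n) = φ (incl J n) := h3
  have hab : ∀ j : {j // j ∈ J}, ∃ a b : Nf J,
      φ (FreeGroup.of j.1) = incl J a * FreeGroup.of j.1 * incl J b := fun j => by
    refine exists_incl_mul j.2 fun i hi => ?_
    rw [← map_inv, h2 i hi, h2 i hi, ← ltr_true, dc_ltr, ltr_inv, dc_ltr]
    constructor
    · simp
    · simp [lbar]
  choose a b hab using hab
  refine ⟨⟨fun k => if k.2 then b k.1 else (a k.1)⁻¹, g⟩, ?_⟩
  refine MulEquiv.toMonoidHom_injective (FreeGroup.ext_hom _ _ fun i => ?_)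
  change stabEnd _ (FreeGroup.of i) = φ (FreeGroup.of i)
  by_cases hi : i ∈ J
  · rw [stabEnd_of_mem _ hi, hab ⟨i, hi⟩]
    simp
  · rw [stabEnd_of_notMem _ hi, hg, incl_of]

end Stabilizer

section Action
variable {α : Type} [Fintype α] [DecidableEq α] {q : ℕ}

/-- The action on functions. -/
def actV (g : MulAut (FreeGroup α)) (v : FreeGroup α → ℕ) : FreeGroup α → ℕ := fun w => v (g⁻¹ w)

theorem actV_vert (g φ : MulAut (FreeGroup α)) (j : α) : actV g (vert φ j) = vert (g * φ) j := by
  funext w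
  simp only [actV, vert, mul_inv_rev, MulAut.mul_apply]

theorem actV_mul (g h : MulAut (FreeGroup α)) (v : FreeGroup α → ℕ) :
    actV (g * h) v = actV g (actV h v) := by
  funext w
  simp only [actV, mul_inv_rev, MulAut.mul_apply]

theorem map_actV_mul (g h : MulAut (FreeGroup α)) (x : List (FreeGroup α → ℕ)) :
    x.map (actV (g * h)) = (x.map (actV h)).map (actV g) := by
  rw [List.map_map]
  exact List.map_congr_left fun v _ => actV_mul g h v

theorem map_actV_one (x : List (FreeGroup α → ℕ)) : x.map (actV 1) = x := by
  conv_rhs => rw [← List.map_id x]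
  rfl

theorem map_vert (g φ : MulAut (FreeGroup α)) (L : List α) :
    (L.map (vert φ)).map (actV g) = L.map (vert (g * φ)) := by
  rw [List.map_map]
  exact List.map_congr_left fun j _ => actV_vert g φ j

theorem Valid.act {x : List (FreeGroup α → ℕ)} (h : Valid x) (g : MulAut (FreeGroup α)) :
    Valid (x.map (actV g)) := by
  obtain ⟨φ, hφ⟩ := h
  refine ⟨g * φ, fun v hv => ?_⟩
  obtain ⟨u, hu, rfl⟩ := List.mem_map.1 hv
  obtain ⟨j, rfl⟩ := hφ u hu
  exact ⟨j, (actV_vert g φ j).symm⟩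

theorem Avoid.act {x : List (FreeGroup α → ℕ)} {w : FreeGroup α} (h : Avoid x w)
    (g : MulAut (FreeGroup α)) : Avoid (x.map (actV g)) (g w) := by
  intro v hv
  obtain ⟨u, hu, rfl⟩ := List.mem_map.1 hv
  simp only [actV, ← map_inv g w, MulAut.inv_apply_self]
  exact h u hu

theorem Ok.act {x : List (FreeGroup α → ℕ)} {t : Fin q → FreeGroup α} (h : Ok x t)
    (g : MulAut (FreeGroup α)) : Ok (x.map (actV g)) fun k => g (t k) :=
  ⟨h.1.act g, fun k => (h.2 k).act g⟩

theorem ok_act_iff {x : List (FreeGroup α → ℕ)} {t : Fin q → FreeGroup α}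
    (g : MulAut (FreeGroup α)) : Ok (x.map (actV g)) (fun k => g (t k)) ↔ Ok x t := by
  refine ⟨fun h => ?_, fun h => h.act g⟩
  have := h.act g⁻¹
  rw [← map_actV_mul, inv_mul_cancel, map_actV_one] at this
  simpa only [MulAut.inv_apply_self] using this

variable (α q) in
/-- The action on functions of a list and a tuple. -/
def actRep : Representation ℚ (MulAut (FreeGroup α))
    (List (FreeGroup α → ℕ) → (Fin q → FreeGroup α) → ℚ) where
  toFun g :=
    { toFun := fun f x t => f (x.map (actV g⁻¹)) fun k => g⁻¹ (t k)
      map_add' := fun _ _ => rfl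
      map_smul' := fun _ _ => rfl }
  map_one' := by
    refine LinearMap.ext fun f => funext fun x => funext fun t => ?_
    change f (x.map (actV 1⁻¹)) _ = _
    rw [inv_one, map_actV_one]
    rfl
  map_mul' g h := by
    refine LinearMap.ext fun f => funext fun x => funext fun t => ?_
    change f (x.map (actV (g * h)⁻¹)) _ = f ((x.map (actV g⁻¹)).map (actV h⁻¹)) _
    rw [mul_inv_rev, map_actV_mul]
    rfl

theorem actRep_apply (g : MulAut (FreeGroup α))
    (f : List (FreeGroup α → ℕ) → (Fin q → FreeGroup α) → ℚ) (x : List (FreeGroup α → ℕ))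
    (t : Fin q → FreeGroup α) :
    actRep α q g f x t = f (x.map (actV g⁻¹)) fun k => g⁻¹ (t k) := rfl

theorem actRep_mem {l : ℕ} {f : List (FreeGroup α → ℕ) → (Fin q → FreeGroup α) → ℚ}
    (hf : f ∈ Ch α q l) (g : MulAut (FreeGroup α)) : actRep α q g f ∈ Ch α q l := by
  constructor
  · intro x t h
    rw [actRep_apply]
    refine hf.1 _ _ fun h' => h ⟨by simpa using h'.1, (ok_act_iff g⁻¹).1 h'.2⟩
  · intro x t h k u w hu hw
    rw [actRep_apply, actRep_apply, actRep_apply, comp_update, comp_update, comp_update, map_mul]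
    exact hf.2 _ _ (h.act g⁻¹) k _ _ (hu.act g⁻¹) (hw.act g⁻¹)

theorem dif_actRep (g : MulAut (FreeGroup α))
    (f : List (FreeGroup α → ℕ) → (Fin q → FreeGroup α) → ℚ) :
    dif (actRep α q g f) = actRep α q g (dif f) := by
  funext x t
  rw [actRep_apply]
  by_cases h : Ok x t
  · rw [dif_of_ok h, dif_of_ok (h.act g⁻¹), bd_apply, bd_apply, ← bd_comp]
    rfl
  · rw [dif, trunc, if_neg h, dif, trunc, if_neg fun h' => h ((ok_act_iff g⁻¹).1 h')]

variable (α q) in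
/-- The action on cochains. -/
def chRep (l : ℕ) : Representation ℚ (MulAut (FreeGroup α)) (Ch α q l) where
  toFun g := (actRep α q g).restrict fun _ hf => actRep_mem hf g
  map_one' := by ext; simp
  map_mul' g h := by ext; simp

variable (α q) in
/-- The differential as a linear map. -/
def difL (l : ℕ) : Ch α q l →ₗ[ℚ] Ch α q (l + 1) where
  toFun f := ⟨dif f.1, dif_mem f.2⟩
  map_add' f g := Subtype.ext (dif_add f.1 g.1)
  map_smul' c f := Subtype.ext (dif_smul c f.1)

theorem eqv_difL (l : ℕ) : Eqv (chRep α q l) (chRep α q (l + 1)) (difL α q l) := fun g f =>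
  Subtype.ext (dif_actRep g f.1)

/-- The orbit of a list of letters. -/
def Orb (L : List α) (x : List (FreeGroup α → ℕ)) : Prop := ∃ φ, x = L.map (vert φ)

theorem Orb.act {L : List α} {x : List (FreeGroup α → ℕ)} (h : Orb L x)
    (g : MulAut (FreeGroup α)) : Orb L (x.map (actV g)) := by
  obtain ⟨φ, rfl⟩ := h
  exact ⟨g * φ, map_vert g φ L⟩

theorem orb_act_iff {L : List α} {x : List (FreeGroup α → ℕ)}
    (g : MulAut (FreeGroup α)) : Orb L (x.map (actV g)) ↔ Orb L x := by
  refine ⟨fun h => ?_, fun h => h.act g⟩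
  have := h.act g⁻¹
  rwa [← map_actV_mul, inv_mul_cancel, map_actV_one] at this

theorem Valid.exists_orb {x : List (FreeGroup α → ℕ)} (h : Valid x) :
    ∃ L : List α, L.length = x.length ∧ Orb L x := by
  obtain ⟨φ, hφ⟩ := h
  induction x with
  | nil => exact ⟨[], rfl, φ, rfl⟩
  | cons v x ih =>
    have key : ∀ x : List (FreeGroup α → ℕ), (∀ v ∈ x, v ∈ Set.range (vert φ)) →
        ∃ L : List α, x = L.map (vert φ) := by
      intro x hx
      induction x with
      | nil => exact ⟨[], rfl⟩
      | cons v x ih =>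
        obtain ⟨L, rfl⟩ := ih fun v hv => hx v (List.mem_cons_of_mem _ hv)
        obtain ⟨j, rfl⟩ := hx _ List.mem_cons_self
        exact ⟨j :: L, rfl⟩
    obtain ⟨L, hL⟩ := key _ hφ
    exact ⟨L, by rw [hL, List.length_map], φ, hL⟩

variable (q) in
/-- The cochains supported on an orbit. -/
def OrbCh (L : List α) : Submodule ℚ (List (FreeGroup α → ℕ) → (Fin q → FreeGroup α) → ℚ) where
  carrier := {f | f ∈ Ch α q L.length ∧ ∀ x t, ¬ Orb L x → f x t = 0}
  add_mem' := fun hf hg => ⟨add_mem hf.1 hg.1, fun x t h => by simp [hf.2 x t h, hg.2 x t h]⟩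
  zero_mem' := ⟨zero_mem _, fun _ _ _ => rfl⟩
  smul_mem' := fun c f hf => ⟨Submodule.smul_mem _ c hf.1, fun x t h => by simp [hf.2 x t h]⟩

variable (q) in
/-- The action on the cochains supported on an orbit. -/
def orbRep (L : List α) : Representation ℚ (MulAut (FreeGroup α)) (OrbCh q L) where
  toFun g := (actRep α q g).restrict fun f hf => ⟨actRep_mem hf.1 g, fun x t h =>
    hf.2 _ _ fun h' => h ((orb_act_iff g⁻¹).1 h')⟩
  map_one' := by ext; simp
  map_mul' g h := by ext; simp; rfl

theorem vert_one (j : α) (w : FreeGroup α) : vert 1 j w = dc (half (j, true)) w := rfl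

theorem avoid_iff {L : List α} {w : FreeGroup α} :
    Avoid (L.map (vert 1)) w ↔ w ∈ (incl L.toFinset).range := by
  constructor
  · intro h
    refine mem_range_incl fun j hj => ?_
    exact h _ (List.mem_map_of_mem (List.mem_toFinset.1 hj))
  · rintro ⟨n, rfl⟩ v hv
    obtain ⟨j, hj, rfl⟩ := List.mem_map.1 hv
    rw [← map_inv, vert_one, vert_one, dc_incl (List.mem_toFinset.2 hj),
      dc_incl (List.mem_toFinset.2 hj)]
    exact ⟨rfl, rfl⟩

theorem valid_map (L : List α) (φ : MulAut (FreeGroup α)) : Valid (L.map (vert φ)) :=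
  ⟨φ, fun v hv => by
    obtain ⟨j, -, rfl⟩ := List.mem_map.1 hv
    exact ⟨j, rfl⟩⟩

theorem ok_incl (L : List α) (t : Fin q → Nf L.toFinset) :
    Ok (L.map (vert 1)) fun k => incl L.toFinset (t k) :=
  ⟨valid_map L 1, fun k => avoid_iff.2 ⟨t k, rfl⟩⟩

variable (q) in
/-- Evaluation of a cochain at the base point of an orbit. -/
def evOrb (L : List α) : OrbCh q L →ₗ[ℚ] mf q (Nf L.toFinset) where
  toFun f := ⟨fun t => f.1 (L.map (vert 1)) fun k => incl L.toFinset (t k), fun t k u w => by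
    beta_reduce
    rw [comp_update, comp_update, comp_update, map_mul]
    exact f.2.1.2 _ _ (ok_incl L t) _ _ _ (avoid_iff.2 ⟨u, rfl⟩) (avoid_iff.2 ⟨w, rfl⟩)⟩
  map_add' _ _ := rfl
  map_smul' _ _ := rfl

theorem avoid_map_vert {L : List α} {φ : MulAut (FreeGroup α)} {w : FreeGroup α} :
    Avoid (L.map (vert φ)) w ↔ ∃ n, incl L.toFinset n = φ⁻¹ w := by
  have h1 : (L.map (vert φ)).map (actV φ⁻¹) = L.map (vert 1) := by
    rw [map_vert, inv_mul_cancel]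
  have h2 : (L.map (vert 1)).map (actV φ) = L.map (vert φ) := by
    rw [map_vert, mul_one]
  constructor
  · intro h
    have := h.act φ⁻¹
    rw [h1, avoid_iff] at this
    exact this
  · intro h
    have := (avoid_iff.2 h).act φ
    rwa [h2, MulAut.apply_inv_self] at this

/-- The cochains supported on an orbit are coinduced from the stabilizer. -/
theorem isCoind_evOrb {P : Type} [Group P] {L : List α} {ι : P →* MulAut (FreeGroup α)}
    (hι : Function.Injective ι) {pr : P →* MulAut (Nf L.toFinset)}
    (h1 : ∀ p n, ι p (incl L.toFinset n) = incl L.toFinset (pr p n))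
    (h2 : ∀ p, ∀ j ∈ L, vert (ι p) j = vert 1 j)
    (h3 : ∀ φ, (∀ j ∈ L, vert φ j = vert 1 j) → ∃ p, ι p = φ) :
    IsCoind ι (orbRep q L) ((mfRep (Nf L.toFinset) q).comp pr) (evOrb q L) where
  inj := hι
  eqv p f := by
    ext t
    change f.1 ((L.map (vert 1)).map (actV (ι p)⁻¹)) (fun k => (ι p)⁻¹ (incl L.toFinset (t k))) =
      f.1 (L.map (vert 1)) fun k => incl L.toFinset ((pr p)⁻¹ (t k))
    have h4 : L.map (vert (ι p⁻¹)) = L.map (vert 1) := List.map_congr_left (h2 p⁻¹)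
    rw [map_vert, mul_one, ← map_inv, h4]
    simp only [h1, ← map_inv pr]
  ext f hf := by
    refine Subtype.ext (funext fun x => funext fun t => ?_)
    by_cases hx : Orb L x
    · by_cases ht : ∀ k, Avoid x (t k)
      · obtain ⟨φ, rfl⟩ := hx
        simp only [avoid_map_vert] at ht
        choose n hn using ht
        have := congrFun (congrArg Subtype.val (hf φ⁻¹)) n
        change f.1 ((L.map (vert 1)).map (actV φ⁻¹⁻¹)) (fun k => φ⁻¹⁻¹ (incl L.toFinset (n k))) =
          0 at this
        rw [map_vert, inv_inv, mul_one] at this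
        simp only [hn, MulAut.apply_inv_self] at this
        exact this
      · exact f.2.1.1 x t fun h => ht h.2.2
    · exact f.2.2 x t hx
  lift Φ hΦ := by
    classical
    let f : List (FreeGroup α → ℕ) → (Fin q → FreeGroup α) → ℚ := fun x t =>
      if h : Orb L x ∧ ∀ k, Avoid x (t k) then
        (Φ h.1.choose⁻¹).1 fun k => retr L.toFinset (h.1.choose⁻¹ (t k)) else 0
    have hf : ∀ φ t, (∀ k, Avoid (L.map (vert φ)) (t k)) → f (L.map (vert φ)) t =
        (Φ φ⁻¹).1 fun k => retr L.toFinset (φ⁻¹ (t k)) := by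
      intro φ t ht
      have hO : Orb L (L.map (vert φ)) := ⟨φ, rfl⟩
      have hc := hO.choose_spec
      change dite _ _ _ = _
      rw [dif_pos ⟨hO, ht⟩]
      generalize hO.choose = ψ at hc
      obtain ⟨p, hp⟩ := h3 (φ⁻¹ * ψ) fun j hj => by
        rw [← actV_vert, ← List.map_inj_left.1 hc j hj, actV_vert, inv_mul_cancel]
      have hp' : φ⁻¹ = ι p * ψ⁻¹ := by rw [hp, mul_inv_cancel_right]
      rw [hp', hΦ]
      change _ = (Φ ψ⁻¹).1 fun k => (pr p)⁻¹ (retr L.toFinset ((ι p * ψ⁻¹) (t k)))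
      refine congrArg _ (funext fun k => ?_)
      obtain ⟨n, hn⟩ := avoid_map_vert.1 (hc ▸ ht k)
      rw [MulAut.mul_apply, ← hn, h1, retr_incl, retr_incl, MulAut.inv_apply_self]
    have hf0 : ∀ x t, ¬ (Orb L x ∧ ∀ k, Avoid x (t k)) → f x t = 0 := fun x t h => dif_neg h
    refine ⟨⟨f, ⟨fun x t h => hf0 x t ?_, ?_⟩, fun x t h => hf0 x t fun h' => h h'.1⟩, fun g => ?_⟩
    · rintro ⟨⟨φ, rfl⟩, ht⟩
      exact h ⟨by simp, valid_map L φ, ht⟩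
    · intro x t ht k u w hu hw
      by_cases hx : Orb L x
      · obtain ⟨φ, rfl⟩ := hx
        rw [hf _ _ ((ok_update ht).2 (hu.mul ht.1 hw)).2, hf _ _ ((ok_update ht).2 hu).2,
          hf _ _ ((ok_update ht).2 hw).2]
        have h5 : ∀ v, (fun i => retr L.toFinset (φ⁻¹ (Function.update t k v i))) =
            Function.update (fun i => retr L.toFinset (φ⁻¹ (t i))) k (retr L.toFinset (φ⁻¹ v)) :=
          fun v => comp_update (fun w => retr L.toFinset (φ⁻¹ w)) t k v
        rw [h5, h5, h5, map_mul, map_mul, (Φ φ⁻¹).2]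
      · rw [hf0 _ _ fun h => hx h.1, hf0 _ _ fun h => hx h.1, hf0 _ _ fun h => hx h.1, add_zero]
    · ext t
      change f ((L.map (vert 1)).map (actV g⁻¹)) (fun k => g⁻¹ (incl L.toFinset (t k))) = _
      rw [map_vert, mul_one, hf]
      · simp only [inv_inv, MulAut.apply_inv_self, retr_incl]
      · exact fun k => avoid_map_vert.2 ⟨t k, by rw [inv_inv, MulAut.apply_inv_self]⟩

theorem hz_orbRep {L : List α} {i : ℕ}
    (h : HZ ((mfRep (Nf L.toFinset) q).comp (holPr ({j // j ∈ L.toFinset} × Bool) _)) i) :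
    HZ (orbRep q L) i :=
  (isCoind_evOrb stabHom_injective (fun p n => stabHom_incl p n)
    (fun p _ hj => vert_stabHom p (List.mem_toFinset.2 hj))
    fun _ hφ => exists_stabHom fun j hj => hφ j (List.mem_toFinset.1 hj)).hz h

open Classical in
/-- The restriction of a cochain to an orbit, suitably weighted. -/
def toOrb (l : ℕ) (L : List.Vector α l) : Ch α q l →ₗ[ℚ] OrbCh q L.1 where
  toFun f := ⟨fun x t => if Orb L.1 x then
      ((Finset.univ.filter fun L : List.Vector α l => Orb L.1 x).card : ℚ)⁻¹ * f.1 x t else 0, by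
    refine ⟨⟨fun x t h => ?_, fun x t h k u w hu hw => ?_⟩, fun x t h => if_neg h⟩
    · beta_reduce
      rw [f.2.1 x t (by rwa [L.2] at h), mul_zero, ite_self]
    · beta_reduce
      rw [f.2.2 x t h k u w hu hw]
      split_ifs <;> ring⟩
  map_add' f g := by
    refine Subtype.ext (funext fun x => funext fun t => ?_)
    change ite _ (_ * (f.1 x t + g.1 x t)) _ = ite _ (_ * f.1 x t) _ + ite _ (_ * g.1 x t) _
    split_ifs <;> ring
  map_smul' c f := by
    refine Subtype.ext (funext fun x => funext fun t => ?_)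
    change ite _ (_ * (c * f.1 x t)) _ = c * ite _ (_ * f.1 x t) _
    split_ifs <;> ring

/-- Cochains supported on an orbit are cochains. -/
def ofOrb (l : ℕ) (L : List.Vector α l) : OrbCh q L.1 →ₗ[ℚ] Ch α q l where
  toFun f := ⟨f.1, (show Ch α q L.1.length = Ch α q l by rw [L.2]) ▸ f.2.1⟩
  map_add' _ _ := rfl
  map_smul' _ _ := rfl

theorem hz_chRep {l i : ℕ} (h : ∀ L : List.Vector α l, HZ (orbRep q L.1) i) :
    HZ (chRep α q l) i := by
  classical
  refine HZ.of_sum h (s := toOrb l) (r := ofOrb l) (fun L g f => ?_) (fun L g f => rfl) fun f => ?_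
  · refine Subtype.ext (funext fun x => funext fun t => ?_)
    change ite (Orb L.1 x) _ _ = ite (Orb L.1 (x.map (actV g⁻¹))) _ _
    simp only [orb_act_iff]
    rfl
  · refine Subtype.ext (funext fun x => funext fun t => ?_)
    rw [AddSubmonoidClass.coe_finsetSum, Finset.sum_apply, Finset.sum_apply]
    change ∑ L : List.Vector α l, ite (Orb L.1 x) _ _ = _
    by_cases hx : x.length = l ∧ Ok x t
    · rw [← Finset.sum_filter, Finset.sum_const, nsmul_eq_mul, ← mul_assoc, mul_inv_cancel₀, one_mul]
      obtain ⟨L, hL, hO⟩ := hx.2.1.exists_orb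
      rw [Nat.cast_ne_zero, ← Nat.pos_iff_ne_zero, Finset.card_pos]
      exact ⟨⟨L, hL.trans hx.1⟩, Finset.mem_filter.2 ⟨Finset.mem_univ _, hO⟩⟩
    · rw [f.2.1 x t hx]
      simp

end Action

section Transfer
variable {P G V V' B B' : Type} [Group P] [Group G] [AddCommGroup V] [Module ℚ V] [AddCommGroup V']
  [Module ℚ V'] [AddCommGroup B] [Module ℚ B] [AddCommGroup B'] [Module ℚ B']

theorem IsCoind.congr {ι : P →* G} {ρ : Representation ℚ G V} {β : Representation ℚ P B}
    {e : V →ₗ[ℚ] B} (h : IsCoind ι ρ β e) {ρ' : Representation ℚ G V'} {β' : Representation ℚ P B'}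
    (d : V' ≃ₗ[ℚ] V) (hd : Eqv ρ' ρ d.toLinearMap) (c : B ≃ₗ[ℚ] B') (hc : Eqv β β' c.toLinearMap) :
    IsCoind ι ρ' β' (c.toLinearMap ∘ₗ e ∘ₗ d.toLinearMap) := by
  have hd' : ∀ g v, d (ρ' g v) = ρ g (d v) := hd
  have hc' : ∀ g v, c (β g v) = β' g (c v) := hc
  refine ⟨h.inj, fun p v => ?_, fun v hv => ?_, fun f hf => ?_⟩
  · change c (e (d (ρ' (ι p) v))) = β' p (c (e (d v)))
    rw [hd', h.eqv, hc']
  · refine d.map_eq_zero_iff.1 (h.ext _ fun g => ?_)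
    rw [← hd', ← c.map_eq_zero_iff]
    exact hv g
  · obtain ⟨v, hv⟩ := h.lift (fun g => c.symm (f g)) fun p g => by
      apply c.injective
      rw [hc', c.apply_symm_apply, c.apply_symm_apply, hf]
    refine ⟨d.symm v, fun g => ?_⟩
    change c (e (d (ρ' g (d.symm v)))) = f g
    rw [hd', d.apply_symm_apply, hv, c.apply_symm_apply]

/-- Postcomposition of additive maps with an isomorphism. -/
def homsCongr (N : Type) [Group N] (c : B ≃ₗ[ℚ] B') : homs N B ≃ₗ[ℚ] homs N B' where
  toFun f := ⟨fun x => c (f.1 x), fun x y => by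
    beta_reduce
    rw [f.2, map_add]⟩
  map_add' f g := Subtype.ext (funext fun x => map_add c (f.1 x) (g.1 x))
  map_smul' a f := Subtype.ext (funext fun x => map_smul c a (f.1 x))
  invFun f := ⟨fun x => c.symm (f.1 x), fun x y => by
    beta_reduce
    rw [f.2, map_add]⟩
  left_inv f := Subtype.ext (funext fun x => c.symm_apply_apply (f.1 x))
  right_inv f := Subtype.ext (funext fun x => c.apply_symm_apply (f.1 x))

theorem eqv_homsCongr {N Γ : Type} [Group N] [Group Γ] {π : Γ →* MulAut N} {μ : Representation ℚ Γ B}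
    {μ' : Representation ℚ Γ B'} (c : B ≃ₗ[ℚ] B') (hc : Eqv μ μ' c.toLinearMap) :
    Eqv (homRep π μ) (homRep π μ') (homsCongr N c).toLinearMap := fun γ f =>
  Subtype.ext (funext fun x => hc γ (f.1 (π γ⁻¹ x)))

theorem hz_homRep_congr {N Γ : Type} [Group N] [Group Γ] {π : Γ →* MulAut N}
    {μ : Representation ℚ Γ B} {μ' : Representation ℚ Γ B'} (c : B ≃ₗ[ℚ] B')
    (hc : Eqv μ μ' c.toLinearMap) {i : ℕ} (h : HZ (A := homs N B) (homRep π μ) i) :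
    HZ (A := homs N B') (homRep π μ') i :=
  h.of_bijective' (A := homs N B) (B := homs N B') (homsCongr N c).toLinearMap
    (eqv_homsCongr c hc) (homsCongr N c).bijective

end Transfer

section Letter
variable {α : Type} [Fintype α] [DecidableEq α] {q : ℕ}

theorem dc_map_le (s : Equiv.Perm α) (j : α) (w : FreeGroup α) :
    dc (half (s j, true)) (FreeGroup.map s w) ≤ dc (half (j, true)) w := by
  induction w using right_induction with
  | h1 => rw [map_one, dc_one, dc_one]
  | hs w x h ih =>
    rw [map_mul, dc_half_mul_ltr h]
    have h1 := (AI_half (α := α) (s j, true)).dc_mul_le (FreeGroup.map s w) (FreeGroup.map s (ltr x))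
    have h2 : FreeGroup.map s (ltr x) = ltr (s x.1, x.2) := rfl
    have h3 : (s x.1, x.2) = (s j, true) ↔ x = (j, true) := by
      rw [Prod.ext_iff, Prod.ext_iff]
      simp
    rw [h2, dc_ltr] at h1
    simp only [h3] at h1
    rw [h2]
    omega

theorem dc_map (s : Equiv.Perm α) (j : α) (w : FreeGroup α) :
    dc (half (s j, true)) (FreeGroup.map s w) = dc (half (j, true)) w := by
  refine le_antisymm (dc_map_le s j w) ?_
  have := dc_map_le s⁻¹ (s j) (FreeGroup.map s w)
  rw [FreeGroup.map.comp] at this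
  simpa [Function.comp_def] using this

theorem orb_singleton (x : α) {y : List (FreeGroup α → ℕ)} (hy : Valid y) (hl : y.length = 1) :
    Orb [x] y := by
  obtain ⟨v, rfl⟩ := List.length_eq_one_iff.1 hl
  obtain ⟨φ, hφ⟩ := hy
  obtain ⟨j, rfl⟩ := hφ v (by simp)
  refine ⟨φ * (FreeGroup.freeGroupCongr (Equiv.swap x j) : MulAut (FreeGroup α)), ?_⟩
  simp only [List.map_cons, List.map_nil, List.cons.injEq, and_true]
  funext w
  rw [vert, vert, mul_inv_rev, MulAut.mul_apply]
  change _ = dc _ (FreeGroup.map (Equiv.swap x j).symm _)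
  rw [Equiv.symm_swap, ← dc_map (Equiv.swap x j) j, Equiv.swap_apply_right]

/-- Cochains of degree one are supported on a single orbit. -/
def chOne (x : α) : Ch α q 1 ≃ₗ[ℚ] OrbCh q [x] where
  toFun f := ⟨f.1, f.2, fun y t h => f.2.1 y t fun h' => h (orb_singleton x h'.2.1 h'.1)⟩
  map_add' _ _ := rfl
  map_smul' _ _ := rfl
  invFun f := ⟨f.1, f.2.1⟩

/-- Cochains of degree zero are multiadditive forms. -/
def chZero : Ch α q 0 ≃ₗ[ℚ] mf q (FreeGroup α) where
  toFun f := ⟨f.1 [], fun t k u w => f.2.2 [] t ⟨⟨1, by simp⟩, fun k v hv => by simp at hv⟩ k u w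
    (fun v hv => by simp at hv) fun v hv => by simp at hv⟩
  map_add' _ _ := rfl
  map_smul' _ _ := rfl
  invFun F := ⟨fun y t => if y.length = 0 then F.1 t else 0, by
    constructor
    · intro y t h
      beta_reduce
      rw [if_neg]
      intro hy
      rw [List.length_eq_zero_iff] at hy
      subst hy
      exact h ⟨rfl, ⟨1, by simp⟩, fun k v hv => by simp at hv⟩
    · intro y t _ k u w _ _
      beta_reduce
      split_ifs
      · exact F.2 t k u w
      · simp⟩
  left_inv f := by
    refine Subtype.ext (funext fun y => funext fun t => ?_)
    change (if y.length = 0 then f.1 [] t else 0) = f.1 y t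
    split_ifs with hy
    · rw [List.length_eq_zero_iff.1 hy]
    · rw [f.2.1 y t fun h => hy h.1]
  right_inv F := rfl

theorem eqv_chZero : Eqv (chRep α q 0) (mfRep (FreeGroup α) q) (chZero (q := q)).toLinearMap :=
  fun _ _ => rfl

end Letter

section Parabolic
open SemidirectProduct
variable {N : Type} [Group N]

/-- The holomorph of a group. -/
abbrev Hol₁ (N : Type) [Group N] : Type := N ⋊[MonoidHom.id (MulAut N)] MulAut N

/-- The holomorph acting by inner and other automorphisms. -/
def holPi (N : Type) [Group N] : Hol₁ N →* MulAut N where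
  toFun p := MulAut.conj p.left * p.right
  map_one' := by simp
  map_mul' p p' := by
    ext n
    simp [mul_assoc]

theorem holPi_apply (p : Hol₁ N) (n : N) :
    holPi N p n = p.left * p.right n * p.left⁻¹ := rfl

theorem mfRep_holPi (q : ℕ) (p : Hol₁ N) : mfRep N q (holPi N p) = mfRep N q p.right :=
  mfRep_conj q p.left p.right

theorem Good.holPi {β : Type} {J c : ℕ} (h : Good (MonoidHom.id (MulAut (FreeGroup β))) J c) :
    Good (holPi (FreeGroup β)) J c := by
  intro j hj q hq hc
  have : (mfRep (FreeGroup β) q).comp (AutFree.holPi (FreeGroup β)) =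
      (mfRep (FreeGroup β) q).comp ((MonoidHom.id _).comp rightHom) :=
    MonoidHom.ext fun p => mfRep_holPi q p
  rw [this]
  exact h.infl j hj q hq hc

variable (N) in
/-- The stabilizer of a letter inside the stabilizer of both of its ends. -/
def toHol (κ : Type) : N ⋊[holPi N] Hol₁ N →* Hol (κ × Bool) N where
  toFun p := ⟨fun k => if k.2 then p.right.left else p.left * p.right.left, p.right.right⟩
  map_one' := by
    refine SemidirectProduct.ext (funext fun k => ?_) rfl
    change (if k.2 then (1 : N) else 1 * 1) = 1
    simp
  map_mul' p p' := by
    refine SemidirectProduct.ext (funext fun k => ?_) rfl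
    change (if k.2 then p.right.left * p.right.right p'.right.left else
      p.left * (p.right.left * p.right.right p'.left * p.right.left⁻¹) *
        (p.right.left * p.right.right p'.right.left)) =
      (if k.2 then p.right.left else p.left * p.right.left) *
        p.right.right (if k.2 then p'.right.left else p'.left * p'.right.left)
    split_ifs
    · rfl
    · rw [map_mul]
      group

theorem toHol_bijective {κ : Type} [Unique κ] : Function.Bijective (toHol N κ) := by
  constructor
  · intro p p' h
    have h1 : p.right.right = p'.right.right := 
      congrArg (fun u : Hol (κ × Bool) N => u.right) h
    have h2 : p.right.left = p'.right.left :=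
      congrFun (congrArg (fun u : Hol (κ × Bool) N => u.left) h) (default, true)
    have h3 : p.left * p.right.left = p'.left * p'.right.left :=
      congrFun (congrArg (fun u : Hol (κ × Bool) N => u.left) h) (default, false)
    rw [h2, mul_left_inj] at h3
    exact SemidirectProduct.ext h3 (SemidirectProduct.ext h2 h1)
  · intro u
    refine ⟨⟨u.left (default, false) * (u.left (default, true))⁻¹,
      ⟨u.left (default, true), u.right⟩⟩, SemidirectProduct.ext (funext ?_) rfl⟩
    rintro ⟨k, b⟩
    obtain rfl := Unique.eq_default k
    cases b
    · exact inv_mul_cancel_right _ _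
    · rfl

end Parabolic

section Base
variable {α : Type} [Fintype α] [DecidableEq α] {q : ℕ}

/-- Restriction of multiadditive forms. -/
def mfRes {J : Finset α} : mf q (FreeGroup α) →ₗ[ℚ] mf q (Nf J) where
  toFun F := ⟨fun t => F.1 fun k => incl J (t k), fun t k u w => by
    beta_reduce
    rw [comp_update, comp_update, comp_update, map_mul, F.2]⟩
  map_add' _ _ := rfl
  map_smul' _ _ := rfl

/-- A multiadditive form gives an affine function on the stabilizer of a letter. -/
def toAffs (x : α) (J : Finset α) : mf (q + 1) (FreeGroup α) →ₗ[ℚ] affs (Nf J) (mf q (Nf J)) where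
  toFun F := ⟨fun h => mfRes ((mfCurry q _ F).1 (incl J h)) -
      mfRes ((mfCurry q _ F).1 (FreeGroup.of x)), fun h h' => by
    beta_reduce
    rw [map_mul, map_one, (mfCurry q _ F).2, homs_one, map_add, map_zero]
    abel⟩
  map_add' F F' := by
    refine Subtype.ext (funext fun h => ?_)
    simp only [map_add]
    change mfRes ((mfCurry q _ F).1 (incl J h) + (mfCurry q _ F').1 (incl J h)) -
      mfRes ((mfCurry q _ F).1 (FreeGroup.of x) + (mfCurry q _ F').1 (FreeGroup.of x)) =
      mfRes ((mfCurry q _ F).1 (incl J h)) - mfRes ((mfCurry q _ F).1 (FreeGroup.of x)) +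
      (mfRes ((mfCurry q _ F').1 (incl J h)) - mfRes ((mfCurry q _ F').1 (FreeGroup.of x)))
    rw [map_add, map_add]
    abel
  map_smul' c F := by
    refine Subtype.ext (funext fun h => ?_)
    simp only [map_smul]
    change mfRes (c • (mfCurry q _ F).1 (incl J h)) -
      mfRes (c • (mfCurry q _ F).1 (FreeGroup.of x)) =
      c • (mfRes ((mfCurry q _ F).1 (incl J h)) - mfRes ((mfCurry q _ F).1 (FreeGroup.of x)))
    rw [map_smul, map_smul, smul_sub]

theorem eqv_toAffs {x : α} {J : Finset α} (hx : x ∈ J) :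
    Eqv (B := affs (Nf J) (mf q (Nf J)))
      ((mfRep (FreeGroup α) (q + 1)).comp ((stabHom J).comp (toHol (Nf J) {j // j ∈ J})))
      (affRep (holPi (Nf J)) ((mfRep (Nf J) q).comp (holPi (Nf J)))) (toAffs x J) := by
  intro p F
  refine Subtype.ext (funext fun h => Subtype.ext (funext fun t => ?_))
  set d : MulAut (FreeGroup α) := stabHom J (toHol (Nf J) {j // j ∈ J} p) with hd
  set C := mfCurry q _ F with hC
  set γ := p.right with hγ
  have hd1 : ∀ n, d (incl J n) = incl J (γ.right n) := fun n => stabHom_incl _ n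
  have hd2 : d (FreeGroup.of x) = incl J (p.left * γ.left)⁻¹ * FreeGroup.of x * incl J γ.left :=
    stabEnd_of_mem _ hx
  have hpi : ∀ n, incl J ((holPi (Nf J) γ)⁻¹ n) = d⁻¹ (incl J (γ.left⁻¹ * n * γ.left)) := by
    intro n
    rw [eq_comm, MulAut.inv_apply, MulEquiv.symm_apply_eq, hd1]
    congr 1
    have : n = holPi (Nf J) γ ((holPi (Nf J) γ)⁻¹ n) := (MulAut.apply_inv_self _ _ _).symm
    conv_lhs => rw [this, holPi_apply]
    group
  have htail : ∀ y, (C.1 y).1 (fun k => incl J ((holPi (Nf J) γ)⁻¹ (t k))) =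
      (C.1 y).1 fun k => d⁻¹ (incl J (t k)) := by
    intro y
    rw [← mf_conj (C.1 y) (fun k => d⁻¹ (incl J (t k))) (d⁻¹ (incl J γ.left))⁻¹]
    refine congrArg _ (funext fun k => ?_)
    rw [hpi, MulAut.conj_apply]
    simp only [map_mul, map_inv, inv_inv]
  have hR : (affRep (holPi (Nf J)) ((mfRep (Nf J) q).comp (holPi (Nf J))) p (toAffs x J F)).1 h =
      mfRep (Nf J) q (holPi (Nf J) γ) ((toAffs x J F).1 (p⁻¹ • h)) := rfl
  have hp : (p⁻¹ • h : Nf J) = (holPi (Nf J) γ)⁻¹ (p.left⁻¹ * h) := by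
    rw [inv_smul_eq_iff, aff_smul, MulAut.apply_inv_self, mul_inv_cancel_left]
  rw [hR, hp]
  change F.1 _ - F.1 _ = (C.1 (incl J ((holPi (Nf J) γ)⁻¹ (p.left⁻¹ * h)))).1
      (fun k => incl J ((holPi (Nf J) γ)⁻¹ (t k))) -
    (C.1 (FreeGroup.of x)).1 (fun k => incl J ((holPi (Nf J) γ)⁻¹ (t k)))
  rw [htail, htail, hpi]
  have hcons : ∀ y : FreeGroup α, F.1 (fun i => d⁻¹ ((Fin.cons y fun k => incl J (t k) :
      Fin (q + 1) → FreeGroup α) i)) = (C.1 (d⁻¹ y)).1 fun k => d⁻¹ (incl J (t k)) := by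
    intro y
    change _ = F.1 (Fin.cons (d⁻¹ y) fun k => d⁻¹ (incl J (t k)))
    refine congrArg F.1 (funext fun i => ?_)
    induction i using Fin.cases with
    | zero => rfl
    | succ i => rfl
  have hx' : C.1 (FreeGroup.of x) = C.1 (d⁻¹ (FreeGroup.of x)) - C.1 (d⁻¹ (incl J p.left)) := by
    conv_lhs => rw [← MulAut.inv_apply_self _ d (FreeGroup.of x), hd2]
    simp only [map_mul, mul_inv_rev, map_inv]
    rw [C.2, C.2, C.2, homs_inv, homs_inv]
    abel
  have hh' : C.1 (d⁻¹ (incl J (γ.left⁻¹ * (p.left⁻¹ * h) * γ.left))) =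
      C.1 (d⁻¹ (incl J h)) - C.1 (d⁻¹ (incl J p.left)) := by
    simp only [map_mul, map_inv]
    rw [C.2, C.2, C.2, homs_inv, homs_inv]
    abel
  refine (congrArg₂ _ (hcons _) (hcons _)).trans ?_
  rw [hx', hh']
  simp only [Submodule.coe_sub, Pi.sub_apply]
  ring

end Base

set_option synthInstance.maxHeartbeats 200000

section Invariants
variable {α : Type} [Fintype α] [DecidableEq α] {q : ℕ}

theorem multiAdd_mf (F : mf q (FreeGroup α)) (x : List (FreeGroup α → ℕ)) : MultiAdd x F.1 :=
  fun t _ k u w _ _ => F.2 t k u w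

theorem hz_mfRep_zero (hq : 1 ≤ q) (hc : q + 2 ≤ Fintype.card α) :
    HZ (mfRep (FreeGroup α) q) 0 := by
  refine hz_zero.2 fun F hF => Subtype.ext (funext fun t => ?_)
  refine MultiAdd.eq_of_gens (x := []) (φ := 1) (by simp) (multiAdd_mf F [])
    (g := fun _ => 0) (fun _ _ _ _ _ _ _ => by simp) (fun s _ => ?_) t fun k v hv => by simp at hv
  obtain ⟨j, hj⟩ : ∃ j, j ∉ Finset.univ.image s := by
    by_contra! h
    have h1 := Finset.card_le_card (fun j _ => h j : Finset.univ ⊆ Finset.univ.image s)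
    have h2 := h1.trans Finset.card_image_le
    simp only [Finset.card_univ, Fintype.card_fin] at h2
    omega
  have hs : ∀ k, s k ∉ ({j} : Finset α) := fun k hk =>
    hj (Finset.mem_image.2 ⟨k, Finset.mem_univ _, Finset.mem_singleton.1 hk⟩)
  let k₀ : Fin q := ⟨0, hq⟩
  let p : Hol ({i // i ∈ ({j} : Finset α)} × Bool) (Nf {j}) :=
    ⟨fun k => if k.2 then FreeGroup.of ⟨s k₀, hs k₀⟩ else 1, 1⟩
  have h1 : ∀ k, stabHom {j} p (FreeGroup.of (s k)) = FreeGroup.of (s k) := fun k => by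
    rw [stabHom_apply, stabEnd_of_notMem p (hs k)]
    exact incl_of _
  have h2 : stabHom {j} p (FreeGroup.of j) = FreeGroup.of j * FreeGroup.of (s k₀) := by
    rw [stabHom_apply, stabEnd_of_mem p (Finset.mem_singleton_self j)]
    change incl {j} 1⁻¹ * FreeGroup.of j * incl {j} (FreeGroup.of ⟨s k₀, hs k₀⟩) = _
    rw [inv_one, map_one, one_mul, incl_of]
  have h3 := congrFun (congrArg Subtype.val (hF (stabHom {j} p)⁻¹))
    (Function.update (fun k => FreeGroup.of (s k)) k₀ (FreeGroup.of j))
  rw [mfRep_apply, inv_inv, comp_update, h2, F.2] at h3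
  simp only [h1] at h3
  rw [add_eq_left] at h3
  change F.1 (fun k => FreeGroup.of (s k)) = 0
  rw [← h3]
  exact congrArg F.1 (Function.update_eq_self k₀ fun k => FreeGroup.of (s k)).symm

end Invariants

theorem hz_homRep_homRep {N Γ M M' : Type} [Group N] [Group Γ] [AddCommGroup M] [Module ℚ M]
    [AddCommGroup M'] [Module ℚ M'] {π : Γ →* MulAut N} {μ : Representation ℚ Γ M}
    {μ' : Representation ℚ Γ M'} (c : M' ≃ₗ[ℚ] homs N M)
    (hc : Eqv (B := homs N M) μ' (homRep π μ) c.toLinearMap) {i : ℕ}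
    (h : HZ (A := homs N M') (homRep π μ') i) :
    HZ (A := homs N (homs N M)) (homRep π (homRep π μ)) i :=
  hz_homRep_congr (B := M') (B' := homs N M) c hc h

section Edge
variable {α : Type} [Fintype α] [DecidableEq α] {q : ℕ}

theorem difL_zero_apply (f : Ch α q 0) {v : FreeGroup α → ℕ} {t : Fin q → FreeGroup α}
    (h : Ok [v] t) : (difL α q 0 f).1 [v] t = f.1 [] t := by
  change dif f.1 [v] t = _
  rw [dif_of_ok h, bd_apply]
  change f.1 [] t - 0 = _
  rw [sub_zero]

theorem map_difL_zero {i : ℕ} (x : α)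
    (h : ∀ k, i = k + 1 → HZ ((mfRep (Nf [x].toFinset) (q + 2)).comp (holPi (Nf [x].toFinset))) k) :
    (eqv_difL (α := α) (q := q + 1) 0).map i = 0 := by
  have hx : x ∈ [x].toFinset := by simp
  have hu : ∀ j : {j // j ∈ [x].toFinset}, j = ⟨x, hx⟩ := fun j =>
    Subtype.ext (by simpa using j.2)
  let _ : Unique {j // j ∈ [x].toFinset} := ⟨⟨⟨x, hx⟩⟩, hu⟩
  have hb := toHol_bijective (N := Nf [x].toFinset) (κ := {j // j ∈ [x].toFinset})
  have hI : IsCoind ((stabHom [x].toFinset).comp (toHol (Nf [x].toFinset) {j // j ∈ [x].toFinset}))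
      (orbRep (q + 1) [x]) ((mfRep (Nf [x].toFinset) (q + 1)).comp
        ((holPr _ _).comp (toHol (Nf [x].toFinset) {j // j ∈ [x].toFinset}))) (evOrb (q + 1) [x]) := by
    refine isCoind_evOrb (Function.Injective.comp stabHom_injective hb.1 :
        Function.Injective fun p => stabHom [x].toFinset (toHol (Nf [x].toFinset) _ p))
      (fun p n => stabHom_incl (toHol (Nf [x].toFinset) _ p) n)
      (fun p _ hj => vert_stabHom _ (List.mem_toFinset.2 hj)) fun φ hφ => ?_
    obtain ⟨u, hu⟩ := exists_stabHom (J := [x].toFinset) fun j hj => hφ j (List.mem_toFinset.1 hj)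
    obtain ⟨p, rfl⟩ := hb.2 u
    exact ⟨p, hu⟩
  have hc := hI.congr (B' := homs (Nf [x].toFinset) (mf q (Nf [x].toFinset)))
    (ρ' := chRep α (q + 1) 1)
    (β' := infl (holPi (Nf [x].toFinset)) (homRep (holPi (Nf [x].toFinset))
      ((mfRep (Nf [x].toFinset) q).comp (holPi (Nf [x].toFinset)))))
    (chOne x) (fun _ _ => rfl) (mfCurry q (Nf [x].toFinset)) fun p F => by
      refine Eq.trans ?_ (mfCurry_eqv (holPi (Nf [x].toFinset)) q p.right F)
      refine congrArg (mfCurry q (Nf [x].toFinset)) ?_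
      exact (LinearMap.congr_fun (mfRep_holPi (q + 1) p.right) F).symm
  have he : Eqv (B := affs (Nf [x].toFinset) (mf q (Nf [x].toFinset)))
      ((chRep α (q + 1) 0).comp ((stabHom [x].toFinset).comp
        (toHol (Nf [x].toFinset) {j // j ∈ [x].toFinset})))
      (affRep (holPi (Nf [x].toFinset)) ((mfRep (Nf [x].toFinset) q).comp (holPi (Nf [x].toFinset))))
      (toAffs x [x].toFinset ∘ₗ (chZero (q := q + 1)).toLinearMap) := fun p f =>
    eqv_toAffs hx p (chZero f)
  refine map_eq_zero_of_affs hc (eqv_difL 0) he (fun f => ?_) fun k hk => ?_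
  · refine Subtype.ext (funext fun h => Subtype.ext (funext fun t => ?_))
    have h1 : ((linPart (Nf [x].toFinset) (mf q (Nf [x].toFinset))
        (toAffs x [x].toFinset (chZero f))).1 h).1 t =
        ((toAffs x [x].toFinset (chZero f)).1 h).1 t - ((toAffs x [x].toFinset (chZero f)).1 1).1 t :=
      rfl
    have h2 : ∀ y, ((toAffs x [x].toFinset (chZero f)).1 y).1 t =
        ((mfCurry q _ (chZero f)).1 (incl _ y)).1 (fun k => incl _ (t k)) -
        ((mfCurry q _ (chZero f)).1 (FreeGroup.of x)).1 (fun k => incl _ (t k)) := fun _ => rfl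
    refine Eq.trans ?_ h1.symm
    rw [h2, h2, map_one, homs_one, sub_sub_sub_cancel_right]
    change (difL α (q + 1) 0 f).1 ([x].map (vert 1))
      (fun i => incl _ ((Fin.cons h t : Fin (q + 1) → Nf [x].toFinset) i)) =
      f.1 [] (Fin.cons (incl _ h) fun k => incl _ (t k)) - 0
    refine (difL_zero_apply f (ok_incl [x] _)).trans ?_
    rw [sub_zero]
    refine congrArg (f.1 []) (funext fun i => ?_)
    induction i using Fin.cases with
    | zero => rfl
    | succ i => rfl
  · exact hz_homRep_homRep (M := mf q (Nf [x].toFinset)) (M' := mf (q + 1) (Nf [x].toFinset))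
      (mfCurry q _) (mfCurry_eqv _ q) (hz_homRep_mf (q := q + 1) (h k hk))

end Edge

section Main

/-- Vanishing of the cohomology of multiadditive forms for all free groups up to a degree. -/
def Vanish (J : ℕ) : Prop := ∀ j ≤ J, ∀ (α : Type) [Fintype α] [DecidableEq α] (q : ℕ), 1 ≤ q →
  2 * j + q + 2 ≤ Fintype.card α → HZ (mfRep (FreeGroup α) q) j

theorem Vanish.good {J : ℕ} (h : Vanish J) (α : Type) [Fintype α] [DecidableEq α] :
    Good (MonoidHom.id (MulAut (FreeGroup α))) J (Fintype.card α) :=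
  fun j hj q hq hc => h j hj α q hq hc

variable {α : Type} [Fintype α] [DecidableEq α] {q : ℕ}

theorem Vanish.good_compl {J : ℕ} (h : Vanish J) (L : List α) {c : ℕ}
    (hc : c + L.length ≤ Fintype.card α) :
    Good (MonoidHom.id (MulAut (Nf L.toFinset))) J c := by
  intro j hj q hq hc'
  refine h.good {i // i ∉ L.toFinset} j hj q hq ?_
  have h1 := Fintype.card_subtype_compl fun i => i ∈ L.toFinset
  have h2 := L.toFinset_card_le
  rw [Fintype.card_coe] at h1
  omega

theorem Vanish.hz_chRep {J : ℕ} (h : Vanish J) (hq : 1 ≤ q) {l m : ℕ} (hm : m ≤ J)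
    (hc : 2 * m + q + 2 + l ≤ Fintype.card α) : HZ (chRep α q l) m :=
  AutFree.hz_chRep fun L => hz_orbRep
    ((h.good_compl L.1 (c := 2 * m + q + 2) (by rw [L.2]; exact hc)).hol _ m hm q hq le_rfl)

variable (α q) in
/-- Cocycles. -/
def Cyc (l : ℕ) : Submodule ℚ (Ch α q l) := LinearMap.ker (difL α q l)

variable (α q) in
/-- The action on cocycles. -/
def cycRep (l : ℕ) : Representation ℚ (MulAut (FreeGroup α)) (Cyc α q l) where
  toFun g := (chRep α q l g).restrict fun f hf => by
    rw [Cyc, LinearMap.mem_ker] at hf ⊢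
    rw [eqv_difL, hf, map_zero]
  map_one' := by ext; simp
  map_mul' g h := by ext; simp

variable (α q) in
/-- The differential as a map to cocycles. -/
def difZ (l : ℕ) : Ch α q l →ₗ[ℚ] Cyc α q (l + 1) :=
  (difL α q l).codRestrict _ fun f => Subtype.ext (dif_dif f.1)

theorem eqv_difZ (l : ℕ) : Eqv (B := Cyc α q (l + 1)) (chRep α q l) (cycRep α q (l + 1)) (difZ α q l) := fun g f =>
  Subtype.ext (eqv_difL l g f)

theorem difZ_surjective {l : ℕ} (hl : l + 1 + q < Fintype.card α) :
    Function.Surjective (difZ α q l) := by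
  rintro ⟨f, hf⟩
  obtain ⟨g, hg, h⟩ := exists_dif_eq hl f.2 (congrArg Subtype.val (LinearMap.mem_ker.1 hf))
  exact ⟨⟨g, hg⟩, Subtype.ext (Subtype.ext h)⟩

theorem ses_cyc {l : ℕ} (hl : l + 1 + q < Fintype.card α) :
    SES (A := Cyc α q l) (C := Cyc α q (l + 1)) (cycRep α q l) (chRep α q l) (cycRep α q (l + 1)) (Cyc α q l).subtype (difZ α q l) where
  eqf _ _ := rfl
  eqg := eqv_difZ l
  inj := Subtype.val_injective
  surj := difZ_surjective hl
  zero f := Subtype.ext f.2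
  exact f hf := ⟨⟨f, congrArg Subtype.val hf⟩, rfl⟩

theorem ses_edge (hl : 2 + q < Fintype.card α) :
    SES (C := Cyc α q 2) (chRep α q 0) (chRep α q 1) (cycRep α q 2) (difL α q 0) (difZ α q 1) where
  eqf := eqv_difL 0
  eqg := eqv_difZ 1
  inj := by
    rw [injective_iff_map_eq_zero]
    exact fun f hf => Subtype.ext
      (eq_zero_of_dif (by omega) f.2 (congrArg Subtype.val hf))
  surj := difZ_surjective hl
  zero f := Subtype.ext (Subtype.ext (dif_dif f.1))
  exact f hf := by
    obtain ⟨g, hg, h⟩ := exists_dif_eq (l := 0) (by omega) f.2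
      (congrArg (fun u : Cyc α q 2 => u.1.1) hf)
    exact ⟨⟨g, hg⟩, Subtype.ext h⟩

theorem Vanish.hz_cycRep {J : ℕ} (h : Vanish J) (hq : 1 ≤ q)
    (hc : 2 * J + q + 4 ≤ Fintype.card α) (m : ℕ) :
    ∀ l, 2 ≤ l → l + m = J + 2 → HZ (A := Cyc α q l) (cycRep α q l) m := by
  induction m with
  | zero =>
    intro l hl hlm
    refine hz_zero.2 fun f hf => Subtype.ext ?_
    exact hz_zero.1 (h.hz_chRep hq (l := l) (m := 0) (by omega) (by omega)) f.1
      fun g => congrArg Subtype.val (hf g)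
  | succ m ih =>
    intro l hl hlm
    exact (ses_cyc (by omega)).hz₁ (ih (l + 1) (by omega) (by omega))
      (h.hz_chRep hq (by omega) (by omega))

theorem vanish (J : ℕ) : Vanish J := by
  induction J with
  | zero =>
    intro j hj α _ _ q hq hc
    obtain rfl := Nat.le_zero.1 hj
    exact hz_mfRep_zero hq (by omega)
  | succ J ih =>
    intro j hj α _ _ q hq hc
    rcases hj.lt_or_eq with hj | rfl
    · exact ih j (by omega) α q hq hc
    obtain ⟨q, rfl⟩ : ∃ q', q = q' + 1 := ⟨q - 1, by omega⟩
    have : 0 < Fintype.card α := by omega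
    obtain ⟨x⟩ := Fintype.card_pos_iff.1 this
    have hm : Mono ((eqv_difL (α := α) (q := q + 1) 0).map (J + 1)) :=
      (ses_edge (by omega)).mono_map (ih.hz_cycRep hq (by omega) J 2 le_rfl (by omega))
    rw [map_difL_zero x] at hm
    · have hz : HZ (chRep α (q + 1) 0) (J + 1) := by
        rw [HZ, Limits.IsZero.iff_id_eq_zero, ← cancel_mono (0 : groupCohomology
          (Rep.of (chRep α (q + 1) 0)) (J + 1) ⟶ groupCohomology (Rep.of (chRep α (q + 1) 1)) (J + 1)),
          Limits.comp_zero, Limits.comp_zero]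
      exact hz.of_bijective' chZero.toLinearMap eqv_chZero chZero.bijective
    · intro k hk
      obtain rfl : J = k := by omega
      refine Good.holPi (ih.good_compl [x] (c := 2 * J + (q + 2) + 2) ?_) J le_rfl (q + 2) (by omega)
        le_rfl
      simp only [List.length_singleton]
      omega

end Main

section Dual
variable {α W : Type} [Fintype α] [DecidableEq α] [AddCommGroup W] [Module ℚ W] {q : ℕ}

theorem ιMulti_mem_extPowerMap {M N : Type} [AddCommGroup M] [Module ℚ M] [AddCommGroup N]
    [Module ℚ N] (f : M →ₗ[ℚ] N) (b : Fin q → M) :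
    extPowerMap f q (exteriorPower.ιMulti ℚ q b) = exteriorPower.ιMulti ℚ q fun i => f (b i) :=
  Subtype.ext (ExteriorAlgebra.map_apply_ιMulti f b)

/-- A representation identified with the rational characters of a free group. -/
structure IsDual (ω : Representation ℚ (MulAut (FreeGroup α)) W) (ev : FreeGroup α → W →ₗ[ℚ] ℚ)
    (a : α → W) : Prop where
  mul : ∀ u w, ev (u * w) = ev u + ev w
  eqv : ∀ g w b, ev w (ω g b) = ev (g⁻¹ w) b
  sum : ∀ b, ∑ k, ev (FreeGroup.of k) b • a k = b
  delta : ∀ j k, ev (FreeGroup.of j) (a k) = if j = k then 1 else 0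

namespace IsDual
variable {ω : Representation ℚ (MulAut (FreeGroup α)) W} {ev : FreeGroup α → W →ₗ[ℚ] ℚ}
  {a : α → W} (D : IsDual ω ev a)
include D

/-- The product of characters. -/
def pureForm : MultilinearMap ℚ (fun _ : Fin q => W) (mf q (FreeGroup α)) where
  toFun b := ⟨fun t => ∏ i, ev (t i) (b i), fun t k u w => by
    have h : ∀ v, (fun i => ev (Function.update t k v i) (b i)) =
        Function.update (fun i => ev (t i) (b i)) k (ev v (b k)) := fun v => by
      funext i
      by_cases hi : i = k
      · subst hi
        rw [Function.update_self, Function.update_self]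
      · rw [Function.update_of_ne hi, Function.update_of_ne hi]
    have h2 := (MultilinearMap.mkPiAlgebra ℚ (Fin q) ℚ).map_update_add
      (fun i => ev (t i) (b i)) k (ev u (b k)) (ev w (b k))
    simp only [MultilinearMap.mkPiAlgebra_apply] at h2
    beta_reduce
    rw [Finset.prod_congr rfl fun i _ => congrFun (h (u * w)) i,
      Finset.prod_congr rfl fun i _ => congrFun (h u) i,
      Finset.prod_congr rfl fun i _ => congrFun (h w) i, D.mul]
    exact h2⟩
  map_update_add' {inst} b k x y := Subtype.ext (funext fun t => by
    rw [Subsingleton.elim inst]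
    exact ((MultilinearMap.mkPiAlgebra ℚ (Fin q) ℚ).compLinearMap
      fun i => ev (t i)).map_update_add b k x y)
  map_update_smul' {inst} b k c x := Subtype.ext (funext fun t => by
    rw [Subsingleton.elim inst]
    exact ((MultilinearMap.mkPiAlgebra ℚ (Fin q) ℚ).compLinearMap
      fun i => ev (t i)).map_update_smul b k c x)

theorem pureForm_apply (b : Fin q → W) (t : Fin q → FreeGroup α) :
    (D.pureForm b).1 t = ∏ i, ev (t i) (b i) := rfl

theorem mfRep_pureForm (g : MulAut (FreeGroup α)) (b : Fin q → W) :
    mfRep (FreeGroup α) q g (D.pureForm b) = D.pureForm fun i => ω g (b i) := by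
  refine Subtype.ext (funext fun t => ?_)
  rw [mfRep_apply, pureForm_apply, pureForm_apply]
  simp only [D.eqv]

theorem sum_pureForm (F : mf q (FreeGroup α)) :
    ∑ s : Fin q → α, F.1 (fun i => FreeGroup.of (s i)) • D.pureForm (fun i => a (s i)) = F := by
  refine Subtype.ext (funext fun t => ?_)
  refine MultiAdd.eq_of_gens (x := []) (φ := 1) (by simp) (multiAdd_mf _ []) (multiAdd_mf F [])
    (fun s _ => ?_) t fun k v hv => by simp at hv
  rw [AddSubmonoidClass.coe_finsetSum, Finset.sum_apply]
  change ∑ s' : Fin q → α, F.1 (fun i => FreeGroup.of (s' i)) *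
    ∏ i, ev (FreeGroup.of (s i)) (a (s' i)) = F.1 fun i => FreeGroup.of (s i)
  simp only [D.delta, Fintype.prod_ite_zero]
  rw [Finset.sum_eq_single s]
  · simp
  · intro s' _ h
    rw [if_neg, mul_zero]
    exact fun h' => h (funext fun i => (h' i).symm)
  · simp

/-- Antisymmetrization of exterior powers to forms. -/
def toForm : ⋀[ℚ]^q W →ₗ[ℚ] mf q (FreeGroup α) :=
  exteriorPower.alternatingMapLinearEquiv (MultilinearMap.alternatization D.pureForm)

theorem toForm_ιMulti (b : Fin q → W) : D.toForm (exteriorPower.ιMulti ℚ q b) =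
    ∑ σ : Equiv.Perm (Fin q), Equiv.Perm.sign σ • D.pureForm fun i => b (σ i) := by
  rw [toForm, exteriorPower.alternatingMapLinearEquiv_apply_ιMulti,
    MultilinearMap.alternatization_apply]
  rfl

omit D in
/-- The map from forms to exterior powers. -/
def ofForm (a : α → W) : mf q (FreeGroup α) →ₗ[ℚ] ⋀[ℚ]^q W :=
  ∑ s : Fin q → α, ((LinearMap.proj fun i => FreeGroup.of (s i)) ∘ₗ (mf q (FreeGroup α)).subtype
    : mf q (FreeGroup α) →ₗ[ℚ] ℚ).smulRight (exteriorPower.ιMulti ℚ q fun i => a (s i))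

theorem ofForm_pureForm (b : Fin q → W) :
    ofForm a (D.pureForm b) = exteriorPower.ιMulti ℚ q b := by
  rw [ofForm, LinearMap.sum_apply]
  change ∑ s : Fin q → α, (∏ i, ev (FreeGroup.of (s i)) (b i)) •
    exteriorPower.ιMulti ℚ q (fun i => a (s i)) = _
  conv_rhs => rw [← funext fun i => D.sum (b i)]
  change _ = (exteriorPower.ιMulti ℚ q (M := W)).toMultilinearMap _
  rw [MultilinearMap.map_sum]
  exact Finset.sum_congr rfl fun s _ => (MultilinearMap.map_smul_univ _ _ _).symm

theorem eqv_toForm : Eqv (A := ⋀[ℚ]^q W) (extPowerRep ω q) (mfRep (FreeGroup α) q) D.toForm := by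
  intro g x
  refine LinearMap.congr_fun (f := D.toForm ∘ₗ extPowerRep ω q g)
    (g := mfRep (FreeGroup α) q g ∘ₗ D.toForm) (exteriorPower.linearMap_ext ?_) x
  ext b : 1
  change D.toForm (extPowerMap (ω g) q (exteriorPower.ιMulti ℚ q b)) =
    mfRep (FreeGroup α) q g (D.toForm (exteriorPower.ιMulti ℚ q b))
  rw [ιMulti_mem_extPowerMap, toForm_ιMulti, toForm_ιMulti, map_sum]
  refine Finset.sum_congr rfl fun σ _ => ?_
  rw [← mfRep_pureForm, Units.smul_def, Units.smul_def, map_zsmul]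

theorem eqv_ofForm :
    Eqv (B := ⋀[ℚ]^q W) (mfRep (FreeGroup α) q) (extPowerRep ω q) (ofForm (q := q) a) := by
  intro g F
  conv_lhs => rw [← D.sum_pureForm F]
  conv_rhs => rw [← D.sum_pureForm F]
  simp only [map_sum, map_smul]
  refine Finset.sum_congr rfl fun s _ => congrArg _ ?_
  rw [mfRep_pureForm, ofForm_pureForm, ofForm_pureForm]
  exact (ιMulti_mem_extPowerMap _ _).symm

theorem ofForm_toForm (x : ⋀[ℚ]^q W) : ofForm a (D.toForm x) = (q.factorial : ℚ) • x := by
  refine LinearMap.congr_fun (f := ofForm a ∘ₗ D.toForm)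
    (g := (q.factorial : ℚ) • LinearMap.id) (exteriorPower.linearMap_ext ?_) x
  ext b : 1
  change ofForm a (D.toForm (exteriorPower.ιMulti ℚ q b)) =
    (q.factorial : ℚ) • exteriorPower.ιMulti ℚ q b
  rw [toForm_ιMulti, map_sum]
  have h : ∀ σ : Equiv.Perm (Fin q), ofForm a (Equiv.Perm.sign σ • D.pureForm fun i => b (σ i)) =
      exteriorPower.ιMulti ℚ q b := fun σ => by
    rw [Units.smul_def, map_zsmul, ofForm_pureForm]
    have := (exteriorPower.ιMulti ℚ q (M := W)).map_perm b σ
    rw [Function.comp_def] at this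
    rw [this, Units.smul_def, smul_smul, Int.units_coe_mul_self, one_smul]
  rw [Finset.sum_congr rfl fun σ _ => h σ, Finset.sum_const, Finset.card_univ, Fintype.card_perm,
    Fintype.card_fin, Nat.cast_smul_eq_nsmul]

theorem hz_extPowerRep {i : ℕ} (h : HZ (mfRep (FreeGroup α) q) i) :
    HZ (A := ⋀[ℚ]^q W) (extPowerRep ω q) i := by
  refine HZ.retract (A := ⋀[ℚ]^q W) h D.eqv_toForm
    (r := (q.factorial : ℚ)⁻¹ • ofForm a) (fun g F => ?_) fun x => ?_
  · rw [LinearMap.smul_apply, LinearMap.smul_apply, D.eqv_ofForm g F, map_smul]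
  · rw [LinearMap.smul_apply, D.ofForm_toForm, smul_smul, inv_mul_cancel₀, one_smul]
    exact_mod_cast q.factorial_ne_zero

end IsDual

variable (n : ℕ)

/-- The class of an element in the abelianization. -/
def abClass (w : FreeGrp n) : AbH n := Additive.ofMul (Abelianization.of w)

/-- Evaluation of rational characters. -/
def evChar (w : FreeGrp n) : ℚ ⊗[ℤ] Module.Dual ℤ (AbH n) →ₗ[ℚ] ℚ :=
  LinearMap.liftBaseChange ℚ
    ((Int.castAddHom ℚ).toIntLinearMap ∘ₗ Module.Dual.eval ℤ (AbH n) (abClass n w))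

theorem evChar_tmul (w : FreeGrp n) (c : ℚ) (ξ : Module.Dual ℤ (AbH n)) :
    evChar n w (c ⊗ₜ ξ) = c * (ξ (abClass n w) : ℤ) := rfl

/-- The dual basis of the abelianization. -/
def dualGen (k : Fin n) : Module.Dual ℤ (AbH n) :=
  (MonoidHom.toAdditiveLeft (Abelianization.lift (A := Multiplicative ℤ) (FreeGroup.lift fun j : Fin n =>
    Multiplicative.ofAdd (if j = k then (1 : ℤ) else 0)))).toIntLinearMap

theorem dualGen_of (j k : Fin n) :
    dualGen n k (abClass n (FreeGroup.of j)) = if j = k then 1 else 0 := by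
  rw [dualGen, abClass, AddMonoidHom.coe_toIntLinearMap, MonoidHom.coe_toAdditiveLeft]
  simp

theorem dual_ext {ξ ξ' : Module.Dual ℤ (AbH n)}
    (h : ∀ j, ξ (abClass n (FreeGroup.of j)) = ξ' (abClass n (FreeGroup.of j))) : ξ = ξ' := by
  have h1 : MonoidHom.toAdditiveLeft.symm ξ.toAddMonoidHom =
      MonoidHom.toAdditiveLeft.symm ξ'.toAddMonoidHom :=
    Abelianization.hom_ext _ _ (FreeGroup.ext_hom _ _ fun j => congrArg Multiplicative.ofAdd (h j))
  have h2 := MonoidHom.toAdditiveLeft.symm.injective h1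
  exact LinearMap.ext fun x => DFunLike.congr_fun h2 x

theorem isDual_evChar : IsDual (ratDualRep n) (evChar n) fun k => 1 ⊗ₜ dualGen n k where
  mul u w := by
    refine LinearMap.ext fun b => ?_
    induction b using TensorProduct.induction_on with
    | zero => simp
    | add x y hx hy => rw [map_add, map_add, hx, hy]
    | tmul c ξ =>
      have : abClass n (u * w) = abClass n u + abClass n w := rfl
      rw [LinearMap.add_apply, evChar_tmul, evChar_tmul, evChar_tmul, this, map_add, Int.cast_add,
        mul_add]
  eqv g w b := by
    induction b using TensorProduct.induction_on with
    | zero => simp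
    | add x y hx hy => rw [map_add, map_add, map_add, hx, hy]
    | tmul c ξ => rfl
  sum b := by
    induction b using TensorProduct.induction_on with
    | zero => simp
    | add x y hx hy =>
      conv_rhs => rw [← hx, ← hy]
      simp only [map_add, add_smul, Finset.sum_add_distrib]
    | tmul c ξ =>
      have h : ξ = ∑ k, ξ (abClass n (FreeGroup.of k)) • dualGen n k := by
        refine dual_ext n fun j => ?_
        rw [LinearMap.sum_apply]
        simp [dualGen_of]
      conv_rhs => rw [h, TensorProduct.tmul_sum]
      refine Finset.sum_congr rfl fun k _ => ?_
      rw [evChar_tmul, TensorProduct.smul_tmul', TensorProduct.tmul_smul, TensorProduct.smul_tmul']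
      congr 1
      simp [mul_comm]
  delta j k := by
    rw [evChar_tmul, dualGen_of]
    split_ifs <;> simp

end Dual

end AutFree

/-- For every `q ≥ 1`, every `n`, and every degree `i ≥ 0` with
`2i ≤ n - 4q`, the group cohomology `H^i(Aut(F_n); Λ^q H_ℚ^*)` vanishes. -/
theorem stmt3 (q : ℕ) (hq : 1 ≤ q) (n : ℕ) (i : ℕ) (h : 2 * i + 4 * q ≤ n) :
    Limits.IsZero (groupCohomology (extPowerDualRep n q) i) :=
  (AutFree.isDual_evChar n).hz_extPowerRep
    (AutFree.vanish i i le_rfl (Fin n) q hq (by rw [Fintype.card_fin]; omega))
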